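/- Let X be a geodesic metric space. Suppose there exist ε>0 and s₀>0 such that every Lipschitz loop γ in X with length(γ) ≥ s₀ bounds a singular Lipschitz disc Σ in X with Area(Σ) ≤ ((1−ε)/(4π))·length(γ)². Then X is Gromov hyperbolic. -/

import Mathlib

open scoped NNReal ENNReal
open MeasureTheory Filter

universe u v

namespace SharpIsop

/-- The closed unit disc `D² ⊂ ℝ²`. -/
def D2 : Set (ℝ × ℝ) := {p | p.1 ^ 2 + p.2 ^ 2 ≤ 1}

/-- The length (total variation over `[0,1]`) of a curve `γ : [0,1] → X`. -/
noncomputable def loopLength {X : Type u} [PseudoEMetricSpace X] (γ : ℝ → X) : ℝ :=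
  (eVariationOn γ (Set.Icc 0 1)).toReal

/-- A Lipschitz loop in `X`: a Lipschitz map `γ : [0,1] → X` with `γ 0 = γ 1`. -/
def IsLipLoop {X : Type u} [PseudoEMetricSpace X] (γ : ℝ → X) : Prop :=
  (∃ K : ℝ≥0, LipschitzOnWith K γ (Set.Icc 0 1)) ∧ γ 0 = γ 1

/-- The metric (directional) derivative of `φ : ℝ² → X` at `x` in direction `v`,
defined via a `limsup` so that it is everywhere defined (and agrees a.e. with the
limit when the latter exists). -/
noncomputable def mder {X : Type u} [PseudoMetricSpace X] (φ : ℝ × ℝ → X)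
    (x v : ℝ × ℝ) : ℝ :=
  Filter.limsup (fun r : ℝ => dist (φ (x + r • v)) (φ x) / r) (nhdsWithin 0 (Set.Ioi 0))

/-- The Jacobian of a (semi)norm `s` on `ℝ²`:  `π / Leb²({v : s v ≤ 1})` if this set
has finite measure, `0` otherwise. -/
noncomputable def jac2 (s : ℝ × ℝ → ℝ) : ℝ :=
  if volume {v : ℝ × ℝ | s v ≤ 1} < ⊤ then
    Real.pi / (volume {v : ℝ × ℝ | s v ≤ 1}).toReal
  else 0

/-- The parametrized (Hausdorff) area of a map `φ : D² → X`. -/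
noncomputable def lipArea {X : Type u} [PseudoMetricSpace X] (φ : ℝ × ℝ → X) : ℝ :=
  ∫ x in D2, jac2 (mder φ x)

/-- `φ : D² → X` is a singular Lipschitz disc bounding the loop `γ : [0,1] → X`. -/
def BoundsLoop {X : Type u} [PseudoMetricSpace X] (φ : ℝ × ℝ → X) (γ : ℝ → X) : Prop :=
  (∃ K : ℝ≥0, LipschitzOnWith K φ D2) ∧
    ∀ s ∈ Set.Icc (0:ℝ) 1, φ (Real.cos (2 * Real.pi * s), Real.sin (2 * Real.pi * s)) = γ s

/-- `g : [0, d x y] → X` is a geodesic from `x` to `y`. -/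
def IsGeodesicSeg {X : Type u} [MetricSpace X] (x y : X) (g : ℝ → X) : Prop :=
  g 0 = x ∧ g (dist x y) = y ∧
    ∀ s ∈ Set.Icc (0:ℝ) (dist x y), ∀ t ∈ Set.Icc (0:ℝ) (dist x y),
      dist (g s) (g t) = |s - t|

/-- A geodesic metric space: any two points are joined by a geodesic. -/
def GeodesicSpace (X : Type u) [MetricSpace X] : Prop :=
  ∀ x y : X, ∃ g : ℝ → X, IsGeodesicSeg x y g

/-- Gromov hyperbolicity via δ-slim geodesic triangles. -/
def GromovHyperbolic (X : Type u) [MetricSpace X] : Prop :=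
  ∃ δ : ℝ, 0 ≤ δ ∧
    ∀ x y z : X, ∀ gxy gyz gzx : ℝ → X,
      IsGeodesicSeg x y gxy → IsGeodesicSeg y z gyz → IsGeodesicSeg z x gzx →
      ∀ s ∈ Set.Icc (0:ℝ) (dist x y),
        ∃ p ∈ gyz '' Set.Icc (0:ℝ) (dist y z) ∪ gzx '' Set.Icc (0:ℝ) (dist z x),
          dist (gxy s) p ≤ δ

/-- `L^∞(X)`: the Banach space of bounded real functions on `X` with sup norm. -/
abbrev Linfty (X : Type u) : Type u := lp (fun _ : X => ℝ) ⊤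

/-- The Kuratowski embedding `x ↦ d(x,·) − d(x₀,·)` of `X` into `L^∞(X)`. -/
noncomputable def kuratowski (X : Type u) [MetricSpace X] (x₀ : X) (x : X) : Linfty X :=
  ⟨fun y => dist x y - dist x₀ y, memℓp_infty ⟨dist x x₀, by
    rintro t ⟨y, rfl⟩
    simpa [Real.norm_eq_abs] using abs_dist_sub_le x x₀ y⟩⟩

/-- `Y` admits a quadratic isoperimetric inequality for curves (with singular
Lipschitz discs as fillings). -/
def QuadIsopSpace (Y : Type u) [MetricSpace Y] : Prop :=
  ∃ C > (0:ℝ), ∀ c : ℝ → Y, IsLipLoop c →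
    ∃ φ : ℝ × ℝ → Y, BoundsLoop φ c ∧ lipArea φ ≤ C * (loopLength c) ^ 2

/-- `X` admits a disc-thickening with a quadratic isoperimetric inequality. -/
def HasDiscThickeningQII (X : Type u) [MetricSpace X] : Prop :=
  ∃ (X' : Type u) (m : MetricSpace X') (ι : X → X'),
    letI := m
    CompleteSpace X' ∧ Isometry ι ∧
      EMetric.hausdorffEdist (Set.range ι) (Set.univ : Set X') ≠ ⊤ ∧
      QuadIsopSpace X'

section
open scoped Real
open Set (Ioi mem_ofPred_eq mem_empty_iff_false Icc eq_empty_or_nonempty mem_preimage Ioc indicator_of_mem indicator_of_notMem ofPred_forall uIcc Ioo EqOn mem_Ioi mem_biUnion mem_inv_smul_set_iff₀ left_mem_Icc right_mem_Icc uIcc_of_le uIcc_of_ge)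
open Finset (range sum_range_succ sum_nonneg sum_add_distrib sum_congr mul_sum sum_eq_zero mem_range sum_mul sum_sub_distrib sum_le_sum mem_filter sum_const card_range sum_range_sub sum_range_add)
open Real (sq_sqrt volume_Icc exp exp_pos sqrt_nonneg measurable_exp norm_eq_abs pi_pos dist_eq cos sin sin_sq_add_cos_sq smoothTransition two_pi_pos norm_of_nonneg)
open ENNReal (ofReal ofReal_mul ofReal_pow toReal_nonneg toReal_le_of_le_ofReal ofReal_toReal toReal_mul toReal_mono ofReal_le_ofReal ofReal_add ofReal_le_ofReal_iff ofReal_ne_top toReal_ofReal ofReal_pos)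
open Metric (ball isClosed_closedBall closedBall mem_closedBall infDist)
local notation "RR" => ℝ × ℝ
local notation "LL" => (by linarith)
local notation "PP" => (by positivity)
local notation "NN" => (by norm_num)
local notation "SP" => (by simp)
local notation "FP" => (by fun_prop)
local notation "OM" => (by omega)

lemma bm1 {A B C : Set ℝ} (hA : MeasurableSet A) (hB : MeasurableSet B) (hAn : A.Nonempty)
    (hBn : B.Nonempty) (h : ∀ a ∈ A, ∀ b ∈ B, (a + b) / 2 ∈ C) :
    volume A + volume B ≤ 2 * volume C := by
  obtain ⟨a0, ha0⟩ := hAn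
  obtain ⟨b0, hb0⟩ := hBn
  have key : ∀ K ⊆ A, IsCompact K → ∀ L ⊆ B, IsCompact L → K.Nonempty → L.Nonempty →
      volume K + volume L ≤ 2 * volume C := by
    intro K hK cK L hL cL nK nL
    obtain ⟨a, ha⟩ := cK.exists_isGreatest nK
    obtain ⟨b, hb⟩ := cL.exists_isLeast nL
    have h1 : volume ((fun x => b + x) '' K ∪ (fun x => a + x) '' L) ≤
        volume ((fun x => (2:ℝ) * x) '' C) := by
      apply measure_mono
      rintro _ (⟨x, hx, rfl⟩ | ⟨x, hx, rfl⟩)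
      · exact ⟨_, h x (hK hx) b (hL hb.1), by ring⟩
      · exact ⟨_, h a (hK ha.1) x (hL hx), by ring⟩
    have h2 : volume ((fun x => (2:ℝ) * x) '' C) = 2 * volume C := by
      have := Measure.addHaar_smul (volume : Measure ℝ) (2:ℝ) C
      rw [← Set.image_smul] at this
      simpa using this
    rw [← h2]
    refine le_trans ?_ h1
    rw [measure_union₀']
    · simp
    · exact (cK.image FP).measurableSet.nullMeasurableSet
    · apply measure_mono_null (t := {a + b}) _ SP
      rintro _ ⟨⟨x, hx, rfl⟩, ⟨y, hy, hxy⟩⟩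
      simp only [Set.mem_singleton_iff] at hxy ⊢
      have := ha.2 hx; have := hb.2 hy; linarith
  have k2 : ∀ K ⊆ A, IsCompact K → ∀ L ⊆ B, IsCompact L →
      volume K + volume L ≤ 2 * volume C := by
    intro K hK cK L hL cL
    refine le_trans ?_ (key (insert a0 K) (Set.insert_subset ha0 hK) (cK.insert _)
      (insert b0 L) (Set.insert_subset hb0 hL) (cL.insert _) ⟨_, Set.mem_insert _ _⟩
      ⟨_, Set.mem_insert _ _⟩)
    gcongr <;> exact Set.subset_insert _ _
  by_contra hc
  rw [not_le] at hc
  obtain ⟨p, q, hp, hq, hpq⟩ : ∃ p q, (p < volume A ∨ p = 0) ∧ (q < volume B ∨ q = 0) ∧ 2 * volume C < p + q := by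
    rcases eq_or_ne (volume A) 0 with hA0 | hA0
    · obtain ⟨q, hq, hq2⟩ := exists_between hc
      rw [hA0, zero_add] at hq2
      exact ⟨0, q, Or.inr rfl, Or.inl hq2, by simpa using hq⟩
    rcases eq_or_ne (volume B) 0 with hB0 | hB0
    · obtain ⟨q, hq, hq2⟩ := exists_between hc
      rw [hB0, add_zero] at hq2
      exact ⟨q, 0, Or.inl hq2, Or.inr rfl, by simpa using hq⟩
    obtain ⟨p, hp, q, hq, hpq⟩ := ENNReal.exists_lt_add_of_lt_add hc hA0 hB0
    grind
  have ex : ∀ {S : Set ℝ} {p : ℝ≥0∞}, MeasurableSet S → (p < volume S ∨ p = 0) →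
      ∃ K ⊆ S, IsCompact K ∧ p ≤ volume K := by
    intro S p hS hp
    rcases hp with hp | hp
    · obtain ⟨K, h1, h2, h3⟩ := hS.exists_lt_isCompact hp
      grind
    · exact ⟨∅, by simp, isCompact_empty, by simp [hp]⟩
  obtain ⟨K, hK, cK, h1⟩ := ex hA hp
  obtain ⟨L, hL, cL, h2⟩ := ex hB hq
  exact absurd (k2 K hK cK L hL cL) (not_le.2 (lt_of_lt_of_le hpq (add_le_add h1 h2)))

lemma amgm {x y z : ℝ≥0∞} (h : x + y ≤ 2 * z) : x * y ≤ z ^ 2 := by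
  rcases eq_or_ne z ⊤ with rfl | hz
  · simp
  have h2 : x + y ≠ ⊤ := ne_top_of_le_ne_top (ENNReal.mul_ne_top SP hz) h
  have hx := (ENNReal.add_ne_top.1 h2).1
  have hy := (ENNReal.add_ne_top.1 h2).2
  lift x to ℝ≥0 using hx
  lift y to ℝ≥0 using hy
  lift z to ℝ≥0 using hz
  norm_cast at h ⊢
  have : (x:ℝ) * y ≤ z ^ 2 := by nlinarith [sq_nonneg ((x:ℝ) - y), x.2, y.2, z.2]
  exact_mod_cast this

lemma prekopa {F G H : ℝ → ℝ} (mF : Measurable F) (mG : Measurable G) (mH : Measurable H)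
    (F0 : ∀ u, 0 ≤ F u) (G0 : ∀ u, 0 ≤ G u) (H0 : ∀ u, 0 ≤ H u)
    (bF : BddAbove (Set.range F)) (bG : BddAbove (Set.range G))
    (h : ∀ u v, F u * G v ≤ H ((u + v) / 2) ^ 2) :
    (∫⁻ u, ofReal (F u)) * (∫⁻ u, ofReal (G u)) ≤
      (∫⁻ u, ofReal (H u)) ^ 2 := by
  set a := ⨆ u, F u with ha
  set b := ⨆ u, G u with hb
  have hFa : ∀ u, F u ≤ a := fun u => le_ciSup bF u
  have hGb : ∀ u, G u ≤ b := fun u => le_ciSup bG u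
  rcases (le_trans (F0 0) (hFa 0)).eq_or_lt with h0 | ha0
  · have : ∀ u, F u = 0 := fun u => le_antisymm (h0 ▸ hFa u) (F0 u)
    simp [this]
  rcases (le_trans (G0 0) (hGb 0)).eq_or_lt with h0 | hb0
  · have : ∀ u, G u = 0 := fun u => le_antisymm (h0 ▸ hGb u) (G0 u)
    simp [this]
  set c := √(a * b) with hc
  have hc0 : 0 < c := by positivity
  have hcc : c ^ 2 = a * b := sq_sqrt PP
  have LC : ∀ {P : ℝ → ℝ} {d : ℝ}, Measurable P → (∀ u, 0 ≤ P u) → 0 < d →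
      ∫⁻ u, ofReal (P u) =
        ofReal d * ∫⁻ t in Ioi (0:ℝ), volume {u | t < P u / d} := by
    intro P d mP P0 hd
    rw [← lintegral_eq_lintegral_meas_lt volume (f := fun u => P u / d)
      (.of_forall fun u => div_nonneg (P0 u) hd.le) (mP.div_const d).aemeasurable,
      ← lintegral_const_mul _ FP]
    congr 1 with u
    rw [← ofReal_mul hd.le]; congr 1; field_simp
  rw [LC mF F0 ha0, LC mG G0 hb0, LC mH H0 hc0, mul_pow, mul_mul_mul_comm,
    ← ofReal_mul ha0.le, ← ofReal_pow hc0.le, hcc]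
  gcongr
  apply amgm
  have mm : ∀ P : ℝ → ℝ, Measurable fun t => volume {u | t < P u} := fun P =>
    Antitone.measurable fun s t hst => measure_mono fun u (hu : t < P u) => lt_of_le_of_lt hst hu
  rw [← lintegral_add_left (mm _), ← lintegral_const_mul _ (mm _)]
  refine setLIntegral_mono (by exact (mm _).const_mul _) ?_
  intro t ht
  have ht : 0 < t := ht
  rcases lt_or_ge t 1 with h1 | h1
  · apply bm1 (measurableSet_lt measurable_const (mF.div_const _))
      (measurableSet_lt measurable_const (mG.div_const _))
    · obtain ⟨u, hu⟩ := exists_lt_of_lt_ciSup (show t * a < ⨆ u, F u by rw [← ha]; nlinarith)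
      exact ⟨u, by simpa [lt_div_iff₀ ha0] using hu⟩
    · obtain ⟨u, hu⟩ := exists_lt_of_lt_ciSup (show t * b < ⨆ u, G u by rw [← hb]; nlinarith)
      exact ⟨u, by simpa [lt_div_iff₀ hb0] using hu⟩
    · intro u hu v hv
      simp only [mem_ofPred_eq, lt_div_iff₀ ha0, lt_div_iff₀ hb0, lt_div_iff₀ hc0] at hu hv ⊢
      apply lt_of_pow_lt_pow_left₀ 2 (H0 _)
      refine lt_of_lt_of_le ?_ (h u v)
      rw [mul_pow, hcc]
      have := mul_lt_mul'' hu hv PP PP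
      nlinarith
  · have e1 : {u | t < F u / a} = ∅ := by
      ext u; simp only [mem_ofPred_eq, mem_empty_iff_false, iff_false, not_lt]
      exact le_trans ((div_le_one ha0).2 (hFa u)) h1
    have e2 : {u | t < G u / b} = ∅ := by
      ext u; simp only [mem_ofPred_eq, mem_empty_iff_false, iff_false, not_lt]
      exact le_trans ((div_le_one hb0).2 (hGb u)) h1
    rw [e1, e2]; simp

noncomputable def slc (A : Set RR) (x : ℝ) : ℝ := (volume (Prod.mk x ⁻¹' A)).toReal

lemma slc_nonneg (A : Set RR) (x : ℝ) : 0 ≤ slc A x := toReal_nonneg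

lemma cpt_box {A : Set RR} (hA : IsCompact A) :
    ∃ R : ℝ, 0 < R ∧ ∀ p ∈ A, |p.1| ≤ R ∧ |p.2| ≤ R := by
  obtain ⟨R, hR, h⟩ := hA.isBounded.exists_pos_norm_le
  refine ⟨R, hR, fun p hp => ⟨?_, ?_⟩⟩
  · exact le_trans (norm_fst_le p) (h p hp)
  · exact le_trans (norm_snd_le p) (h p hp)

lemma slc_top {A : Set RR} (hA : IsCompact A) (x : ℝ) : volume (Prod.mk x ⁻¹' A) ≠ ⊤ := by
  obtain ⟨R, hR, h⟩ := cpt_box hA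
  refine ne_top_of_le_ne_top (b := volume (Icc (-R) R)) SP (measure_mono ?_)
  grind

lemma slc_bdd {A : Set RR} (hA : IsCompact A) :
    ∃ R : ℝ, 0 < R ∧ (∀ x, slc A x ≤ R) ∧ ∀ x, R < |x| → slc A x = 0 := by
  obtain ⟨R, hR, h⟩ := cpt_box hA
  refine ⟨2 * R, by linarith, fun x => ?_, fun x hx => ?_⟩
  · have : volume (Prod.mk x ⁻¹' A) ≤ volume (Icc (-R) R) :=
      measure_mono fun y hy => abs_le.1 (h _ hy).2
    rw [volume_Icc] at this
    refine toReal_le_of_le_ofReal LL (this.trans (le_of_eq (by ring_nf)))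
  · have : Prod.mk x ⁻¹' A = ∅ := by
      grind
    simp [slc, this]

lemma slc_meas {A : Set RR} (hA : IsCompact A) : Measurable (slc A) :=
  (measurable_measure_prodMk_left hA.measurableSet).ennreal_toReal

lemma slc_int {A : Set RR} (hA : IsCompact A) :
    ∫⁻ x, ofReal (slc A x) = volume A := by
  rw [Measure.volume_eq_prod, Measure.prod_apply hA.measurableSet]
  congr 1 with x
  exact ofReal_toReal (slc_top hA x)

lemma bm2 {A B C : Set RR} (hA : IsCompact A) (hB : IsCompact B) (hC : IsCompact C)
    (h : ∀ a ∈ A, ∀ b ∈ B, (2⁻¹ : ℝ) • (a + b) ∈ C) : volume A * volume B ≤ volume C ^ 2 := by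
  rw [← slc_int hA, ← slc_int hB, ← slc_int hC]
  have bd : ∀ {A : Set RR}, IsCompact A → BddAbove (Set.range (slc A)) := by
    intro A hA
    obtain ⟨R, -, h, -⟩ := slc_bdd hA
    exact ⟨R, by rintro _ ⟨x, rfl⟩; exact h x⟩
  refine prekopa (slc_meas hA) (slc_meas hB) (slc_meas hC) (slc_nonneg A) (slc_nonneg B)
    (slc_nonneg C) (bd hA) (bd hB) fun u v => ?_
  rcases eq_empty_or_nonempty (Prod.mk u ⁻¹' A) with e | ne
  · simp only [slc, e]; simp
  rcases eq_empty_or_nonempty (Prod.mk v ⁻¹' B) with e | ne'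
  · simp only [slc, e]; simp
  have h1 := amgm (bm1 (A := Prod.mk u ⁻¹' A) (B := Prod.mk v ⁻¹' B)
    (C := Prod.mk ((u + v) / 2) ⁻¹' C) (measurable_prodMk_left hA.measurableSet)
    (measurable_prodMk_left hB.measurableSet) ne ne' (by
      intro a ha b hb
      have := h _ ha _ hb
      simp only [mem_preimage]
      convert this using 1
      ext <;> simp <;> ring))
  simp only [slc]
  rw [← toReal_mul, ← ENNReal.toReal_pow]
  exact toReal_mono (ENNReal.pow_ne_top (slc_top hC _)) h1

lemma exp_subst (f : ℝ → ℝ) :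
    ∫⁻ x in Ioi (0:ℝ), ofReal (f x) =
      ∫⁻ u, ofReal (exp u * f (exp u)) := by
  have := lintegral_image_eq_lintegral_abs_deriv_mul (s := Set.univ) MeasurableSet.univ
    (fun x _ => (Real.hasDerivAt_exp x).hasDerivWithinAt) Real.exp_injective.injOn
    (fun x => ofReal (f x))
  rw [Set.image_univ, Real.range_exp] at this
  rw [this, Measure.restrict_univ]
  congr 1 with u
  rw [abs_of_pos (exp_pos u), ofReal_mul (exp_pos u).le]

lemma quarter : ∫⁻ w in Ioi (0:ℝ), ofReal √(2 - w ^ 2) ≤ ofReal (π / 2) := by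
  have hc : Continuous fun w : ℝ => √(2 - w ^ 2) := by fun_prop
  have h0 : ∀ w : ℝ, √2 < w → √(2 - w ^ 2) = 0 := by
    intro w hw
    apply Real.sqrt_eq_zero_of_nonpos
    have := sq_sqrt (show (0:ℝ) ≤ 2 by norm_num)
    nlinarith [sqrt_nonneg 2]
  have e1 : ∫⁻ w in Ioi (0:ℝ), ofReal √(2 - w ^ 2) =
      ∫⁻ w in Ioc (0:ℝ) (√2), ofReal √(2 - w ^ 2) := by
    rw [← Set.Ioc_union_Ioi_eq_Ioi (sqrt_nonneg 2),
      lintegral_union measurableSet_Ioi (by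
        simp)]
    rw [setLIntegral_congr_fun (g := fun _ => 0) measurableSet_Ioi
      (fun w hw => by simp only; rw [h0 w hw, ENNReal.ofReal_zero])]
    simp
  have hi : IntervalIntegrable (fun w : ℝ => √(2 - w ^ 2)) volume 0 √2 := hc.intervalIntegrable _ _
  rw [e1, ← ofReal_integral_eq_lintegral_ofReal, ← intervalIntegral.integral_of_le (sqrt_nonneg 2)]
  · apply ofReal_le_ofReal
    apply le_of_eq
    have h1 := intervalIntegral.mul_integral_comp_mul_left (a := (0:ℝ)) (b := 1)
      (f := fun w : ℝ => √(2 - w ^ 2)) √2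
    simp only [mul_zero, mul_one] at h1
    rw [← h1]
    have h2 : ∀ x : ℝ, √(2 - (√2 * x) ^ 2) = √2 * √(1 - x ^ 2) := by
      intro x
      rw [← Real.sqrt_mul NN, mul_pow, sq_sqrt NN]; ring_nf
    simp_rw [h2]
    rw [intervalIntegral.integral_const_mul, ← mul_assoc, Real.mul_self_sqrt NN]
    have h3 := integral_sqrt_one_sub_sq
    have hc1 : Continuous fun w : ℝ => √(1 - w ^ 2) := by fun_prop
    rw [← intervalIntegral.integral_add_adjacent_intervals (b := 0) (hc1.intervalIntegrable _ _)
      (hc1.intervalIntegrable _ _)] at h3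
    have h4 := intervalIntegral.integral_comp_neg (a := (0:ℝ)) (b := 1) (fun w : ℝ => √(1 - w ^ 2))
    simp only [neg_sq, neg_zero] at h4
    linarith
  · exact (intervalIntegrable_iff_integrableOn_Ioc_of_le (sqrt_nonneg 2)).1 hi
  · exact .of_forall fun w => sqrt_nonneg _

lemma half_int {B : Set RR} (hB : IsCompact B) (sB : ∀ x ∈ B, -x ∈ B) :
    volume B = 2 * ∫⁻ x in Ioi (0:ℝ), ofReal (slc B x) := by
  have ev : ∀ x, slc B (-x) = slc B x := by
    intro x
    have : Prod.mk (-x) ⁻¹' B = Neg.neg ⁻¹' (Prod.mk x ⁻¹' B) := by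
      ext y; simp only [mem_preimage]
      constructor <;> intro h <;> simpa using sB _ h
    simp only [slc, this]
    simp
  rw [← slc_int hB, two_mul]
  rw [← lintegral_add_compl _ (measurableSet_Ioi (a := (0:ℝ)))]
  congr 1
  rw [Set.compl_Ioi, setLIntegral_congr (Iio_ae_eq_Iic (a := (0:ℝ)) (μ := volume)).symm]
  have := (Measure.measurePreserving_neg (volume : Measure ℝ)).setLIntegral_comp_preimage_emb
    (MeasurableEquiv.neg ℝ).measurableEmbedding (fun x => ofReal (slc B x)) (Set.Iio 0)
  rw [← this]
  simp [ev]

lemma santalo {B K : Set RR} (hB : IsCompact B) (hK : IsCompact K)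
    (sB : ∀ x ∈ B, -x ∈ B) (sK : ∀ x ∈ K, -x ∈ K)
    (h : ∀ x ∈ B, ∀ ξ ∈ K, x.1 * ξ.1 + x.2 * ξ.2 ≤ 1) :
    volume B * volume K ≤ ofReal (π ^ 2) := by
  set K' : Set RR := Prod.swap '' K with hK'
  have cK' : IsCompact K' := hK.image continuous_swap
  have vK : volume K' = volume K := by
    rw [hK', Set.image_swap_eq_preimage_swap, Measure.volume_eq_prod]
    exact (Measure.measurePreserving_swap (μ := (volume : Measure ℝ)) (ν := (volume : Measure ℝ))).measure_preimage_equiv (f := MeasurableEquiv.prodComm) K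
  have sK' : ∀ x ∈ K', -x ∈ K' := by
    rintro _ ⟨y, hy, rfl⟩; exact ⟨-y, sK y hy, by simp⟩
  obtain ⟨R, hR, L1, L2⟩ := slc_bdd hB
  obtain ⟨T, hT, M1, M2⟩ := slc_bdd cK'
  set L := slc B
  set M := slc K'
  have xM : ∀ x > 0, ∀ η > 0, (Prod.mk x ⁻¹' B).Nonempty → (Prod.mk η ⁻¹' K').Nonempty →
      x * M η + η * L x ≤ 2 := by
    intro x hx η hη ne ne'
    have sc : ∀ (c : ℝ) (S : Set ℝ), 0 < c → volume ((fun y => c * y) '' S) = ofReal c * volume S := by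
      intro c S hc
      have := Measure.addHaar_smul (volume : Measure ℝ) c S
      rw [← Set.image_smul] at this
      simpa [abs_of_pos hc] using this
    have := bm1 (A := (fun y => x * y) '' (Prod.mk η ⁻¹' K')) (B := (fun y => η * y) '' (Prod.mk x ⁻¹' B))
      (C := Icc (-1/2) (1/2))
      (((measurableEmbedding_mulLeft₀ hx.ne').measurableSet_image).2
        (measurable_prodMk_left cK'.measurableSet))
      (((measurableEmbedding_mulLeft₀ hη.ne').measurableSet_image).2
        (measurable_prodMk_left hB.measurableSet)) (ne'.image _) (ne.image _) (by
        rintro _ ⟨ξ, ⟨ζ, hζ, hζ'⟩, rfl⟩ _ ⟨y, hy, rfl⟩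
        have e1 : ζ.1 = ξ := congrArg Prod.snd hζ'
        have e2 : ζ.2 = η := congrArg Prod.fst hζ'
        have h1 := h _ hy ζ hζ
        have h2 := h _ hy _ (sK ζ hζ)
        simp only [e1, e2, Prod.fst_neg, Prod.snd_neg] at h1 h2
        constructor <;> linarith)
    rw [sc _ _ hx, sc _ _ hη, volume_Icc] at this
    rw [← ofReal_toReal (slc_top cK' η), ← ofReal_toReal (slc_top hB x),
      ← ofReal_mul hx.le, ← ofReal_mul hη.le, ← ofReal_add
      PP PP] at this
    have h2 : (2:ℝ≥0∞) * ofReal (1/2 - -1/2) = ofReal 2 := by norm_num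
    rw [h2] at this
    exact (ofReal_le_ofReal_iff NN).1 this
  set n : ℝ → ℝ := fun ξ => (volume.restrict (Ioi (0:ℝ)) {η | ξ < M η}).toReal with hn
  have nsub : ∀ ξ > 0, {η | ξ < M η} ⊆ Icc (-T) T := by
    intro ξ hξ η hη
    grind
  have ntop : ∀ ξ > 0, volume.restrict (Ioi (0:ℝ)) {η | ξ < M η} ≤ ofReal (2 * T) := by
    intro ξ hξ
    refine (Measure.restrict_apply_le _ _).trans ((measure_mono (nsub ξ hξ)).trans ?_)
    rw [volume_Icc]; ring_nf; rfl
  have mn : Measurable n := by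
    apply Measurable.ennreal_toReal
    exact Antitone.measurable fun s t hst => measure_mono fun u (hu : t < M u) => lt_of_le_of_lt hst hu
  have hMn : ∫⁻ η in Ioi (0:ℝ), ofReal (M η) = ∫⁻ ξ in Ioi (0:ℝ), ofReal (n ξ) := by
    rw [lintegral_eq_lintegral_meas_lt _ (.of_forall fun u => slc_nonneg _ u)
      (slc_meas cK').aemeasurable]
    refine setLIntegral_congr_fun measurableSet_Ioi fun ξ hξ => ?_
    exact (ofReal_toReal (ne_top_of_le_ne_top ofReal_ne_top (ntop ξ hξ))).symm
  have Ln : ∀ x > 0, ∀ ξ > 0, L x * n ξ ≤ √(2 - x * ξ) ^ 2 := by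
    intro x hx ξ hξ
    rcases (slc_nonneg B x).eq_or_lt with h0 | h0
    · change 0 = L x at h0
      rw [← h0, zero_mul]; positivity
    change 0 < L x at h0
    have ne : (Prod.mk x ⁻¹' B).Nonempty := by
      rw [Set.nonempty_iff_ne_empty]; intro e; simp [L, slc, e] at h0
    have sub : ∀ η > 0, ξ < M η → η ≤ (2 - x * ξ) / L x := by
      intro η hη hM
      have ne' : (Prod.mk η ⁻¹' K').Nonempty := by
        rw [Set.nonempty_iff_ne_empty]; intro e; simp [M, slc, e] at hM; linarith
      have := xM x hx η hη ne ne'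
      rw [le_div_iff₀ h0]; nlinarith
    rcases eq_empty_or_nonempty {η | 0 < η ∧ ξ < M η} with e | ⟨η0, hη0, hη1⟩
    · have : volume.restrict (Ioi (0:ℝ)) {η | ξ < M η} = 0 := by
        rw [Measure.restrict_apply (measurableSet_lt measurable_const (slc_meas cK'))]
        rw [show {η | ξ < M η} ∩ Ioi 0 = {η | 0 < η ∧ ξ < M η} by ext; simp [and_comm], e]; simp
      simp only [hn, this]; simp
    · have h2 := sub _ hη0 hη1
      have h3 : 0 < 2 - x * ξ := by
        by_contra hc
        have := div_nonpos_of_nonpos_of_nonneg (not_lt.1 hc) h0.le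
        linarith
      rw [sq_sqrt h3.le, mul_comm, ← le_div_iff₀ h0]
      apply toReal_le_of_le_ofReal PP
      rw [Measure.restrict_apply (measurableSet_lt measurable_const (slc_meas cK'))]
      refine (measure_mono (t := Icc 0 ((2 - x * ξ) / L x)) ?_).trans SP
      grind
  have main := prekopa (F := fun u => exp u * L (exp u)) (G := fun u => exp u * n (exp u))
    (H := fun u => exp u * √(2 - exp u ^ 2))
    (measurable_exp.mul ((slc_meas hB).comp measurable_exp))
    (measurable_exp.mul (mn.comp measurable_exp)) FP
    (fun u => mul_nonneg (exp_pos u).le (slc_nonneg _ _))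
    (fun u => mul_nonneg (exp_pos u).le toReal_nonneg)
    (fun u => by positivity)
    ⟨R * R, by
      rintro _ ⟨u, rfl⟩
      simp only
      rcases le_or_gt (exp u) R with h1 | h1
      · exact mul_le_mul h1 (L1 _) (slc_nonneg _ _) hR.le
      · rw [L2 _ (by rwa [abs_of_pos (exp_pos u)]), mul_zero]; positivity⟩
    ⟨T * (2 * T), by
      rintro _ ⟨u, rfl⟩
      simp only
      rcases le_or_gt (exp u) T with h1 | h1
      · exact mul_le_mul h1 (toReal_le_of_le_ofReal PP (ntop _ (exp_pos u)))
          toReal_nonneg hT.le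
      · have : {η | exp u < M η} = ∅ := by
          grind
        simp only [hn, this]; simp; positivity⟩
    (by
      intro u v
      have e : exp ((u + v) / 2) ^ 2 = exp u * exp v := by
        rw [← Real.exp_nat_mul, ← Real.exp_add]; congr 1; push_cast; ring
      rw [mul_pow, e]
      have := Ln _ (exp_pos u) _ (exp_pos v)
      nlinarith)
  rw [← exp_subst L, ← exp_subst n, ← exp_subst (fun w => √(2 - w ^ 2)), ← hMn] at main
  rw [← vK, half_int hB sB, half_int cK' sK']
  calc _ = 4 * ((∫⁻ x in Ioi (0:ℝ), ofReal (slc B x)) *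
        ∫⁻ x in Ioi (0:ℝ), ofReal (slc K' x)) := by ring
    _ ≤ 4 * (ofReal (π / 2)) ^ 2 := by
      gcongr
      exact main.trans (by gcongr; exact quarter)
    _ = _ := by
      rw [← ofReal_pow PP, show (4:ℝ≥0∞) = ofReal 4 by simp,
        ← ofReal_mul NN]
      congr 1; ring

section
open Pointwise
def wd (a b : RR) : ℝ := a.1 * b.2 - a.2 * b.1

def dil (E : Set RR) (c : RR) : Set RR := E + (fun t : ℝ => t • c) '' Icc (-1) 1

lemma mem_dil {E : Set RR} {c x : RR} :
    x ∈ dil E c ↔ ∃ t ∈ Icc (-1:ℝ) 1, x - t • c ∈ E := by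
  constructor
  · rintro ⟨e, he, _, ⟨t, ht, rfl⟩, rfl⟩; exact ⟨t, ht, by simpa using he⟩
  · rintro ⟨t, ht, h⟩; exact ⟨_, h, _, ⟨t, ht, rfl⟩, by simp⟩

lemma sub_dil {E : Set RR} {c : RR} : E ⊆ dil E c := fun x hx =>
  mem_dil.2 ⟨0, by simp, by simpa using hx⟩

lemma dil_slice {S : Set ℝ} (h1 : IsCompact S) (h2 : Convex ℝ S) (h3 : S.Nonempty) :
    volume {y | ∃ t ∈ Icc (-1:ℝ) 1, y - t ∈ S} = volume S + 2 := by
  have e := eq_Icc_of_connected_compact ⟨h3, h2.isPreconnected⟩ h1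
  set a := sInf S
  set b := sSup S
  have hab : a ≤ b := by
    simp_all
  have : {y | ∃ t ∈ Icc (-1:ℝ) 1, y - t ∈ S} = Icc (a - 1) (b + 1) := by
    rw [e]; ext y; simp only [mem_ofPred_eq, Set.mem_Icc]
    constructor
    · grind
    · rintro ⟨h1, h2⟩
      refine ⟨y - max a (min y b), ⟨?_, ?_⟩, ?_, ?_⟩
      · simp_all
      · grind
      · simp
      · simp [hab]
  rw [this, e, volume_Icc, volume_Icc, show (2:ℝ≥0∞) = ofReal 2 by simp,
    ← ofReal_add LL NN]
  congr 1; ring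

noncomputable def linM (d c : RR) : RR →ₗ[ℝ] RR :=
  Matrix.toLin (Module.Basis.finTwoProd ℝ) (Module.Basis.finTwoProd ℝ) !![d.1, c.1; d.2, c.2]

lemma linM_apply (d c p : RR) : linM d c p = p.1 • d + p.2 • c := by
  rw [linM, Matrix.toLin_finTwoProd_apply]; ext <;> simp <;> ring

lemma linM_det (d c : RR) : LinearMap.det (linM d c) = wd d c := by
  rw [linM, LinearMap.det_toLin, Matrix.det_fin_two_of, wd]; ring

lemma exists_dual {c : RR} (hc : c ≠ 0) : ∃ d, wd d c = 1 := by
  have : c.1 ^ 2 + c.2 ^ 2 ≠ 0 := by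
    intro h
    apply hc
    ext
    · simp only [Prod.fst_zero]; nlinarith [sq_nonneg c.1, sq_nonneg c.2]
    · simp only [Prod.snd_zero]; nlinarith [sq_nonneg c.1, sq_nonneg c.2]
  refine ⟨(c.2 / (c.1 ^ 2 + c.2 ^ 2), -c.1 / (c.1 ^ 2 + c.2 ^ 2)), ?_⟩
  simp only [wd]; field_simp; ring

lemma vol_slices {d c : RR} (h : wd d c = 1) {E : Set RR} (hE : IsCompact E) :
    volume E = ∫⁻ x : ℝ, volume {y : ℝ | x • d + y • c ∈ E} := by
  have h1 := Measure.addHaar_preimage_linearMap (volume : Measure RR) (f := linM d c)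
    (by rw [linM_det, h]; norm_num) E
  rw [linM_det, h] at h1
  simp only [inv_one, abs_one, ENNReal.ofReal_one, one_mul] at h1
  rw [← h1, Measure.volume_eq_prod, Measure.prod_apply]
  · congr 1 with x
    congr 1; ext y; simp [linM_apply]
  · exact hE.measurableSet.preimage (LinearMap.continuous_of_finiteDimensional _).measurable

lemma dil_cpt {E : Set RR} {c : RR} (hE : IsCompact E) : IsCompact (dil E c) :=
  hE.add (isCompact_Icc.image FP)

lemma dil_conv {E : Set RR} {c : RR} (hE : Convex ℝ E) : Convex ℝ (dil E c) :=
  hE.add ((convex_Icc (-1:ℝ) 1).is_linear_image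
    ⟨fun x y => add_smul x y c, fun a x => by simp [mul_smul]⟩)

lemma dil_symm {E : Set RR} {c : RR} (hE : ∀ x ∈ E, -x ∈ E) : ∀ x ∈ dil E c, -x ∈ dil E c := by
  intro x hx
  obtain ⟨t, ht, h⟩ := mem_dil.1 hx
  refine mem_dil.2 ⟨-t, ⟨by linarith [ht.2], by linarith [ht.1]⟩, ?_⟩
  have := hE _ h
  convert this using 1
  rw [neg_smul]; abel

lemma slice_cpt {d c : RR} (h : wd d c = 1) {E : Set RR} (hE : IsCompact E) (x : ℝ) :
    IsCompact {y : ℝ | x • d + y • c ∈ E} := by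
  refine (hE.image (f := fun p => wd d p) (by unfold wd; fun_prop)).of_isClosed_subset
    (hE.isClosed.preimage (f := fun y : ℝ => x • d + y • c) FP) ?_
  intro y hy
  refine ⟨_, hy, ?_⟩
  simp only [wd, Prod.fst_add, Prod.snd_add, Prod.smul_fst, Prod.smul_snd, smul_eq_mul] at h ⊢
  linear_combination y * h

lemma slice_conv {d c : RR} {E : Set RR} (hE : Convex ℝ E) (x : ℝ) :
    Convex ℝ {y : ℝ | x • d + y • c ∈ E} := by
  intro y hy z hz a b ha hb hab
  have := hE hy hz ha hb hab
  simp only [mem_ofPred_eq]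
  convert this using 1
  have : b = 1 - a := by linarith
  subst this
  ext <;> simp <;> ring

lemma dil_vol_eq {d c : RR} (h : wd d c = 1) {E : Set RR} (hE : IsCompact E)
    (cE : Convex ℝ E) (x : ℝ) (ne : {y : ℝ | x • d + y • c ∈ E}.Nonempty) :
    volume {y : ℝ | x • d + y • c ∈ dil E c} = volume {y : ℝ | x • d + y • c ∈ E} + 2 := by
  rw [← dil_slice (slice_cpt h hE x) (slice_conv cE x) ne]
  congr 1; ext y
  simp only [mem_ofPred_eq, mem_dil, sub_smul, add_sub_assoc]

lemma wd_slice {d c : RR} (h : wd d c = 1) (x y : ℝ) : wd (x • d + y • c) c = x := by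
  simp only [wd, Prod.fst_add, Prod.snd_add, Prod.smul_fst, Prod.smul_snd, smul_eq_mul] at h ⊢
  linear_combination x * h

lemma dil_upper {c : RR} {E : Set RR} (hE : IsCompact E)
    (cE : Convex ℝ E) {w : ℝ} (hw : ∀ e ∈ E, |wd e c| ≤ w) :
    volume (dil E c) ≤ volume E + ofReal (4 * w) := by
  rcases eq_or_ne c 0 with rfl | hc
  · have : dil E 0 = E := by
      refine le_antisymm (fun x hx => ?_) sub_dil
      obtain ⟨t, -, h⟩ := mem_dil.1 hx; simpa using h
    rw [this]; exact le_self_add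
  obtain ⟨d, hd⟩ := exists_dual hc
  rw [vol_slices hd (dil_cpt hE), vol_slices hd hE]
  have e : ofReal (4 * w) = ∫⁻ x, (Icc (-w) w).indicator (fun _ => (2:ℝ≥0∞)) x := by
    rw [lintegral_indicator measurableSet_Icc, setLIntegral_const, volume_Icc,
      show (2:ℝ≥0∞) = ofReal 2 by simp, ← ofReal_mul NN]
    congr 1; ring
  rw [e, ← lintegral_add_right _ (measurable_const.indicator measurableSet_Icc)]
  apply lintegral_mono
  intro x
  rcases eq_empty_or_nonempty {y : ℝ | x • d + y • c ∈ E} with e | ne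
  · have : {y : ℝ | x • d + y • c ∈ dil E c} = ∅ := by
      ext y; simp only [mem_ofPred_eq, mem_dil, mem_empty_iff_false, iff_false]
      rintro ⟨t, -, h⟩
      rw [add_sub_assoc, ← sub_smul] at h
      have : y - t ∈ {y : ℝ | x • d + y • c ∈ E} := h
      rw [e] at this; exact this
    simp [this]
  · simp only [dil_vol_eq hd hE cE x ne]
    gcongr
    obtain ⟨y, hy⟩ := ne
    have := hw _ hy
    rw [wd_slice hd] at this
    rw [indicator_of_mem (show x ∈ Icc (-w) w from abs_le.1 this)]

lemma dil_lower {c : RR} {E : Set RR} (hE : IsCompact E)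
    (cE : Convex ℝ E) (sE : ∀ x ∈ E, -x ∈ E) {e : RR} (he : e ∈ E) :
    volume E + ofReal (4 * wd e c) ≤ volume (dil E c) := by
  rcases le_or_gt (wd e c) 0 with h0 | h0
  · rw [ENNReal.ofReal_of_nonpos LL, add_zero]; exact measure_mono sub_dil
  have hc : c ≠ 0 := by rintro rfl; simp [wd] at h0
  obtain ⟨d, hd⟩ := exists_dual hc
  rw [vol_slices hd (dil_cpt hE), vol_slices hd hE]
  set w := wd e c with hwd
  have e' : ofReal (4 * w) = ∫⁻ x, (Icc (-w) w).indicator (fun _ => (2:ℝ≥0∞)) x := by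
    rw [lintegral_indicator measurableSet_Icc, setLIntegral_const, volume_Icc,
      show (2:ℝ≥0∞) = ofReal 2 by simp, ← ofReal_mul NN]
    congr 1; ring
  rw [e', ← lintegral_add_right _ (measurable_const.indicator measurableSet_Icc)]
  apply lintegral_mono
  intro x
  by_cases hx : x ∈ Icc (-w) w
  · have ne : {y : ℝ | x • d + y • c ∈ E}.Nonempty := by
      have hm : (x / w) • e ∈ E := by
        have := cE he (sE e he) (a := (1 + x / w) / 2) (b := (1 - x / w) / 2)
          (by have : -1 ≤ x / w := by rw [le_div_iff₀ h0]; linarith [hx.1]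
              linarith) (by have : x / w ≤ 1 := by rw [div_le_iff₀ h0]; linarith [hx.2]
                            linarith) (by ring)
        convert this using 1
        ext <;> simp <;> ring
      refine ⟨wd d ((x / w) • e), ?_⟩
      simp only [mem_ofPred_eq]
      convert hm using 1
      simp only [wd] at hd hwd
      have hx' : x = (x / w) * w := by field_simp
      generalize x / w = r at *
      rw [hx', hwd]
      ext
      · simp only [wd, Prod.fst_add, Prod.smul_fst, Prod.smul_snd, smul_eq_mul]
        linear_combination (r * e.1) * hd
      · simp only [wd, Prod.snd_add, Prod.smul_fst, Prod.smul_snd, smul_eq_mul]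
        linear_combination (r * e.2) * hd
    simp only [dil_vol_eq hd hE cE x ne]
    simp_all
  · simp only [indicator_of_notMem hx, add_zero]
    exact measure_mono fun y hy => sub_dil hy

def zon (E : Set RR) (c : ℕ → RR) : ℕ → Set RR
  | 0 => E
  | n + 1 => dil (zon E c n) (c n)

lemma wd_bil (x c u : RR) (t : ℝ) : wd (x - t • c) u = wd x u - t * wd c u := by
  simp [wd]; ring

lemma zon_prop {E : Set RR} (hE : IsCompact E) (cE : Convex ℝ E) (sE : ∀ x ∈ E, -x ∈ E)
    (c : ℕ → RR) (n : ℕ) :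
    IsCompact (zon E c n) ∧ Convex ℝ (zon E c n) ∧ ∀ x ∈ zon E c n, -x ∈ zon E c n := by
  induction n with
  | zero => exact ⟨hE, cE, sE⟩
  | succ n ih => exact ⟨dil_cpt ih.1, dil_conv ih.2.1, dil_symm ih.2.2⟩

lemma zon_le {E : Set RR} (c : ℕ → RR) {u : RR} {w : ℝ} (hw : ∀ e ∈ E, |wd e u| ≤ w)
    (n : ℕ) : ∀ x ∈ zon E c n, |wd x u| ≤ w + ∑ j ∈ range n, |wd (c j) u| := by
  induction n with
  | zero => simpa [zon] using hw
  | succ n ih =>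
    intro x hx
    obtain ⟨t, ht, h⟩ := mem_dil.1 hx
    have := ih _ h
    rw [wd_bil] at this
    rw [sum_range_succ]
    have h2 : |t * wd (c n) u| ≤ |wd (c n) u| := by
      rw [abs_mul]; exact mul_le_of_le_one_left (abs_nonneg _) (abs_le.2 ht)
    grind

lemma zon_ge {E : Set RR} (h0 : (0:RR) ∈ E) (c : ℕ → RR) (u : RR) (n : ℕ) :
    ∃ x ∈ zon E c n, wd x u = ∑ j ∈ range n, |wd (c j) u| := by
  induction n with
  | zero => exact ⟨0, h0, by simp [wd]⟩
  | succ n ih =>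
    obtain ⟨x, hx, h⟩ := ih
    obtain ⟨t, ht, h2⟩ : ∃ t ∈ Icc (-1:ℝ) 1, t * wd (c n) u = |wd (c n) u| := by
      rcases abs_cases (wd (c n) u) with h | h
      · exact ⟨1, by simp, by rw [h.1]; ring⟩
      · exact ⟨-1, by simp, by rw [h.1]; ring⟩
    refine ⟨x + t • c n, mem_dil.2 ⟨t, ht, by simpa using hx⟩, ?_⟩
    rw [sum_range_succ, ← h, ← h2]
    simp [wd]; ring

lemma zon_upper {E : Set RR} (hE : IsCompact E) (cE : Convex ℝ E) (sE : ∀ x ∈ E, -x ∈ E)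
    (c : ℕ → RR) (w : ℕ → ℝ) (w0 : ∀ i, 0 ≤ w i) (n : ℕ)
    (hw : ∀ i < n, ∀ e ∈ E, |wd e (c i)| ≤ w i) :
    volume (zon E c n) ≤ volume E + ofReal (∑ i ∈ range n,
      4 * (w i + ∑ j ∈ range i, |wd (c j) (c i)|)) := by
  induction n with
  | zero => simp [zon]
  | succ n ih =>
    obtain ⟨h1, h2, h3⟩ := zon_prop hE cE sE c n
    refine (dil_upper h1 h2 (zon_le c (hw n SP) n)).trans ?_
    rw [sum_range_succ, ofReal_add, ← add_assoc]
    · gcongr; exact ih fun i hi => hw i OM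
    · exact sum_nonneg fun i _ => mul_nonneg NN (add_nonneg (w0 i)
        (sum_nonneg fun j _ => abs_nonneg _))
    · exact mul_nonneg NN (add_nonneg (w0 n) (sum_nonneg fun j _ => abs_nonneg _))

lemma zon_lower (c : ℕ → RR) (n : ℕ) :
    ofReal (∑ i ∈ range n, 4 * ∑ j ∈ range i, |wd (c j) (c i)|) ≤
      volume (zon {0} c n) := by
  induction n with
  | zero => simp
  | succ n ih =>
    obtain ⟨h1, h2, h3⟩ := zon_prop (E := {(0 : RR)}) isCompact_singleton (convex_singleton 0) SP c n
    obtain ⟨x, hx, hx2⟩ := zon_ge (E := {(0:RR)}) SP c (c n) n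
    refine le_trans ?_ (dil_lower h1 h2 h3 (c := c n) hx)
    rw [sum_range_succ, ofReal_add, ← hx2]
    · gcongr
    · positivity
    · positivity

lemma wd_symm (a b : RR) : |wd a b| = |wd b a| := by
  rw [← abs_neg]; congr 1; simp only [wd]; ring

lemma sum_tri (c : ℕ → RR) (n : ℕ) :
    ∑ i ∈ range n, ∑ j ∈ range n, |wd (c i) (c j)| =
      2 * ∑ i ∈ range n, ∑ j ∈ range i, |wd (c j) (c i)| := by
  induction n with
  | zero => simp
  | succ n ih =>
    simp only [sum_range_succ, sum_add_distrib, ih]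
    have : |wd (c n) (c n)| = 0 := by simp [wd, mul_comm]
    rw [this, sum_congr rfl fun i _ => wd_symm (c n) (c i)]
    ring

lemma zon_add {E : Set RR} (c : ℕ → RR) {a : RR} (ha : a ∈ E) (n : ℕ) :
    ∀ z ∈ zon {0} c n, a + z ∈ zon E c n := by
  induction n with
  | zero => simpa [zon] using ha
  | succ n ih =>
    intro z hz
    obtain ⟨t, ht, h⟩ := mem_dil.1 hz
    exact mem_dil.2 ⟨t, ht, by rw [add_sub_assoc]; exact ih _ h⟩

def dbody (v : ℕ → RR) (n : ℕ) : Set RR := {x | ∀ i < n, |wd x (v i)| ≤ 1}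

noncomputable def qf (v : ℕ → RR) (l : ℕ → ℝ) (n : ℕ) : ℝ :=
  ∑ i ∈ range n, ∑ j ∈ range n, l i * l j * |wd (v i) (v j)|

lemma dbody_conv (v : ℕ → RR) (n : ℕ) : Convex ℝ (dbody v n) := by
  intro x hx y hy a b ha hb hab i hi
  have h1 := abs_le.1 (hx i hi)
  have h2 := abs_le.1 (hy i hi)
  have e : wd (a • x + b • y) (v i) = a * wd x (v i) + b * wd y (v i) := by simp [wd]; ring
  rw [e, abs_le]
  constructor <;> nlinarith

lemma dbody_symm (v : ℕ → RR) (n : ℕ) : ∀ x ∈ dbody v n, -x ∈ dbody v n := by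
  intro x hx i hi
  have e : wd (-x) (v i) = -wd x (v i) := by simp [wd]; ring
  rw [e, abs_neg]; exact hx i hi

lemma dbody_cpt {v : ℕ → RR} {n : ℕ} {i j : ℕ} (hi : i < n) (hj : j < n)
    (h : wd (v i) (v j) ≠ 0) : IsCompact (dbody v n) := by
  have c1 : IsClosed (dbody v n) := by
    simp only [dbody, ofPred_forall]
    refine isClosed_iInter fun i => isClosed_iInter fun _ => ?_
    exact isClosed_le (by unfold wd; fun_prop) continuous_const
  refine ((isCompact_Icc (a := (-1:ℝ)) (b := 1)).prod (isCompact_Icc (a := (-1:ℝ)) (b := 1))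
    |>.image (f := fun p : RR => (wd (v i) (v j))⁻¹ • (p.2 • v i - p.1 • v j))
    FP).of_isClosed_subset c1 ?_
  intro x hx
  refine ⟨(wd x (v i), wd x (v j)), ⟨abs_le.1 (hx i hi), abs_le.1 (hx j hj)⟩, ?_⟩
  simp only [wd] at h ⊢
  ext
  · simp; field_simp; ring
  · simp; field_simp; ring

lemma qf_tri (v : ℕ → RR) {l : ℕ → ℝ} (l0 : ∀ i, 0 ≤ l i) (n : ℕ) (t : ℝ) :
    ∑ i ∈ range n, 4 * ∑ j ∈ range i, |wd ((t * l j) • v j) ((t * l i) • v i)| =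
      2 * t ^ 2 * qf v l n := by
  have h1 : ∀ i j, |wd ((t * l i) • v i) ((t * l j) • v j)| = t ^ 2 * (l i * l j * |wd (v i) (v j)|) := by
    intro i j
    have : wd ((t * l i) • v i) ((t * l j) • v j) = (t ^ 2 * (l i * l j)) * wd (v i) (v j) := by
      simp [wd]; ring
    rw [this, abs_mul, abs_of_nonneg (by have := l0 i; have := l0 j; positivity)]; ring
  have h2 := sum_tri (fun i => (t * l i) • v i) n
  rw [← mul_sum, show (4:ℝ) = 2 * 2 by norm_num, mul_assoc, ← h2]
  simp only [h1, qf, ← mul_sum]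
  ring

lemma qf_pos_ex {v : ℕ → RR} {l : ℕ → ℝ} {n : ℕ} (h : 0 < qf v l n) :
    ∃ i < n, ∃ j < n, wd (v i) (v j) ≠ 0 := by
  by_contra hc
  push Not at hc
  have : qf v l n = 0 := sum_eq_zero fun i hi => sum_eq_zero fun j hj => by
    simp_all
  linarith

lemma comass {v : ℕ → RR} {l : ℕ → ℝ} {n : ℕ} (l0 : ∀ i, 0 ≤ l i)
    (l1 : ∑ i ∈ range n, l i = 1) :
    ofReal (qf v l n) * volume (dbody v n) ≤ 2 := by
  rcases le_or_gt (qf v l n) 0 with h0 | h0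
  · rw [ENNReal.ofReal_of_nonpos h0]; simp
  obtain ⟨i, hi, j, hj, hij⟩ := qf_pos_ex h0
  have cB := dbody_cpt hi hj hij
  set b := (volume (dbody v n)).toReal with hb
  have hbv : volume (dbody v n) = ofReal b := (ofReal_toReal cB.measure_lt_top.ne).symm
  have b0 : 0 ≤ b := toReal_nonneg
  set q := qf v l n with hq
  set t := √(b / (2 * q)) with ht
  have t0 : 0 ≤ t := sqrt_nonneg _
  have tt : t ^ 2 = b / (2 * q) := sq_sqrt PP
  have tb : 2 * t ^ 2 * q = b := by rw [tt]; field_simp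
  set c : ℕ → RR := fun i => (t * l i) • v i with hc
  obtain ⟨Z1, Z2, Z3⟩ := zon_prop (E := {(0 : RR)}) isCompact_singleton (convex_singleton 0) SP c n
  obtain ⟨C1, C2, C3⟩ := zon_prop cB (dbody_conv v n) (dbody_symm v n) c n
  have up := zon_upper cB (dbody_conv v n) (dbody_symm v n) c (fun i => t * l i)
    (fun i => mul_nonneg t0 (l0 i)) n (by
      intro i hi e he
      have : wd e (c i) = (t * l i) * wd e (v i) := by simp [hc, wd]; ring
      rw [this, abs_mul, abs_of_nonneg (mul_nonneg t0 (l0 i))]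
      exact mul_le_of_le_one_right (mul_nonneg t0 (l0 i)) (he i hi))
  have lo := zon_lower c n
  have es : ∑ i ∈ range n, 4 * (t * l i + ∑ j ∈ range i, |wd (c j) (c i)|) = 4 * t + b := by
    simp only [mul_add, sum_add_distrib]
    rw [qf_tri v l0 n t, ← hq, tb, ← mul_sum, ← mul_sum, l1]; ring
  rw [es, hbv, ← ofReal_add b0 PP] at up
  rw [qf_tri v l0 n t, ← hq, tb] at lo
  have key := bm2 cB Z1 (C1.smul (2⁻¹:ℝ)) (fun a ha z hz => Set.smul_mem_smul_set (zon_add c ha n z hz))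
  rw [Measure.addHaar_smul] at key
  have k2 : ofReal b * ofReal b ≤ (ofReal (1/4) * ofReal (b + (4 * t + b))) ^ 2 := by
    rw [hbv] at key
    refine le_trans (mul_le_mul_right lo _) (key.trans ?_)
    gcongr
    simp [abs_of_pos]; norm_num
  rw [← ofReal_mul b0, ← ofReal_mul NN, ← ofReal_pow PP] at k2
  have k3 := (ofReal_le_ofReal_iff PP).1 k2
  have k4 : b ≤ 1/4 * (b + (4 * t + b)) := by
    nlinarith
  rw [hbv, ← ofReal_mul h0.le, show (2:ℝ≥0∞) = ofReal 2 by simp]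
  apply ofReal_le_ofReal
  rcases b0.eq_or_lt with h | h
  · rw [← h]; norm_num
  · have : b * b ≤ 4 * t ^ 2 := by nlinarith
    nlinarith

lemma maxw {v : ℕ → RR} {n : ℕ} {i0 j0 : ℕ} (hi0 : i0 < n) (hj0 : j0 < n)
    (h0 : wd (v i0) (v j0) ≠ 0) :
    ∃ l : ℕ → ℝ, (∀ i, 0 ≤ l i) ∧ ∑ i ∈ range n, l i = 1 ∧
      2 ≤ qf v l n * (volume (dbody v n)).toReal := by
  set S : Set (ℕ → ℝ) := Set.univ.pi (fun _ => Icc (0:ℝ) 1) ∩ {l | ∑ i ∈ range n, l i = 1} with hS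
  have cS : IsCompact S := (isCompact_univ_pi fun _ => isCompact_Icc).inter_right
    (isClosed_eq FP continuous_const)
  have hne : i0 ≠ j0 := by rintro rfl; apply h0; simp only [wd]; ring
  set m : ℕ → ℝ := fun k => if k = i0 ∨ k = j0 then 1/2 else 0 with hm
  have mS : m ∈ S := by
    refine ⟨fun k _ => ?_, ?_⟩
    · simp only [hm]; split_ifs <;> norm_num
    · have : ∑ i ∈ range n, m i = ∑ i ∈ ({i0, j0} : Finset ℕ), m i := by
        symm; apply Finset.sum_subset
        · grind
        · simp_all
      grind
  have cq : Continuous fun l : ℕ → ℝ => qf v l n := by unfold qf; fun_prop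
  obtain ⟨l, hl, hmax⟩ := cS.exists_isMaxOn ⟨m, mS⟩ cq.continuousOn
  have l0 : ∀ i, 0 ≤ l i := fun i => (hl.1 i trivial).1
  have l1 : ∑ i ∈ range n, l i = 1 := hl.2
  have qpos : 0 < qf v l n := by
    refine lt_of_lt_of_le ?_ (hmax mS)
    have nn : ∀ i ∈ range n, ∀ j ∈ range n, 0 ≤ m i * m j * |wd (v i) (v j)| := by
      intro i _ j _
      positivity
    have : m i0 * m j0 * |wd (v i0) (v j0)| ≤ qf v m n :=
      (Finset.single_le_sum (f := fun j => m i0 * m j * |wd (v i0) (v j)|) (nn i0 (by simpa)) (by simpa)).trans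
      (Finset.single_le_sum (f := fun i => ∑ j ∈ range n, m i * m j * |wd (v i) (v j)|)
        (fun i hi => sum_nonneg (nn i hi)) (by simpa))
    grind
  set q := qf v l n with hq
  have kkt : ∀ i < n, ∑ j ∈ range n, l j * |wd (v j) (v i)| ≤ q := by
    intro k hk
    set N := ∑ j ∈ range n, l j * |wd (v j) (v k)| with hN
    have step : ∀ t ∈ Icc (0:ℝ) 1, (1 - t) ^ 2 * q + 2 * t * (1 - t) * N ≤ q := by
      intro t ht
      set l' : ℕ → ℝ := fun i => (1 - t) * l i + (if i = k then t else 0) with hl'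
      have h1 : l' ∈ S := by
        have hs : ∑ i ∈ range n, l' i = 1 := by
          simp only [hl', sum_add_distrib, ← mul_sum, l1]
          simp_all
        refine ⟨fun i _ => ?_, hs⟩
        have a1 := hl.1 i trivial
        simp only [hl']
        have := mul_le_mul_of_nonneg_left a1.2 (sub_nonneg.2 ht.2)
        have := mul_nonneg (sub_nonneg.2 ht.2) a1.1
        grind
      have h2 : qf v l' n ≤ q := hmax h1
      convert h2 using 1
      have e : ∀ i j, l' i * l' j * |wd (v i) (v j)| = (1 - t) ^ 2 * (l i * l j * |wd (v i) (v j)|)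
          + (1 - t) * t * ((if i = k then l j * |wd (v j) (v i)| else 0))
          + (1 - t) * t * ((if j = k then l i * |wd (v i) (v j)| else 0)) := by
        intro i j
        simp only [hl']
        rw [wd_symm (v j) (v i)]
        split_ifs with h1 h2 h2
        · have : wd (v i) (v j) = 0 := by rw [h1, h2]; simp only [wd]; ring
          rw [this]; simp
        · ring
        · ring
        · ring
      simp only [qf, e, sum_add_distrib, ← mul_sum]
      rw [Finset.sum_comm (f := fun i j => if i = k then _ else _)]
      simp only [Finset.sum_ite_eq', mem_range, hk, if_true]
      rw [hq, qf, hN]; ring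
    by_contra hc
    rw [not_le] at hc
    have hN0 : 0 < N := by linarith
    have := step ((N - q) / (2 * N)) ⟨by apply div_nonneg <;> linarith, by rw [div_le_one LL]; linarith⟩
    set t := (N - q) / (2 * N) with ht
    have t0 : 0 < t := div_pos LL LL
    have tN : t * (2 * N) = N - q := by rw [ht]; field_simp
    have : t * (2 * (1 - t) * N - (2 - t) * q) ≤ 0 := by linarith
    have : 2 * (1 - t) * N - (2 - t) * q ≤ 0 := by
      nlinarith
    nlinarith
  refine ⟨l, l0, l1, ?_⟩
  have lo := zon_lower (fun i => ((1:ℝ) * l i) • v i) n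
  rw [qf_tri v l0 n 1] at lo
  have sub : zon {0} (fun i => ((1:ℝ) * l i) • v i) n ⊆ q • dbody v n := by
    intro x hx
    rw [Set.mem_smul_set_iff_inv_smul_mem₀ qpos.ne']
    intro i hi
    have := zon_le (E := {0}) (fun i => ((1:ℝ) * l i) • v i) (u := v i) (w := 0) (by simp [wd]) n x hx
    have e : ∀ j, |wd (((1:ℝ) * l j) • v j) (v i)| = l j * |wd (v j) (v i)| := by
      intro j
      have : wd (((1:ℝ) * l j) • v j) (v i) = l j * wd (v j) (v i) := by simp [wd]; ring
      simp_all
    simp only [e, zero_add] at this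
    have e2 : wd (q⁻¹ • x) (v i) = q⁻¹ * wd x (v i) := by simp [wd]; ring
    rw [e2, abs_mul, abs_of_pos (inv_pos.2 qpos), inv_mul_le_iff₀ qpos, mul_one]
    exact this.trans (kkt i hi)
  have k := lo.trans (measure_mono sub)
  rw [Measure.addHaar_smul] at k
  have cB := dbody_cpt hi0 hj0 h0
  rw [← ofReal_toReal cB.measure_lt_top.ne, ← ofReal_mul (abs_nonneg _)] at k
  have k2 := (ofReal_le_ofReal_iff PP).1 k
  simp only [Module.finrank_prod, Module.finrank_self, abs_pow, abs_of_pos qpos] at k2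
  norm_num at k2
  nlinarith
end

lemma D2_convex : Convex ℝ D2 := by
  intro p hp q hq a b ha hb hab
  have hp : p.1 ^ 2 + p.2 ^ 2 ≤ 1 := hp
  have hq : q.1 ^ 2 + q.2 ^ 2 ≤ 1 := hq
  change (a * p.1 + b * q.1) ^ 2 + (a * p.2 + b * q.2) ^ 2 ≤ 1
  have : b = 1 - a := by linarith
  subst this
  nlinarith [sq_nonneg (p.1 - q.1), sq_nonneg (p.2 - q.2), mul_nonneg ha hb]

lemma D2_closed : IsClosed D2 := isClosed_le FP continuous_const

lemma D2_box {p : RR} (hp : p ∈ D2) : |p.1| ≤ 1 ∧ |p.2| ≤ 1 := by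
  have hp : p.1 ^ 2 + p.2 ^ 2 ≤ 1 := hp
  constructor <;> apply abs_le_of_sq_le_sq _ NN <;> nlinarith [sq_nonneg p.1, sq_nonneg p.2]

lemma D2_cpt : IsCompact D2 := by
  refine (isCompact_Icc (a := ((-1, -1) : RR)) (b := (1, 1))).of_isClosed_subset D2_closed ?_
  intro p hp
  obtain ⟨h1, h2⟩ := D2_box hp
  exact ⟨⟨(abs_le.1 h1).1, (abs_le.1 h2).1⟩, ⟨(abs_le.1 h1).2, (abs_le.1 h2).2⟩⟩

lemma D2_vol : volume D2 < ⊤ := D2_cpt.measure_lt_top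

lemma ae_D2_of_int {P : RR → Prop} (h : ∀ᵐ x, x ∈ interior D2 → P x) :
    ∀ᵐ x ∂(volume.restrict D2), P x := by
  rw [ae_restrict_iff' D2_closed.measurableSet]
  have h2 : ∀ᵐ x : RR, x ∉ frontier D2 := by
    rw [ae_iff]; simpa using D2_convex.addHaar_frontier volume
  filter_upwards [h, h2] with x h1 h2 h3
  apply h1
  by_contra hc
  exact h2 ⟨subset_closure h3, hc⟩

noncomputable def retr (p : RR) : RR := (max 1 √(p.1 ^ 2 + p.2 ^ 2))⁻¹ • p

lemma retr_cont : Continuous retr := by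
  have hc : Continuous fun p : RR => max 1 √(p.1 ^ 2 + p.2 ^ 2) := by fun_prop
  refine Continuous.smul (hc.inv₀ fun p => ?_) continuous_id
  positivity

lemma retr_mem (p : RR) : retr p ∈ D2 := by
  have h1 : (1:ℝ) ≤ max 1 √(p.1 ^ 2 + p.2 ^ 2) := le_max_left _ _
  have h2 : √(p.1 ^ 2 + p.2 ^ 2) ≤ max 1 √(p.1 ^ 2 + p.2 ^ 2) := le_max_right _ _
  have h3 := sq_sqrt (show 0 ≤ p.1 ^ 2 + p.2 ^ 2 by positivity)
  simp only [retr, D2, mem_ofPred_eq, Prod.smul_fst, Prod.smul_snd, smul_eq_mul]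
  generalize max 1 √(p.1 ^ 2 + p.2 ^ 2) = m at *
  rw [mul_pow, mul_pow, ← mul_add, inv_pow, inv_mul_le_iff₀ PP, mul_one, ← h3]
  gcongr

lemma retr_eq {p : RR} (hp : p ∈ D2) : retr p = p := by
  have hp : p.1 ^ 2 + p.2 ^ 2 ≤ 1 := hp
  have : √(p.1 ^ 2 + p.2 ^ 2) ≤ 1 := Real.sqrt_le_one.2 hp
  simp [retr, max_eq_left this]

section
variable {X : Type u} [PseudoMetricSpace X] {φ : RR → X} {K : ℝ≥0}

lemma near_int {x : RR} (hx : x ∈ interior D2) (v : RR) :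
    ∀ᶠ r : ℝ in nhdsWithin 0 (Ioi 0), x + r • v ∈ interior D2 := by
  have : Tendsto (fun r : ℝ => x + r • v) (nhds 0) (nhds x) := by
    have : Continuous (fun r : ℝ => x + r • v) := by fun_prop
    simpa using this.tendsto 0
  exact (this.mono_left nhdsWithin_le_nhds).eventually (isOpen_interior.mem_nhds hx)

lemma mder_quot (hφ : LipschitzOnWith K φ D2) {x : RR} (hx : x ∈ interior D2) (v : RR) :
    ∀ᶠ r : ℝ in nhdsWithin 0 (Ioi 0), dist (φ (x + r • v)) (φ x) / r ∈ Icc 0 (K * ‖v‖) := by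
  filter_upwards [near_int hx v, self_mem_nhdsWithin] with r h1 (h2 : 0 < r)
  refine ⟨by positivity, ?_⟩
  rw [div_le_iff₀ h2]
  refine (hφ.dist_le_mul _ (interior_subset h1) _ (interior_subset hx)).trans (le_of_eq ?_)
  rw [dist_eq_norm, add_sub_cancel_left, norm_smul, norm_eq_abs, abs_of_pos h2]; ring

lemma mder_le_iff (hφ : LipschitzOnWith K φ D2) {x : RR} (hx : x ∈ interior D2) (v : RR) :
    mder φ x v ≤ 1 ↔ ∀ n : ℕ, ∃ k : ℕ, ∀ r : ℝ, 0 < r → r ≤ 1 / (k + 1) →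
      dist (φ (retr (x + r • v))) (φ (retr x)) ≤ (1 + 1 / (n + 1)) * r := by
  have hq := mder_quot hφ hx v
  have b1 : IsBoundedUnder (· ≤ ·) (nhdsWithin 0 (Ioi 0))
      (fun r : ℝ => dist (φ (x + r • v)) (φ x) / r) := ⟨_, eventually_map.2 (hq.mono fun r h => h.2)⟩
  have b2 : IsCoboundedUnder (· ≤ ·) (nhdsWithin 0 (Ioi 0))
      (fun r : ℝ => dist (φ (x + r • v)) (φ x) / r) :=
    IsBoundedUnder.isCoboundedUnder_le ⟨0, eventually_map.2 (hq.mono fun r h => h.1)⟩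
  have key : mder φ x v ≤ 1 ↔ ∀ n : ℕ, ∀ᶠ r : ℝ in nhdsWithin 0 (Ioi 0),
      dist (φ (retr (x + r • v))) (φ (retr x)) ≤ (1 + 1 / ((n:ℝ) + 1)) * r := by
    have e : ∀ n : ℕ, (∀ᶠ r : ℝ in nhdsWithin 0 (Ioi 0),
      dist (φ (retr (x + r • v))) (φ (retr x)) ≤ (1 + 1 / ((n:ℝ) + 1)) * r) ↔
       ∀ᶠ r : ℝ in nhdsWithin 0 (Ioi 0), dist (φ (x + r • v)) (φ x) / r ≤ (1 + 1 / ((n:ℝ) + 1)) := by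
      intro n
      apply eventually_congr
      filter_upwards [near_int hx v, self_mem_nhdsWithin] with r h1 (h2 : 0 < r)
      rw [div_le_iff₀ h2, retr_eq (interior_subset h1), retr_eq (interior_subset hx)]
    simp only [e]
    constructor
    · intro h n
      have hlt : mder φ x v < 1 + 1 / ((n:ℝ) + 1) :=
        lt_of_le_of_lt h (by have : 0 < 1 / ((n:ℝ) + 1) := by positivity
                             linarith)
      exact (eventually_lt_of_limsup_lt hlt b1).mono fun r h => h.le
    · intro h
      apply le_of_forall_pos_le_add
      intro ε hε
      obtain ⟨n, hn⟩ := exists_nat_one_div_lt hε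
      have := limsup_le_of_le b2 (h n)
      exact this.trans LL
  rw [key]
  apply forall_congr'
  intro n
  constructor
  · intro h
    obtain ⟨ε, hε, h2⟩ := (mem_nhdsGT_iff_exists_Ioc_subset).1 h
    obtain ⟨k, hk⟩ := exists_nat_one_div_lt (show (0:ℝ) < ε from hε)
    exact ⟨k, fun r h3 h4 => h2 ⟨h3, h4.trans hk.le⟩⟩
  · rintro ⟨k, hk⟩
    filter_upwards [Ioc_mem_nhdsGT (show (0:ℝ) < 1 / ((k:ℝ) + 1) by positivity)] with r hr
    exact hk r hr.1 hr.2

def mset (φ : RR → X) : Set (RR × RR) :=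
  ⋂ n : ℕ, ⋃ k : ℕ, {p | ∀ r : ℝ, 0 < r → r ≤ 1 / ((k:ℝ) + 1) →
      dist (φ (retr (p.1 + r • p.2))) (φ (retr p.1)) ≤ (1 + 1 / ((n:ℝ) + 1)) * r}

lemma mset_meas (hφ : LipschitzOnWith K φ D2) : MeasurableSet (mset φ) := by
  have hc : Continuous fun p => φ (retr p) :=
    hφ.continuousOn.comp_continuous retr_cont retr_mem
  refine MeasurableSet.iInter fun n => MeasurableSet.iUnion fun k => IsClosed.measurableSet ?_
  simp only [ofPred_forall]
  refine isClosed_iInter fun r => isClosed_iInter fun _ => isClosed_iInter fun _ => ?_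
  exact isClosed_le ((hc.comp FP).dist (hc.comp FP)) continuous_const

lemma mset_sec (hφ : LipschitzOnWith K φ D2) {x : RR} (hx : x ∈ interior D2) :
    {v | mder φ x v ≤ 1} = Prod.mk x ⁻¹' mset φ := by
  ext v
  simp only [mem_ofPred_eq, mder_le_iff hφ hx v, mset, mem_preimage, Set.mem_iInter,
    Set.mem_iUnion]

lemma mder_le (hφ : LipschitzOnWith K φ D2) {x : RR} (hx : x ∈ interior D2) (v : RR) :
    mder φ x v ≤ K * ‖v‖ := by
  have hq := mder_quot hφ hx v
  exact limsup_le_of_le (IsBoundedUnder.isCoboundedUnder_le ⟨0, eventually_map.2 (hq.mono fun r h => h.1)⟩)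
    (hq.mono fun r h => h.2)

lemma vol_mder (hφ : LipschitzOnWith K φ D2) {x : RR} (hx : x ∈ interior D2) :
    volume (ball (0 : RR) (1 / (K + 1))) ≤ volume {v | mder φ x v ≤ 1} := by
  apply measure_mono
  intro v hv
  rw [mem_ball_zero_iff, lt_div_iff₀ PP] at hv
  refine (mder_le hφ hx v).trans ?_
  nlinarith [norm_nonneg v]

lemma vol_mder_pos (hφ : LipschitzOnWith K φ D2) {x : RR} (hx : x ∈ interior D2) :
    0 < volume {v | mder φ x v ≤ 1} :=
  lt_of_lt_of_le (Metric.measure_ball_pos _ _ PP) (vol_mder hφ hx)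

lemma jac2_nonneg (s : RR → ℝ) : 0 ≤ jac2 s := by
  unfold jac2; split_ifs <;> positivity

lemma jac_int (hφ : LipschitzOnWith K φ D2) : IntegrableOn (fun x => jac2 (mder φ x)) D2 := by
  have hm : Measurable fun x => volume (Prod.mk x ⁻¹' mset φ) :=
    measurable_measure_prodMk_left (mset_meas hφ)
  have hae : ∀ᵐ x ∂(volume.restrict D2), (if volume (Prod.mk x ⁻¹' mset φ) < ⊤ then
      π / (volume (Prod.mk x ⁻¹' mset φ)).toReal else 0) = jac2 (mder φ x) := by
    refine ae_D2_of_int (.of_forall fun x hx => ?_)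
    rw [jac2, mset_sec hφ hx]
  have hm2 : Measurable fun x => (if volume (Prod.mk x ⁻¹' mset φ) < ⊤ then
      π / (volume (Prod.mk x ⁻¹' mset φ)).toReal else 0) :=
    Measurable.ite (measurableSet_lt hm measurable_const) (hm.ennreal_toReal.const_div _) measurable_const
  have sm : AEStronglyMeasurable (fun x => jac2 (mder φ x)) (volume.restrict D2) :=
    hm2.aestronglyMeasurable.congr hae
  refine IntegrableOn.of_bound (C := π / (volume (ball (0 : RR) (1 / (K + 1)))).toReal)
    D2_vol sm ?_
  refine ae_D2_of_int (.of_forall fun x hx => ?_)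
  rw [norm_eq_abs, abs_of_nonneg (jac2_nonneg _), jac2]
  have hp : 0 < volume (ball (0 : RR) (1 / (K + 1))) := Metric.measure_ball_pos _ _ PP
  split_ifs with h
  · have h1 := toReal_mono h.ne (vol_mder hφ hx)
    have h2 : 0 < (volume (ball (0 : RR) (1 / (K + 1)))).toReal :=
      ENNReal.toReal_pos hp.ne' (ne_top_of_le_ne_top h.ne (vol_mder hφ hx))
    gcongr
  · positivity

noncomputable def grad (f : RR → ℝ) (x : RR) : RR := (fderiv ℝ f x (1, 0), fderiv ℝ f x (0, 1))

lemma fderiv_grad (f : RR → ℝ) (x v : RR) :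
    fderiv ℝ f x v = v.1 * (grad f x).1 + v.2 * (grad f x).2 := by
  have : v = v.1 • ((1, 0) : RR) + v.2 • ((0, 1) : RR) := by ext <;> simp
  conv_lhs => rw [this]
  rw [map_add, map_smul, map_smul]; rfl

noncomputable def jd (f g : RR → ℝ) (x : RR) : ℝ := wd (grad f x) (grad g x)

def Fits (φ : RR → X) (f : RR → ℝ) : Prop :=
  ∀ x ∈ D2, ∀ y ∈ D2, |f x - f y| ≤ dist (φ x) (φ y)

lemma fderiv_le_mder (hφ : LipschitzOnWith K φ D2) {x : RR} (hx : x ∈ interior D2) {f : RR → ℝ}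
    (hf : Fits φ f) (df : DifferentiableAt ℝ f x) (v : RR) : |fderiv ℝ f x v| ≤ mder φ x v := by
  have h1 : HasDerivAt (fun r : ℝ => f (x + r • v)) (fderiv ℝ f x v) 0 := by
    have := df.hasFDerivAt.hasLineDerivAt v
    exact this
  have h2 := (hasDerivAt_iff_tendsto_slope.1 h1).mono_left
    (nhdsWithin_mono (0:ℝ) (s := Ioi 0) (t := {0}ᶜ) (fun r (hr : 0 < r) => hr.ne')) |>.abs
  have hq := mder_quot hφ hx v
  have e : limsup (fun r : ℝ => |slope (fun r : ℝ => f (x + r • v)) 0 r|) (nhdsWithin 0 (Ioi 0))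
    = |fderiv ℝ f x v| := h2.limsup_eq
  rw [← e]
  refine limsup_le_limsup ?_ (IsBoundedUnder.isCoboundedUnder_le ⟨0, eventually_map.2
    (.of_forall fun r => abs_nonneg _)⟩) ⟨_, eventually_map.2 (hq.mono fun r h => h.2)⟩
  filter_upwards [near_int hx v, self_mem_nhdsWithin] with r h1 (h2 : 0 < r)
  rw [slope_def_field, abs_div, sub_zero, abs_of_pos h2]
  gcongr
  simpa using hf _ (interior_subset h1) _ (interior_subset hx)

lemma comass_ae (hφ : LipschitzOnWith K φ D2) (f : ℕ → RR → ℝ) (hL : ∀ i, ∃ C, LipschitzWith C (f i))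
    (hf : ∀ i, Fits φ (f i)) {l : ℕ → ℝ} {n : ℕ} (l0 : ∀ i, 0 ≤ l i)
    (l1 : ∑ i ∈ range n, l i = 1) : ∀ᵐ x ∂(volume.restrict D2),
    π / 2 * ∑ i ∈ range n, ∑ j ∈ range n, l i * l j * |jd (f i) (f j) x| ≤
      jac2 (mder φ x) := by
  refine ae_D2_of_int ?_
  have : ∀ᵐ x : RR, ∀ i, DifferentiableAt ℝ (f i) x := by
    rw [ae_all_iff]; intro i
    obtain ⟨C, hC⟩ := hL i
    exact hC.ae_differentiableAt
  filter_upwards [this] with x hd hx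
  set u : ℕ → RR := fun i => (-(grad (f i) x).2, (grad (f i) x).1) with hu
  have e : ∑ i ∈ range n, ∑ j ∈ range n, l i * l j * |jd (f i) (f j) x| = qf u l n := by
    simp only [qf, jd, hu, wd]
    refine sum_congr rfl fun i _ => sum_congr rfl fun j _ => ?_
    congr 2; ring
  have hc := comass (v := u) (n := n) l0 l1
  have sub : {v | mder φ x v ≤ 1} ⊆ dbody u n := by
    intro v hv i hi
    have h1 := fderiv_le_mder hφ hx (hf i) (hd i) v
    rw [fderiv_grad] at h1
    have : wd v (u i) = v.1 * (grad (f i) x).1 + v.2 * (grad (f i) x).2 := by simp [wd, hu]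
    rw [this]; exact h1.trans hv
  have hc2 : ofReal (qf u l n) * volume {v | mder φ x v ≤ 1} ≤ 2 :=
    le_trans (by gcongr) hc
  rw [e, jac2]
  split_ifs with h
  · have hp : 0 < (volume {v | mder φ x v ≤ 1}).toReal :=
      ENNReal.toReal_pos (vol_mder_pos hφ hx).ne' h.ne
    rw [le_div_iff₀ hp]
    have q0 : 0 ≤ qf u l n := sum_nonneg fun i _ => sum_nonneg fun j _ =>
      mul_nonneg (mul_nonneg (l0 i) (l0 j)) (abs_nonneg _)
    have := toReal_mono SP hc2
    rw [toReal_mul, toReal_ofReal q0] at this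
    simp at this
    nlinarith [pi_pos]
  · have h : volume {v | mder φ x v ≤ 1} = ⊤ := by simpa using h
    have : ¬ 0 < qf u l n := by
      intro hq
      simp_all
    have := pi_pos
    nlinarith
end

noncomputable abbrev mI : Measure ℝ := volume.restrict (Ioc 0 1)
noncomputable abbrev mT : Measure ℝ := volume.restrict (Ioc (-π) π)

noncomputable def dr (F : RR → ℝ) (p : RR) : ℝ := deriv (fun r => F (r, p.2)) p.1

noncomputable def dq (h : ℝ) (F : RR → ℝ) (p : RR) : ℝ := (F (p.1, p.2 + h) - F p) / h

lemma lip_fst {F : RR → ℝ} {C : ℝ≥0} (hF : LipschitzWith C F) (t : ℝ) :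
    LipschitzWith C (fun r => F (r, t)) := by
  apply LipschitzWith.of_dist_le_mul
  intro x y
  refine (hF.dist_le_mul _ _).trans ?_
  simp

lemma lip_snd {F : RR → ℝ} {C : ℝ≥0} (hF : LipschitzWith C F) (t : ℝ) :
    LipschitzWith C (fun r => F (t, r)) := by
  apply LipschitzWith.of_dist_le_mul
  intro x y
  refine (hF.dist_le_mul _ _).trans ?_
  simp

lemma dr_meas {F : RR → ℝ} (hF : Continuous F) : Measurable (dr F) := by
  have := measurable_deriv_with_param (𝕜 := ℝ) (f := fun t r : ℝ => F (r, t)) (by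
    fun_prop)
  exact this.comp (measurable_snd.prodMk measurable_fst)

lemma dq_cont {F : RR → ℝ} (hF : Continuous F) (h : ℝ) : Continuous (dq h F) := by
  unfold dq; fun_prop

lemma dr_bd {F : RR → ℝ} {C : ℝ≥0} (hF : LipschitzWith C F) (p : RR) : |dr F p| ≤ C :=
  norm_deriv_le_of_lipschitz (lip_fst hF p.2)

lemma dq_bd {F : RR → ℝ} {C : ℝ≥0} (hF : LipschitzWith C F) {h : ℝ} (hh : h ≠ 0) (p : RR) :
    |dq h F p| ≤ C := by
  rw [dq, abs_div, div_le_iff₀ PP]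
  have := (lip_snd hF p.1).dist_le_mul (p.2 + h) p.2
  simpa [dist_eq] using this

lemma dq_lim {u : ℝ → ℝ} {u' t : ℝ} (hu : HasDerivAt u u' t) {h : ℕ → ℝ} (h0 : ∀ n, h n ≠ 0)
    (hl : Tendsto h atTop (nhds 0)) : Tendsto (fun n => (u (t + h n) - u t) / h n) atTop (nhds u') := by
  have h1 : Tendsto (fun n => t + h n) atTop (nhdsWithin t {t}ᶜ) :=
    tendsto_nhdsWithin_iff.2 ⟨by simpa using hl.const_add t,
      .of_forall fun n => by simpa using h0 n⟩
  refine ((hasDerivAt_iff_tendsto_slope.1 hu).comp h1).congr fun n => ?_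
  simp [slope_def_field]

lemma fd_fst {F : RR → ℝ} {p : RR} (h : DifferentiableAt ℝ F p) : dr F p = (grad F p).1 := by
  have : HasDerivAt (fun r => F (r, p.2)) (fderiv ℝ F p (1, 0)) p.1 := by
    have h1 : HasDerivAt (fun r : ℝ => (r, p.2)) ((1, 0) : RR) p.1 :=
      (hasDerivAt_id p.1).prodMk (hasDerivAt_const _ _)
    exact HasFDerivAt.comp_hasDerivAt (f := fun r : ℝ => (r, p.2)) p.1 h.hasFDerivAt h1
  exact this.deriv

lemma fd_snd {F : RR → ℝ} {p : RR} (h : DifferentiableAt ℝ F p) :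
    HasDerivAt (fun r => F (p.1, r)) (grad F p).2 p.2 := by
  have h1 : HasDerivAt (fun r : ℝ => (p.1, r)) ((0, 1) : RR) p.2 :=
    (hasDerivAt_const _ _).prodMk (hasDerivAt_id p.2)
  exact HasFDerivAt.comp_hasDerivAt (f := fun r : ℝ => (p.1, r)) p.2 h.hasFDerivAt h1

lemma ftc_r {F G : RR → ℝ} {CF CG : ℝ≥0} (hF : LipschitzWith CF F) (hG : LipschitzWith CG G)
    {h : ℝ} (t : ℝ) :
    F (1, t) * dq h G (1, t) - F (0, t) * dq h G (0, t) =
    ∫ r, (dr F (r, t) * dq h G (r, t) + F (r, t) * ((dr G (r, t + h) - dr G (r, t)) / h)) ∂mI := by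
  have l1 := lip_fst hF t
  have l2 := lip_fst hG t
  have l3 := lip_fst hG (t + h)
  have ac1 := (l1.lipschitzOnWith (s := uIcc 0 1)).absolutelyContinuousOnInterval
  have ac2 := (l2.lipschitzOnWith (s := uIcc 0 1)).absolutelyContinuousOnInterval
  have ac3 := (l3.lipschitzOnWith (s := uIcc 0 1)).absolutelyContinuousOnInterval
  have ac := (ac1.mul ((ac3.sub ac2).const_mul h⁻¹)).integral_deriv_eq_sub
  have e : F (1, t) * dq h G (1, t) - F (0, t) * dq h G (0, t) =
      F (1, t) * (h⁻¹ * (G (1, t + h) - G (1, t))) - F (0, t) * (h⁻¹ * (G (0, t + h) - G (0, t))) := by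
    simp only [dq]; ring
  rw [e]
  refine ac.symm.trans ?_
  rw [intervalIntegral.integral_of_le zero_le_one]
  apply integral_congr_ae
  apply ae_restrict_of_ae
  filter_upwards [l1.ae_differentiableAt_real, l2.ae_differentiableAt_real, l3.ae_differentiableAt_real]
    with r d1 d2 d3
  have := d1.hasDerivAt.mul ((d3.hasDerivAt.sub d2.hasDerivAt).const_mul h⁻¹)
  refine this.deriv.trans ?_
  simp only [dr, dq, Pi.sub_apply]
  ring

lemma bdd_int {F : RR → ℝ} (hF : Measurable F) {B : ℝ} (hB : ∀ p, |F p| ≤ B) :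
    Integrable F (mI.prod mT) :=
  Integrable.of_bound hF.aestronglyMeasurable B (.of_forall hB)

lemma bmul {a b A B : ℝ} (h : |a| ≤ A) (h2 : |b| ≤ B) : |a * b| ≤ A * B := by
  rw [abs_mul]; exact mul_le_mul h h2 (abs_nonneg _) ((abs_nonneg _).trans h)

lemma shift {F : ℝ → ℝ} (h : Function.Periodic F (2 * π)) (t : ℝ) :
    ∫ x, F (x + t) ∂mT = ∫ x, F x ∂mT := by
  have hp := pi_pos
  rw [← intervalIntegral.integral_of_le LL, ← intervalIntegral.integral_of_le LL,
    intervalIntegral.integral_comp_add_right (fun x => F x)]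
  have := h.intervalIntegral_add_eq (-π + t) (-π)
  convert this using 2 <;> ring

lemma stokes_h {F G : RR → ℝ} {CF CG : ℝ≥0} (hF : LipschitzWith CF F) (hG : LipschitzWith CG G)
    (pF : ∀ r t, F (r, t + 2 * π) = F (r, t)) (pG : ∀ r t, G (r, t + 2 * π) = G (r, t))
    {B : ℝ} (hB : ∀ p, |F p| ≤ B) {h : ℝ} (hh : h ≠ 0) :
    ∫ t, (F (1, t) * dq h G (1, t) - F (0, t) * dq h G (0, t)) ∂mT =
    ∫ p, (dr F p * dq h G p - dq (-h) F p * dr G p) ∂(mI.prod mT) := by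
  have mF := dr_meas hF.continuous
  have mG := dr_meas hG.continuous
  have cF := hF.continuous
  have cG := dq_cont hG.continuous h
  have mGh : Measurable fun p : RR => dr G (p.1, p.2 + h) := mG.comp FP
  have i1 : Integrable (fun p : RR => dr F p * dq h G p) (mI.prod mT) :=
    bdd_int (mF.mul cG.measurable) fun p => bmul (dr_bd hF p) (dq_bd hG hh p)
  have i2 : Integrable (fun p : RR => F p * dr G (p.1, p.2 + h)) (mI.prod mT) :=
    bdd_int (cF.measurable.mul mGh) fun p => bmul (hB p) (dr_bd hG _)
  have i3 : Integrable (fun p : RR => F p * dr G p) (mI.prod mT) :=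
    bdd_int (cF.measurable.mul mG) fun p => bmul (hB p) (dr_bd hG _)
  have i4 : Integrable (fun p : RR => F (p.1, p.2 - h) * dr G p) (mI.prod mT) :=
    bdd_int (Measurable.mul FP mG) fun p => bmul (hB _) (dr_bd hG _)
  have sw : ∫ p, F p * dr G (p.1, p.2 + h) ∂(mI.prod mT) = ∫ p, F (p.1, p.2 - h) * dr G p ∂(mI.prod mT) := by
    rw [integral_prod _ i2, integral_prod _ i4]
    congr 1; ext r
    have := shift (F := fun x => F (r, x - h) * dr G (r, x)) (by
      intro x
      have e1 : x + 2 * π - h = x - h + 2 * π := by ring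
      simp only [e1, pF, dr, pG]) h
    simpa using this
  simp only [ftc_r hF hG]
  rw [show (∫ p, (dr F p * dq h G p - dq (-h) F p * dr G p) ∂(mI.prod mT)) =
    ∫ p, (dr F p * dq h G p + h⁻¹ * (F (p.1, p.2 - h) * dr G p - F p * dr G p)) ∂(mI.prod mT) by
      congr 1; ext p; simp only [dq, ← sub_eq_add_neg]; field_simp; ring]
  have j4 : Integrable (fun p : RR => h⁻¹ * (F (p.1, p.2 - h) * dr G p - F p * dr G p)) (mI.prod mT) :=
    (i4.sub i3).const_mul _
  have j2 : Integrable (fun p : RR => h⁻¹ * (F p * dr G (p.1, p.2 + h) - F p * dr G p)) (mI.prod mT) :=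
    (i2.sub i3).const_mul _
  rw [integral_add i1 j4, integral_const_mul, integral_sub i4 i3, ← sw,
    ← integral_sub i2 i3, ← integral_const_mul, ← integral_add i1 j2]
  refine Eq.trans ?_ (integral_prod_symm _ (i1.add j2)).symm
  congr 1; ext t
  congr 1; ext r
  simp only [Pi.add_apply]
  ring

lemma stokes_r {F G : RR → ℝ} {CF CG : ℝ≥0} (hF : LipschitzWith CF F) (hG : LipschitzWith CG G)
    (pF : ∀ r t, F (r, t + 2 * π) = F (r, t)) (pG : ∀ r t, G (r, t + 2 * π) = G (r, t))
    {B : ℝ} (hB : ∀ p, |F p| ≤ B) :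
    ∫ p, jd F G p ∂(mI.prod mT) =
    ∫ t, (F (1, t) * deriv (fun t => G (1, t)) t - F (0, t) * deriv (fun t => G (0, t)) t) ∂mT := by
  set h : ℕ → ℝ := fun n => 1 / ((n:ℝ) + 1) with hh
  have h0 : ∀ n, h n ≠ 0 := fun n => by simp only [hh]; positivity
  have hl : Tendsto h atTop (nhds 0) := tendsto_one_div_add_atTop_nhds_zero_nat
  have h0' : ∀ n, -h n ≠ 0 := fun n => neg_ne_zero.2 (h0 n)
  have hl' : Tendsto (fun n => -h n) atTop (nhds 0) := by simpa using hl.neg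
  have cF := hF.continuous
  have cG := hG.continuous
  have A : Tendsto (fun n => ∫ p, (dr F p * dq (h n) G p - dq (-h n) F p * dr G p) ∂(mI.prod mT)) atTop
      (nhds (∫ p, jd F G p ∂(mI.prod mT))) := by
    refine tendsto_integral_of_dominated_convergence (fun _ => (CF:ℝ) * CG + CF * CG) ?_ ?_ ?_ ?_
    · intro n
      exact (((dr_meas cF).mul (dq_cont cG _).measurable).sub
        ((dq_cont cF _).measurable.mul (dr_meas cG))).aestronglyMeasurable
    · exact integrable_const _
    · intro n
      refine .of_forall fun p => ?_
      refine (norm_sub_le _ _).trans (add_le_add ?_ ?_)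
      · exact bmul (dr_bd hF p) (dq_bd hG (h0 n) p)
      · exact bmul (dq_bd hF (h0' n) p) (dr_bd hG p)
    · rw [Measure.prod_restrict]
      apply ae_restrict_of_ae
      have e1 : ∀ᵐ p : RR, DifferentiableAt ℝ F p := hF.ae_differentiableAt
      have e2 : ∀ᵐ p : RR, DifferentiableAt ℝ G p := hG.ae_differentiableAt
      filter_upwards [e1, e2] with p d1 d2
      have l1 := dq_lim (fd_snd d2) h0 hl
      have l2 := dq_lim (fd_snd d1) h0' hl'
      simp only [jd, wd, fd_fst d1, fd_fst d2]
      exact (l1.const_mul _).sub (l2.mul_const _)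
  have A2 : Tendsto (fun n => ∫ t, (F (1, t) * dq (h n) G (1, t) - F (0, t) * dq (h n) G (0, t)) ∂mT) atTop
      (nhds (∫ t, (F (1, t) * deriv (fun t => G (1, t)) t - F (0, t) * deriv (fun t => G (0, t)) t) ∂mT)) := by
    refine tendsto_integral_of_dominated_convergence (fun _ => B * CG + B * CG) ?_ ?_ ?_ ?_
    · intro n
      have := dq_cont cG (h n)
      fun_prop
    · exact integrable_const _
    · intro n
      refine .of_forall fun p => ?_
      refine (norm_sub_le _ _).trans (add_le_add ?_ ?_)
      · exact bmul (hB _) (dq_bd hG (h0 n) _)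
      · exact bmul (hB _) (dq_bd hG (h0 n) _)
    · apply ae_restrict_of_ae
      filter_upwards [(lip_snd hG 1).ae_differentiableAt_real, (lip_snd hG 0).ae_differentiableAt_real]
        with t d1 d0
      have l1 := dq_lim d1.hasDerivAt h0 hl
      have l2 := dq_lim d0.hasDerivAt h0 hl
      exact (l1.const_mul _).sub (l2.const_mul _)
  refine tendsto_nhds_unique A (A2.congr fun n => ?_)
  exact stokes_h hF hG pF pG hB (h0 n)

noncomputable def pol (p : RR) : RR := (max 0 (min 1 p.1) * cos p.2, max 0 (min 1 p.1) * sin p.2)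

lemma pol_lip : ∃ C, LipschitzWith C pol := by
  refine ⟨2, LipschitzWith.of_dist_le_mul fun p q => ?_⟩
  have a1 : |max 0 (min 1 p.1) - max 0 (min 1 q.1)| ≤ |p.1 - q.1| := by
    grind
  have a2 := Real.abs_cos_sub_cos_le p.2 q.2
  have a3 := Real.abs_sin_sub_sin_le p.2 q.2
  have b1 : |p.1 - q.1| ≤ dist p q := by rw [← dist_eq]; exact le_max_left _ _
  have b2 : |p.2 - q.2| ≤ dist p q := by rw [← dist_eq]; exact le_max_right _ _
  have c1 : |max 0 (min 1 q.1)| ≤ 1 := by rw [abs_of_nonneg (le_max_left _ _)]; simp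
  have gen : ∀ a b x y : ℝ, |a - b| ≤ dist p q → |x - y| ≤ dist p q → |b| ≤ 1 → |x| ≤ 1 →
      |a * x - b * y| ≤ 2 * dist p q := by
    intro a b x y h1 h2 h3 h4
    rw [show a * x - b * y = (a - b) * x + b * (x - y) by ring]
    refine (abs_add_le _ _).trans ?_
    have := bmul h1 h4
    have := bmul h3 h2
    linarith
  rw [Prod.dist_eq]
  refine max_le ?_ ?_
  · exact gen _ _ _ _ (a1.trans b1) (a2.trans b2) c1 (Real.abs_cos_le_one _)
  · exact gen _ _ _ _ (a1.trans b1) (a3.trans b2) c1 (Real.abs_sin_le_one _)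

lemma pol_mem (p : RR) : pol p ∈ D2 := by
  have h0 : 0 ≤ max 0 (min 1 p.1) := le_max_left _ _
  have h1 : max 0 (min 1 p.1) ≤ 1 := by simp
  simp only [pol, D2, mem_ofPred_eq]
  generalize max 0 (min 1 p.1) = m at *
  have := sin_sq_add_cos_sq p.2
  have : (m * cos p.2) ^ 2 + (m * sin p.2) ^ 2 = m ^ 2 := by
    grind
  rw [this]; nlinarith

lemma grad_pol {f : RR → ℝ} {p : RR} (h0 : 0 < p.1) (h1 : p.1 < 1)
    (hf : DifferentiableAt ℝ f (polarCoord.symm p)) :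
    grad (f ∘ pol) p = (cos p.2 * (grad f (polarCoord.symm p)).1 + sin p.2 * (grad f (polarCoord.symm p)).2,
      -(p.1 * sin p.2) * (grad f (polarCoord.symm p)).1 + p.1 * cos p.2 * (grad f (polarCoord.symm p)).2) := by
  have ev : pol =ᶠ[nhds p] polarCoord.symm := by
    have : ∀ᶠ q : RR in nhds p, 0 < q.1 ∧ q.1 < 1 :=
      (((isOpen_lt continuous_const continuous_fst).inter (isOpen_lt continuous_fst continuous_const)).mem_nhds ⟨h0, h1⟩)
    filter_upwards [this] with q hq
    simp [pol, polarCoord, min_eq_right hq.2.le, max_eq_right hq.1.le]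
  have ev2 : f ∘ pol =ᶠ[nhds p] f ∘ polarCoord.symm := ev.fun_comp f
  have hp := hasFDerivAt_polarCoord_symm p
  have hd : fderiv ℝ (f ∘ pol) p = _ := (ev2.fderiv_eq).trans (hf.hasFDerivAt.comp p hp).fderiv
  simp only [grad, hd, ContinuousLinearMap.comp_apply]
  have k1 : (fderivPolarCoordSymm p) (1, 0) = (cos p.2, sin p.2) := by
    simp [fderivPolarCoordSymm, Matrix.toLin_finTwoProd_apply]
  have k2 : (fderivPolarCoordSymm p) (0, 1) = (-(p.1 * sin p.2), p.1 * cos p.2) := by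
    simp [fderivPolarCoordSymm, Matrix.toLin_finTwoProd_apply]
  rw [k1, k2, fderiv_grad, fderiv_grad]; simp [grad]

lemma ae_pol {P : RR → Prop} (h : ∀ᵐ x, P x) :
    ∀ᵐ p ∂(volume.restrict polarCoord.target), P (polarCoord.symm p) := by
  have h1 : ∫⁻ p in polarCoord.target, ofReal p.1 • (toMeasurable volume {x | ¬ P x}).indicator 1 (polarCoord.symm p) = 0 := by
    rw [lintegral_comp_polarCoord_symm, lintegral_indicator_one (measurableSet_toMeasurable _ _),
      measure_toMeasurable]
    exact ae_iff.1 h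
  have mm : Measurable fun p : RR => polarCoord.symm p := continuous_polarCoord_symm.measurable
  rw [lintegral_eq_zero_iff] at h1
  · filter_upwards [h1, ae_restrict_mem polarCoord.open_target.measurableSet] with p hp hm
    by_contra hc
    have : polarCoord.symm p ∈ toMeasurable volume {x | ¬ P x} := subset_toMeasurable _ _ hc
    have h3 : (0:ℝ) < p.1 := hm.1
    rw [Pi.zero_apply, indicator_of_mem this, Pi.one_apply, smul_eq_mul, mul_one,
      ENNReal.ofReal_eq_zero] at hp
    linarith
  · refine Measurable.smul (M := ℝ≥0∞) (f := fun p : RR => ofReal p.1) FP ?_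
    exact (measurable_one.indicator (measurableSet_toMeasurable _ _)).comp mm

lemma stokes {f g : RR → ℝ} {Cf Cg : ℝ≥0} (hf : LipschitzWith Cf f) (hg : LipschitzWith Cg g) :
    ∫ x in D2, jd f g x = ∫ t in (-π)..Real.pi, f (cos t, sin t) *
      deriv (fun t => g (cos t, sin t)) t := by
  have hp := pi_pos
  obtain ⟨C, hC⟩ := pol_lip
  obtain ⟨B, hB⟩ := D2_cpt.exists_bound_of_continuousOn hf.continuous.continuousOn
  have per : ∀ r t, pol (r, t + 2 * π) = pol (r, t) := by intro r t; simp [pol]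
  have key := stokes_r (hf.comp hC) (hg.comp hC) (fun r t => by simp [per]) (fun r t => by simp [per])
    (B := B) (fun p => hB _ (pol_mem p))
  have e0 : ∀ t, pol (0, t) = (0, 0) := fun t => by simp [pol]
  have e1 : ∀ t, pol (1, t) = (cos t, sin t) := fun t => by simp [pol]
  simp only [Function.comp_apply, e0, e1, deriv_const, mul_zero, sub_zero] at key
  rw [intervalIntegral.integral_of_le LL, ← key, ← integral_indicator D2_closed.measurableSet,
    ← integral_comp_polarCoord_symm]
  rw [Measure.prod_restrict, ← Measure.volume_eq_prod]
  have s1 : (Ioo 0 1 ×ˢ Ioo (-π) π : Set RR) =ᵐ[volume]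
      (Ioc 0 1 ×ˢ Ioc (-π) π : Set RR) := by
    rw [Measure.volume_eq_prod]
    exact Measure.set_prod_ae_eq Ioo_ae_eq_Ioc Ioo_ae_eq_Ioc
  have s2 : (Ioi 0 ×ˢ Ioo (-π) π ∩ {p : RR | p.1 ≤ 1} : Set RR) =ᵐ[volume]
      (Ioo 0 1 ×ˢ Ioo (-π) π : Set RR) := by
    have : (Ioi 0 ×ˢ Ioo (-π) π ∩ {p : RR | p.1 ≤ 1} : Set RR) =
        (Ioc 0 1 ×ˢ Ioo (-π) π : Set RR) := by
      grind
    rw [this, Measure.volume_eq_prod]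
    exact Measure.set_prod_ae_eq Ioo_ae_eq_Ioc.symm (ae_eq_refl _)
  rw [← setIntegral_congr_set s1, ← setIntegral_congr_set s2, ← setIntegral_indicator
    (measurableSet_le measurable_fst measurable_const)]
  have d1 : ∀ᵐ p : RR, DifferentiableAt ℝ f p := hf.ae_differentiableAt
  have d2 : ∀ᵐ p : RR, DifferentiableAt ℝ g p := hg.ae_differentiableAt
  have n1 : ∀ᵐ p : RR ∂(volume.restrict polarCoord.target), p.1 ≠ 1 := by
    apply ae_restrict_of_ae
    have : volume ({1} ×ˢ Set.univ : Set RR) = 0 := by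
      rw [Measure.volume_eq_prod, Measure.prod_prod]; simp
    rw [ae_iff]
    convert this using 2
    ext p; simp
  apply integral_congr_ae
  filter_upwards [ae_pol d1, ae_pol d2, n1, ae_restrict_mem polarCoord.open_target.measurableSet] with p a1 a2 a3 a4
  have a4 : (0:ℝ) < p.1 := a4.1
  have mem : polarCoord.symm p ∈ D2 ↔ p.1 ≤ 1 := by
    change (p.1 * cos p.2) ^ 2 + (p.1 * sin p.2) ^ 2 ≤ 1 ↔ _
    have := sin_sq_add_cos_sq p.2
    rw [mul_pow, mul_pow, ← mul_add, add_comm, this, mul_one]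
    exact sq_le_one_iff₀ a4.le
  by_cases h : p.1 ≤ 1
  · rw [indicator_of_mem (mem.2 h), indicator_of_mem (by exact h)]
    have h : p.1 < 1 := lt_of_le_of_ne h a3
    simp only [jd, grad_pol a4 h a1, grad_pol a4 h a2, wd, smul_eq_mul]
    have := sin_sq_add_cos_sq p.2
    linear_combination (-(p.1 * ((grad f (polarCoord.symm p)).1 * (grad g (polarCoord.symm p)).2 -
      (grad f (polarCoord.symm p)).2 * (grad g (polarCoord.symm p)).1))) * this
  · simp_all

def LD (f : RR → ℝ) : Prop := ∃ C : ℝ≥0, LipschitzOnWith C f D2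

lemma LD.ext {f : RR → ℝ} (hf : LD f) : ∃ f', (∃ C, LipschitzWith C f') ∧ EqOn f f' D2 := by
  obtain ⟨C, hC⟩ := hf
  obtain ⟨f', h1, h2⟩ := hC.extend_real
  grind

lemma evEq {f f' : RR → ℝ} (h : EqOn f f' D2) {x : RR} (hx : x ∈ interior D2) :
    f =ᶠ[nhds x] f' := by
  filter_upwards [isOpen_interior.mem_nhds hx] with y hy using h (interior_subset hy)

lemma grad_congr {f f' : RR → ℝ} (h : EqOn f f' D2) {x : RR} (hx : x ∈ interior D2) :
    grad f x = grad f' x := by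
  simp only [grad, (evEq h hx).fderiv_eq]

lemma ae_int : ∀ᵐ x ∂(volume.restrict D2), x ∈ interior D2 :=
  ae_D2_of_int (.of_forall fun _ h => h)

lemma LD.ae_diff {f : RR → ℝ} (hf : LD f) : ∀ᵐ x ∂(volume.restrict D2), DifferentiableAt ℝ f x := by
  obtain ⟨f', ⟨C, hC⟩, h2⟩ := hf.ext
  filter_upwards [ae_int, ae_restrict_of_ae hC.ae_differentiableAt] with x h1 h3
  exact h3.congr_of_eventuallyEq (evEq h2 h1)

lemma LD.cont {f : RR → ℝ} (hf : LD f) : ContinuousOn f D2 := by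
  obtain ⟨C, hC⟩ := hf
  exact hC.continuousOn

lemma LD.bdd {f : RR → ℝ} (hf : LD f) : ∃ B : ℝ, 0 ≤ B ∧ ∀ x ∈ D2, |f x| ≤ B := by
  obtain ⟨B, hB⟩ := D2_cpt.exists_bound_of_continuousOn hf.cont
  exact ⟨|B|, abs_nonneg _, fun x hx => (hB x hx).trans (le_abs_self _)⟩

lemma LD.of {f : RR → ℝ} {C : ℝ} (h : ∀ x ∈ D2, ∀ y ∈ D2, |f x - f y| ≤ C * dist x y) : LD f := by
  refine ⟨C.toNNReal, LipschitzOnWith.of_dist_le_mul fun x hx y hy => ?_⟩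
  refine (h x hx y hy).trans ?_
  gcongr
  simp

lemma LD.le {f : RR → ℝ} (hf : LD f) : ∃ C : ℝ, 0 ≤ C ∧ ∀ x ∈ D2, ∀ y ∈ D2, |f x - f y| ≤ C * dist x y := by
  obtain ⟨C, hC⟩ := hf
  exact ⟨C, C.2, fun x hx y hy => hC.dist_le_mul x hx y hy⟩

lemma LD.mul {f g : RR → ℝ} (hf : LD f) (hg : LD g) : LD (fun x => f x * g x) := by
  obtain ⟨C, c0, hC⟩ := hf.le
  obtain ⟨C', c0', hC'⟩ := hg.le
  obtain ⟨B, b0, hB⟩ := hf.bdd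
  obtain ⟨B', b0', hB'⟩ := hg.bdd
  refine LD.of (C := C * B' + B * C') fun x hx y hy => ?_
  rw [show f x * g x - f y * g y = (f x - f y) * g x + f y * (g x - g y) by ring]
  refine (abs_add_le _ _).trans ?_
  have := bmul (hC x hx y hy) (hB' x hx)
  have := bmul (hB y hy) (hC' x hx y hy)
  linarith

lemma LD.comp {f : RR → ℝ} (hf : LD f) {P : ℝ → ℝ} {C : ℝ≥0} (hP : LipschitzWith C P) : LD (fun x => P (f x)) := by
  obtain ⟨C', h⟩ := hf
  exact ⟨_, hP.comp_lipschitzOnWith h⟩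

lemma LD.grad_bd {f : RR → ℝ} (hf : LD f) : ∃ B : ℝ, ∀ x ∈ interior D2, |(grad f x).1| ≤ B ∧ |(grad f x).2| ≤ B := by
  obtain ⟨f', ⟨C, hC⟩, h2⟩ := hf.ext
  refine ⟨C, fun x hx => ?_⟩
  rw [grad_congr h2 hx]
  have : ∀ v : RR, ‖v‖ ≤ 1 → |fderiv ℝ f' x v| ≤ C := fun v hv => by
    have h1 := (fderiv ℝ f' x).le_opNorm v
    have h3 := norm_fderiv_le_of_lipschitz ℝ hC (x₀ := x)
    rw [← norm_eq_abs]
    refine h1.trans ?_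
    nlinarith [norm_nonneg v, norm_nonneg (fderiv ℝ f' x), C.2]
  exact ⟨this _ (by simp [Prod.norm_def]), this _ (by simp [Prod.norm_def])⟩

lemma jd_meas (f g : RR → ℝ) : Measurable (jd f g) := by
  have m := fun (f : RR → ℝ) (v : RR) => measurable_fderiv_apply_const ℝ f v
  exact ((m f (1, 0)).mul (m g (0, 1))).sub ((m f (0, 1)).mul (m g (1, 0)))

instance : IsFiniteMeasure ((volume : Measure RR).restrict D2) := ⟨by simpa using D2_vol⟩

lemma LD.jd_bd {f g : RR → ℝ} (hf : LD f) (hg : LD g) : ∃ B : ℝ, ∀ x ∈ interior D2, |jd f g x| ≤ B := by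
  obtain ⟨A, hA⟩ := hf.grad_bd
  obtain ⟨B, hB⟩ := hg.grad_bd
  refine ⟨A * B + A * B, fun x hx => ?_⟩
  refine (norm_sub_le (_ : ℝ) _).trans (add_le_add ?_ ?_)
  · exact bmul (hA x hx).1 (hB x hx).2
  · exact bmul (hA x hx).2 (hB x hx).1

lemma LD.jd_int {f g : RR → ℝ} (hf : LD f) (hg : LD g) : IntegrableOn (jd f g) D2 := by
  obtain ⟨B, hB⟩ := hf.jd_bd hg
  refine Integrable.of_bound (jd_meas f g).aestronglyMeasurable B ?_
  filter_upwards [ae_int] with x hx using hB x hx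

noncomputable def circ (t : ℝ) : RR := (cos (2 * π * t), sin (2 * π * t))

lemma circ_mem (t : ℝ) : circ t ∈ D2 := by
  simp [circ, D2]

lemma stokes_on {f g : RR → ℝ} (hf : LD f) (hg : LD g) :
    ∫ x in D2, jd f g x = ∫ t in (0:ℝ)..1, f (circ t) * deriv (fun t => g (circ t)) t := by
  obtain ⟨f', ⟨C, hC⟩, h2⟩ := hf.ext
  obtain ⟨g', ⟨C', hC'⟩, h2'⟩ := hg.ext
  have e1 : ∫ x in D2, jd f g x = ∫ x in D2, jd f' g' x := by
    apply integral_congr_ae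
    filter_upwards [ae_int] with x hx
    simp only [jd, grad_congr h2 hx, grad_congr h2' hx]
  have e2 : ∀ t, f (circ t) = f' (circ t) := fun t => h2 (circ_mem t)
  have e3 : ∀ t, g (circ t) = g' (circ t) := fun t => h2' (circ_mem t)
  simp only [e1, e2, e3]
  rw [stokes hC hC']
  set v : ℝ → ℝ := fun t => g' (cos t, sin t) with hv
  set w : ℝ → ℝ := fun t => f' (cos t, sin t) * deriv v t with hw
  have e4 : ∀ t, f' (circ t) * deriv (fun t => g' (circ t)) t = 2 * π * w (2 * π * t) := by
    intro t
    have : deriv (fun t => g' (circ t)) t = 2 * π * deriv v (2 * π * t) :=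
      (deriv_comp_mul_left (2 * π) v t).trans SP
    rw [this, hw]; simp only [circ]; ring
  simp only [e4]
  rw [intervalIntegral.integral_const_mul, intervalIntegral.mul_integral_comp_mul_left]
  have per : Function.Periodic w (2 * π) := by
    have pv : ∀ t, v (t + 2 * π) = v t := fun t => by simp [hv]
    intro t
    have : deriv v (t + 2 * π) = deriv v t := by
      rw [← deriv_comp_add_const]; simp only [pv]
    simp [hw, this]
  have := per.intervalIntegral_add_eq (-π) 0
  convert this using 2 <;> ring

lemma comass_ae' {X : Type u} [PseudoMetricSpace X] {φ : RR → X} {K : ℝ≥0}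
    (hφ : LipschitzOnWith K φ D2) (f : ℕ → RR → ℝ)
    (hf : ∀ i, Fits φ (f i)) {l : ℕ → ℝ} {n : ℕ} (l0 : ∀ i, 0 ≤ l i)
    (l1 : ∑ i ∈ range n, l i = 1) : ∀ᵐ x ∂(volume.restrict D2),
    π / 2 * ∑ i ∈ range n, ∑ j ∈ range n, l i * l j * |jd (f i) (f j) x| ≤
      jac2 (mder φ x) := by
  have hL : ∀ i, LD (f i) := fun i => LD.of (C := K) fun x hx y hy =>
    (hf i x hx y hy).trans (hφ.dist_le_mul x hx y hy)
  choose f' h1 h2 using fun i => (hL i).ext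
  have := comass_ae hφ f' h1 (fun i x hx y hy => by
    rw [← h2 i hx, ← h2 i hy]; exact hf i x hx y hy) l0 l1
  filter_upwards [this, ae_int] with x h3 hx
  simpa only [jd, grad_congr (h2 _) hx] using h3

lemma Fits.LD {X : Type u} [PseudoMetricSpace X] {φ : RR → X} {K : ℝ≥0}
    (hφ : LipschitzOnWith K φ D2) {f : RR → ℝ} (hf : Fits φ f) : LD f :=
  LD.of (C := K) fun x hx y hy => (hf x hx y hy).trans (hφ.dist_le_mul x hx y hy)

lemma jd_le_jac {X : Type u} [PseudoMetricSpace X] {φ : RR → X} {K : ℝ≥0}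
    (hφ : LipschitzOnWith K φ D2) {f g : RR → ℝ} (hf : Fits φ f) (hg : Fits φ g) :
    ∀ᵐ x ∂(volume.restrict D2), |jd f g x| ≤ 4 / π * jac2 (mder φ x) := by
  have := comass_ae' hφ (fun i => if i = 0 then f else g) (fun i => by split_ifs <;> assumption)
    (l := fun _ => 1 / 2) (n := 2) (fun _ => by norm_num) NN
  filter_upwards [this] with x hx
  have e : |jd g f x| = |jd f g x| := wd_symm _ _
  have e1 : ∀ f, jd f f x = 0 := fun f => by simp [jd, wd, mul_comm]
  simp [sum_range_succ, e, e1] at hx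
  have := pi_pos
  rw [div_mul_eq_mul_div, le_div_iff₀ this]
  linarith

lemma ibp {f g h : RR → ℝ} (hf : LD f) (hg : LD g) (hh : LD h) {P b P' b' : ℝ → ℝ} {C C' : ℝ≥0}
    (hP : ∀ t, HasDerivAt P (P' t) t) (hb : ∀ t, HasDerivAt b (b' t) t) (lP : LipschitzWith C P)
    (lb : LipschitzWith C' b) (h0 : ∀ t, P (f (circ t)) * b (g (circ t)) = 0)  :
    ∫ x in D2, (h x * (P' (f x) * b (g x)) * jd f g x + P (f x) * b (g x) * jd h g x) = 0 := by
  have hw : LD (fun x => P (f x) * b (g x) * h x) := ((hf.comp lP).mul (hg.comp lb)).mul hh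
  have key := stokes_on hw hg
  simp only [h0, zero_mul, intervalIntegral.integral_zero] at key
  rw [← key]
  apply integral_congr_ae
  filter_upwards [hf.ae_diff, hg.ae_diff, hh.ae_diff] with x df dg dh
  have d1 : HasFDerivAt (fun x => P (f x)) (P' (f x) • fderiv ℝ f x) x := (hP _).comp_hasFDerivAt x df.hasFDerivAt
  have d2 : HasFDerivAt (fun x => b (g x)) (b' (g x) • fderiv ℝ g x) x := (hb _).comp_hasFDerivAt x dg.hasFDerivAt
  have d3 := ((d1.mul d2).mul dh.hasFDerivAt).fderiv
  have d4 : fderiv ℝ (fun x => P (f x) * b (g x) * h x) x = _ := d3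
  simp only [jd, grad, d4, wd]
  simp
  ring

noncomputable def pairD (f g : RR → ℝ) (x : RR) : RR →L[ℝ] RR := (fderiv ℝ f x).prod (fderiv ℝ g x)

lemma pairD_det (f g : RR → ℝ) (x : RR) : (pairD f g x).det = jd f g x := by
  have : ((pairD f g x : RR →L[ℝ] RR) : RR →ₗ[ℝ] RR) =
      linM ((grad f x).1, (grad g x).1) ((grad f x).2, (grad g x).2) := by
    apply LinearMap.ext
    intro v
    rw [linM_apply]
    change (fderiv ℝ f x v, fderiv ℝ g x v) = _
    rw [fderiv_grad, fderiv_grad]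
    ext <;> simp
  rw [ContinuousLinearMap.det, this, linM_det, jd, wd, wd]; ring

def regE (f g : RR → ℝ) : Set RR :=
  interior D2 ∩ ({x | DifferentiableAt ℝ f x} ∩ ({x | DifferentiableAt ℝ g x} ∩ {x | jd f g x ≠ 0}))

lemma regE_meas (f g : RR → ℝ) : MeasurableSet (regE f g) :=
  isOpen_interior.measurableSet.inter ((measurableSet_of_differentiableAt ℝ f).inter
    ((measurableSet_of_differentiableAt ℝ g).inter ((jd_meas f g) (measurableSet_singleton 0).compl)))

lemma regE_part (f g : RR → ℝ) : ∃ e : ℕ → Set RR, Pairwise (Function.onFun Disjoint e) ∧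
    (∀ n, MeasurableSet (e n)) ∧ (⋃ n, e n) = regE f g ∧ ∀ n, Set.InjOn (fun x => (f x, g x)) (e n) := by
  have hd : ∀ x ∈ regE f g, HasFDerivWithinAt (fun x => (f x, g x)) (pairD f g x) (regE f g) x :=
    fun x hx => (hx.2.1.hasFDerivAt.prodMk hx.2.2.1.hasFDerivAt).hasFDerivWithinAt
  classical
  obtain ⟨t, A, h1, h2, h3, h4, h5⟩ := exists_partition_approximatesLinearOn_of_hasFDerivWithinAt
    (fun x => (f x, g x)) (regE f g) (pairD f g) hd
    (fun A => if h : A.det ≠ 0 then ‖((A.toContinuousLinearEquivOfDetNeZero h).symm : RR →L[ℝ] RR)‖₊⁻¹ / 2 else 1)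
    (by
      intro A
      split_ifs with h
      · have := (A.toContinuousLinearEquivOfDetNeZero h).nnnorm_symm_pos
        positivity
      · linarith)
  refine ⟨fun n => regE f g ∩ t n, fun i j hij => (h1 hij).mono Set.inter_subset_right Set.inter_subset_right,
    fun n => (regE_meas f g).inter (h2 n), ?_, fun n => ?_⟩
  · rw [← Set.inter_iUnion]; exact Set.inter_eq_left.2 h3
  · rcases (regE f g).eq_empty_or_nonempty with he | hne
    · rw [he]; simp
    obtain ⟨y, hy, hA⟩ := h5 hne n
    have hdet : (A n).det ≠ 0 := by rw [hA, pairD_det]; exact hy.2.2.2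
    have h6 := h4 n
    rw [dif_pos hdet] at h6
    have h7 : ApproximatesLinearOn (fun x => (f x, g x))
      (((A n).toContinuousLinearEquivOfDetNeZero hdet : RR ≃L[ℝ] RR) : RR →L[ℝ] RR)
        (regE f g ∩ t n) (‖(((A n).toContinuousLinearEquivOfDetNeZero hdet).symm : RR →L[ℝ] RR)‖₊⁻¹ / 2) := by
      rw [ContinuousLinearMap.coe_toContinuousLinearEquivOfDetNeZero]; exact h6
    refine h7.injOn (Or.inr ?_)
    apply NNReal.half_lt_self
    have := ((A n).toContinuousLinearEquivOfDetNeZero hdet).nnnorm_symm_pos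
    positivity

structure Slice (f g : RR → ℝ) where
  J : ℕ → Set RR
  x : ℕ → RR → RR
  σ : ℕ → RR → ℤ
  hJ : ∀ n, MeasurableSet (J n)
  hσ : ∀ n y, |σ n y| = 1
  hx : ∀ n, ∀ y ∈ J n, x n y ∈ D2 ∧ f (x n y) = y.1 ∧ g (x n y) = y.2
  hN : ∑' n, volume (J n) ≤ ∫⁻ x in D2, ofReal |jd f g x|
  hint : ∀ h, LD h → ∀ n, Integrable ((J n).indicator fun y => (σ n y : ℝ) * h (x n y))
  hsum : ∀ h, LD h → ∀ η : RR → ℝ, Continuous η →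
    HasSum (fun n => ∫ y in J n, ((σ n y : ℝ) * h (x n y)) * η y) (∫ x in D2, h x * η (f x, g x) * jd f g x)

local notation "SJ(" S ", " n ", " h ")" => Set.indicator (Slice.J S n) (fun y => (Slice.σ S n y : ℝ) * h (Slice.x S n y))

open Classical in
lemma slices {f g : RR → ℝ} (hf : LD f) (hg : LD g) : Nonempty (Slice f g) := by
  obtain ⟨e, he1, he2, he3, he4⟩ := regE_part f g
  have sub : ∀ n, e n ⊆ regE f g := fun n => he3 ▸ Set.subset_iUnion e n
  have subD : regE f g ⊆ D2 := fun x hx => interior_subset hx.1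
  set Φ : RR → RR := fun x => (f x, g x) with hΦ
  have hd : ∀ n, ∀ x ∈ e n, HasFDerivWithinAt Φ (pairD f g x) (e n) x := fun n x hx =>
    ((sub n hx).2.1.hasFDerivAt.prodMk (sub n hx).2.2.1.hasFDerivAt).hasFDerivWithinAt
  set s : ℕ → RR → RR := fun n => Function.invFunOn Φ (e n) with hs
  set σ : ℕ → RR → ℤ := fun n y => if 0 < jd f g (s n y) then 1 else -1 with hσ
  have inv : ∀ n, ∀ x ∈ e n, s n (Φ x) = x := fun n x hx => (he4 n).leftInvOn_invFunOn hx
  have sg : ∀ n, ∀ x ∈ e n, |jd f g x| * (σ n (Φ x) : ℝ) = jd f g x := by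
    intro n x hx
    simp only [hσ, inv n x hx]
    split_ifs with h
    · rw [abs_of_pos h]; simp
    · grind
  have hI : ∀ h, LD h → ∀ η : RR → ℝ, Continuous η → IntegrableOn (fun x => h x * η (f x, g x) * jd f g x) D2 := by
    intro h hh η hη
    have c : ContinuousOn (fun x => h x * η (f x, g x)) D2 :=
      hh.cont.mul (hη.comp_continuousOn (hf.cont.prodMk hg.cont))
    obtain ⟨B, hB⟩ := D2_cpt.exists_bound_of_continuousOn c
    refine (hf.jd_int hg).bdd_mul (c := B) (c.aestronglyMeasurable D2_closed.measurableSet) ?_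
    filter_upwards [ae_restrict_mem D2_closed.measurableSet] with x hx using hB x hx
  have alg : ∀ h : RR → ℝ, ∀ η : RR → ℝ, ∀ n, ∀ x ∈ e n,
      |(pairD f g x).det| • ((σ n (Φ x) : ℝ) * h (s n (Φ x)) * η (Φ x)) = h x * η (f x, g x) * jd f g x := by
    intro h η n x hx
    rw [inv n x hx, pairD_det, smul_eq_mul]
    grind
  refine ⟨⟨fun n => Φ '' e n, s, σ, ?_, ?_, ?_, ?_, ?_, ?_⟩⟩
  · intro n; exact measurable_image_of_fderivWithin (he2 n) (hd n) (he4 n)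
  · grind
  · grind
  · have : ∀ n, volume (Φ '' e n) = ∫⁻ x in e n, ofReal |jd f g x| := fun n => by
      rw [← lintegral_abs_det_fderiv_eq_addHaar_image volume (he2 n) (hd n) (he4 n)]
      simp only [pairD_det]
    simp only [this]
    rw [← lintegral_iUnion he2 he1, he3]
    exact lintegral_mono_set subD
  · intro h hh n
    rw [integrable_indicator_iff (measurable_image_of_fderivWithin (he2 n) (hd n) (he4 n)),
      integrableOn_image_iff_integrableOn_abs_det_fderiv_smul volume (he2 n) (hd n) (he4 n)]
    have := (hI h hh (fun _ => 1) continuous_const).mono_set ((sub n).trans subD)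
    refine this.congr_fun (fun x hx => ?_) (he2 n)
    have := alg h (fun _ => 1) n x hx
    simp_all
  · intro h hh η hη
    have e1 : ∀ n, ∫ y in Φ '' e n, (σ n y : ℝ) * h (s n y) * η y = ∫ x in e n, h x * η (f x, g x) * jd f g x := by
      intro n
      rw [integral_image_eq_integral_abs_det_fderiv_smul volume (he2 n) (hd n) (he4 n)]
      exact setIntegral_congr_fun (he2 n) fun x hx => alg h η n x hx
    simp only [e1]
    have e2 : ∫ x in D2, h x * η (f x, g x) * jd f g x = ∫ x in regE f g, h x * η (f x, g x) * jd f g x := by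
      refine setIntegral_eq_of_subset_of_ae_sdiff_eq_zero D2_closed.measurableSet.nullMeasurableSet subD ?_
      have := (ae_restrict_iff' D2_closed.measurableSet).1 (((ae_int.and hf.ae_diff).and hg.ae_diff))
      filter_upwards [this] with x h1 h2
      obtain ⟨⟨h3, h4⟩, h5⟩ := h1 h2.1
      have : jd f g x = 0 := by
        by_contra hc
        exact h2.2 ⟨h3, h4, h5, hc⟩
      rw [this, mul_zero]
    rw [e2, ← he3]
    refine hasSum_integral_iUnion he2 he1 ((hI h hh η hη).mono_set ?_)
    rw [he3]; exact subD

noncomputable def Slice.U {f g : RR → ℝ} (S : Slice f g) (h : RR → ℝ) (y : RR) : ℝ :=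
  ∑' n, SJ(S, n, h) y

lemma Slice.fin {f g : RR → ℝ} (hf : LD f) (hg : LD g) (S : Slice f g) : ∑' n, volume (S.J n) ≠ ⊤ := by
  refine ne_top_of_le_ne_top ?_ S.hN
  have := (hf.jd_int hg).2
  simp only [HasFiniteIntegral, ← ofReal_norm, norm_eq_abs] at this
  exact this.ne

lemma Slice.summ {f g h : RR → ℝ} (hf : LD f) (hg : LD g) (hh : LD h) (S : Slice f g) {B : ℝ} {η : RR → ℝ}
    (hη : Continuous η) (hB : ∀ y, |η y| ≤ B) :
    (∀ n, Integrable (fun y => SJ(S, n, h) y * η y)) ∧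
    Summable fun n => ∫ y, ‖SJ(S, n, h) y * η y‖ := by
  obtain ⟨A, hA0, hA⟩ := hh.bdd
  have i1 : ∀ n, Integrable (fun y => SJ(S, n, h) y * η y) := fun n =>
    (S.hint h hh n).mul_bdd (c := B) hη.aestronglyMeasurable (.of_forall hB)
  refine ⟨i1, ?_⟩
  have fin := S.fin hf hg
  have s1 : Summable fun n => (volume (S.J n)).toReal := ENNReal.summable_toReal fin
  refine Summable.of_nonneg_of_le (fun n => integral_nonneg fun y => norm_nonneg _) (fun n => ?_) (s1.mul_left (A * B))
  have f1 : volume (S.J n) ≠ ⊤ := ne_top_of_le_ne_top fin (ENNReal.le_tsum n)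
  have : (volume (S.J n)).toReal * (A * B) = ∫ y, (S.J n).indicator (fun _ => A * B) y := by
    rw [integral_indicator_const _ (S.hJ n)]; rfl
  rw [mul_comm, this]
  refine integral_mono (i1 n).norm ((integrable_indicator_iff (S.hJ n)).2 (integrableOn_const f1)) fun y => ?_
  by_cases hy : y ∈ S.J n
  · simp only [indicator_of_mem hy]
    rw [norm_mul]
    gcongr
    · rw [norm_mul, norm_eq_abs, ← Int.cast_abs, S.hσ, Int.cast_one, one_mul]
      exact hA _ (S.hx n y hy).1
    · exact hB y
  · simp [indicator_of_notMem hy]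

lemma Slice.U_int {f g h : RR → ℝ} (hf : LD f) (hg : LD g) (hh : LD h) (S : Slice f g) {B : ℝ} {η : RR → ℝ}
    (hη : Continuous η) (hB : ∀ y, |η y| ≤ B) :
    ∫ y, S.U h y * η y = ∫ x in D2, h x * η (f x, g x) * jd f g x := by
  obtain ⟨i1, s1⟩ := S.summ hf hg hh hη hB
  have h1 := hasSum_integral_of_summable_integral_norm i1 s1
  have h2 := S.hsum h hh η hη
  simp only [tsum_mul_right] at h1
  have e : ∀ n, ∫ y, SJ(S, n, h) y * η y =
    ∫ y in S.J n, ((S.σ n y : ℝ) * h (S.x n y)) * η y := fun n => by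
      rw [← integral_indicator (S.hJ n)]
      congr 1; ext y
      by_cases hy : y ∈ S.J n <;> simp [hy]
  simp only [e] at h1
  exact h1.unique h2

lemma Slice.U_loc {f g h : RR → ℝ} (hf : LD f) (hg : LD g) (hh : LD h) (S : Slice f g) : Integrable (S.U h) := by
  obtain ⟨i1, s1⟩ := S.summ hf hg hh (η := fun _ => 1) (B := 1) continuous_const SP
  simp only [mul_one] at i1 s1
  unfold Slice.U
  have e : ∀ n, ∫⁻ y, ‖SJ(S, n, h) y‖ₑ =
      ofReal (∫ y, ‖SJ(S, n, h) y‖) := fun n =>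
    (ofReal_integral_norm_eq_lintegral_enorm (i1 n)).symm
  have fin : ∑' n, ∫⁻ y, ‖SJ(S, n, h) y‖ₑ ≠ ⊤ := by
    simp only [e]; exact s1.tsum_ofReal_ne_top
  have m : ∀ n, AEMeasurable (fun y => ‖SJ(S, n, h) y‖ₑ) :=
    fun n => (i1 n).1.enorm
  rw [← lintegral_tsum m] at fin
  have sm := ae_lt_top' (AEMeasurable.tsum m) fin
  refine ⟨aestronglyMeasurable_of_tendsto_ae atTop
    (f := fun k y => ∑ n ∈ range k, SJ(S, n, h) y)
    (fun k => Finset.aestronglyMeasurable_fun_sum _ fun n _ => (i1 n).1) ?_, ?_⟩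
  · filter_upwards [sm] with y hy
    have : Summable fun n => ‖SJ(S, n, h) y‖ := by
      have := ENNReal.summable_toReal hy.ne
      simpa using this
    exact this.of_norm.hasSum.tendsto_sum_nat
  · refine lt_of_le_of_lt (lintegral_mono fun y => enorm_tsum_le_tsum_enorm) fin.lt_top

noncomputable def tT : ℝ → ℝ := deriv smoothTransition

lemma tG_deriv (t : ℝ) : HasDerivAt smoothTransition (tT t) t :=
  ((smoothTransition.contDiff (n := 1)).differentiable one_ne_zero t).hasDerivAt

lemma tT_smooth : ContDiff ℝ 1 tT := by
  have := smoothTransition.contDiff (n := 2)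
  exact (contDiff_succ_iff_deriv (n := 1)).1 this |>.2.2

lemma tT_deriv (t : ℝ) : HasDerivAt tT (deriv tT t) t :=
  (tT_smooth.differentiable one_ne_zero t).hasDerivAt

lemma tT_zero {t : ℝ} (h : t ≤ 0 ∨ 1 ≤ t) : tT t = 0 := by
  rcases h with h | h
  · refine IsLocalMin.hasDerivAt_eq_zero (.of_forall fun s => ?_) (tG_deriv t)
    rw [smoothTransition.zero_of_nonpos h]; exact smoothTransition.nonneg s
  · refine IsLocalMax.hasDerivAt_eq_zero (.of_forall fun s => ?_) (tG_deriv t)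
    rw [smoothTransition.one_of_one_le h]; exact smoothTransition.le_one s

lemma tT_cs : HasCompactSupport tT := by
  refine HasCompactSupport.intro (isCompact_Icc (a := (0:ℝ)) (b := 1)) fun t ht => tT_zero ?_
  grind

lemma tT_bd : ∃ B : ℝ, 1 ≤ B ∧ ∀ t, |tT t| ≤ B ∧ |deriv tT t| ≤ B := by
  obtain ⟨C, hC⟩ := tT_smooth.continuous.bounded_above_of_compact_support tT_cs
  obtain ⟨C', hC'⟩ := (tT_smooth.continuous_deriv_one).bounded_above_of_compact_support tT_cs.deriv
  exact ⟨max 1 (max C C'), le_max_left _ _, fun t => ⟨(hC t).trans ((le_max_left _ _).trans (le_max_right _ _)),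
    (hC' t).trans ((le_max_right _ _).trans (le_max_right _ _))⟩⟩

noncomputable def tB : ℝ := tT_bd.choose
lemma tB_one : 1 ≤ tB := tT_bd.choose_spec.1
lemma tB_le (t : ℝ) : |tT t| ≤ tB := (tT_bd.choose_spec.2 t).1
lemma tB_le' (t : ℝ) : |deriv tT t| ≤ tB := (tT_bd.choose_spec.2 t).2

noncomputable def sE (y ρ t : ℝ) : ℝ := smoothTransition ((t - y) / (2 * ρ) + 1 / 2)
noncomputable def sa (y ρ t : ℝ) : ℝ := tT ((t - y) / (2 * ρ) + 1 / 2) / (2 * ρ)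
noncomputable def sa' (y ρ t : ℝ) : ℝ := deriv tT ((t - y) / (2 * ρ) + 1 / 2) / (2 * ρ) / (2 * ρ)

lemma sE_deriv (y ρ t : ℝ) : HasDerivAt (sE y ρ) (sa y ρ t) t := by
  have : HasDerivAt (fun t => (t - y) / (2 * ρ) + 1 / 2) (1 / (2 * ρ)) t :=
    (((hasDerivAt_id t).sub_const y).div_const (2 * ρ)).add_const _
  have := (tG_deriv ((t - y) / (2 * ρ) + 1 / 2)).comp t this
  rwa [mul_one_div] at this

lemma sa_deriv (y ρ t : ℝ) : HasDerivAt (sa y ρ) (sa' y ρ t) t := by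
  have : HasDerivAt (fun t => (t - y) / (2 * ρ) + 1 / 2) (1 / (2 * ρ)) t :=
    (((hasDerivAt_id t).sub_const y).div_const (2 * ρ)).add_const _
  have := ((tT_deriv ((t - y) / (2 * ρ) + 1 / 2)).comp t this).div_const (2 * ρ)
  rwa [mul_one_div] at this

lemma sa_cont (y ρ : ℝ) : Continuous (sa y ρ) :=
  continuous_iff_continuousAt.2 fun t => (sa_deriv y ρ t).continuousAt

lemma sa_zero {y ρ t : ℝ} (hρ : 0 < ρ) (h : t ≤ y - ρ ∨ y + ρ ≤ t) : sa y ρ t = 0 := by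
  unfold sa
  rw [tT_zero, zero_div]
  rcases h with h | h
  · left
    have : (t - y) / (2 * ρ) ≤ -(1 / 2) := by rw [div_le_iff₀ PP]; linarith
    linarith
  · right
    have : 1 / 2 ≤ (t - y) / (2 * ρ) := by rw [le_div_iff₀ PP]; linarith
    linarith

lemma sE_zero {y ρ t : ℝ} (hρ : 0 < ρ) (h : t ≤ y - ρ) : sE y ρ t = 0 := by
  refine smoothTransition.zero_of_nonpos ?_
  have : (t - y) / (2 * ρ) ≤ -(1 / 2) := by rw [div_le_iff₀ PP]; linarith
  linarith

lemma sE_one {y ρ t : ℝ} (hρ : 0 < ρ) (h : y + ρ ≤ t) : sE y ρ t = 1 := by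
  refine smoothTransition.one_of_one_le ?_
  have : 1 / 2 ≤ (t - y) / (2 * ρ) := by rw [le_div_iff₀ PP]; linarith
  linarith

lemma sE_mem (y ρ t : ℝ) : 0 ≤ sE y ρ t ∧ sE y ρ t ≤ 1 :=
  ⟨smoothTransition.nonneg _, smoothTransition.le_one _⟩

lemma sa_bd {y ρ : ℝ} (hρ : 0 < ρ) (t : ℝ) : |sa y ρ t| ≤ tB / (2 * ρ) := by
  unfold sa
  rw [abs_div, abs_of_pos (by positivity : 0 < 2 * ρ)]
  gcongr; exact tB_le _

lemma lip_of_bd {P P' : ℝ → ℝ} {C : ℝ} (h : ∀ t, HasDerivAt P (P' t) t) (hC : ∀ t, |P' t| ≤ C) :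
    LipschitzWith C.toNNReal P := by
  refine lipschitzWith_of_nnnorm_deriv_le (fun t => (h t).differentiableAt) fun t => ?_
  rw [(h t).deriv, ← NNReal.coe_le_coe, coe_nnnorm, Real.coe_toNNReal _ ((abs_nonneg _).trans (hC 0))]
  exact hC t

lemma sa_lip {y ρ : ℝ} (hρ : 0 < ρ) : LipschitzWith (tB / (2 * ρ) / (2 * ρ)).toNNReal (sa y ρ) := by
  refine lip_of_bd (sa_deriv y ρ) fun t => ?_
  unfold sa'
  rw [abs_div, abs_div, abs_of_pos (by positivity : 0 < 2 * ρ)]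
  gcongr; exact tB_le' _

lemma sa_integral {y ρ : ℝ} (hρ : 0 < ρ) : ∫ t, sa y ρ t = 1 := by
  have h1 : ∫ t, sa y ρ t = ∫ t in (y - ρ)..(y + ρ), sa y ρ t := by
    rw [intervalIntegral.integral_of_le LL, ← setIntegral_eq_integral_of_forall_compl_eq_zero]
    intro t ht
    refine sa_zero hρ ?_
    grind
  rw [h1, intervalIntegral.integral_eq_sub_of_hasDerivAt (fun t _ => sE_deriv y ρ t)
    ((sa_cont y ρ).intervalIntegrable _ _), sE_one hρ le_rfl, sE_zero hρ le_rfl, sub_zero]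

noncomputable def Slice.W {f g : RR → ℝ} (S : Slice f g) (h : RR → ℝ) (y1 ρ1 y2 ρ2 : ℝ) : ℝ :=
  ∫ y, S.U h y * (sa y1 ρ1 y.1 * sa y2 ρ2 y.2)

lemma Slice.W_eq {f g h : RR → ℝ} (hf : LD f) (hg : LD g) (hh : LD h) (S : Slice f g) {y1 ρ1 y2 ρ2 : ℝ}
    (h1 : 0 < ρ1) (h2 : 0 < ρ2) :
    S.W h y1 ρ1 y2 ρ2 = ∫ x in D2, h x * (sa y1 ρ1 (f x) * sa y2 ρ2 (g x)) * jd f g x :=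
  S.U_int hf hg hh (η := fun y => sa y1 ρ1 y.1 * sa y2 ρ2 y.2) (B := tB / (2 * ρ1) * (tB / (2 * ρ2)))
    (((sa_cont _ _).comp continuous_fst).mul ((sa_cont _ _).comp continuous_snd))
    fun _ => bmul (sa_bd h1 _) (sa_bd h2 _)

structure Sq {X : Type u} [PseudoMetricSpace X] (φ : RR → X) (f g : RR → ℝ) (D : ℝ) (K : ℝ≥0) : Prop where
  hφ : LipschitzOnWith K φ D2
  hf : Fits φ f
  hg : Fits φ g
  hD : 0 < D
  hb : ∀ t, f (circ t) = 0 ∨ f (circ t) = D ∨ g (circ t) = 0 ∨ g (circ t) = D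

def bx (f g : RR → ℝ) (c : RR) (r : ℝ) : Set RR := D2 ∩ {x | |f x - c.1| ≤ r ∧ |g x - c.2| ≤ r}

lemma bx_meas {f g : RR → ℝ} (hf : LD f) (hg : LD g) (c : RR) (r : ℝ) : MeasurableSet (bx f g c r) := by
  have h1 : ContinuousOn (fun x => (f x, g x)) D2 := hf.cont.prodMk hg.cont
  have := (h1.preimage_isClosed_of_isClosed D2_closed (isClosed_closedBall (x := c) (ε := r))).measurableSet
  convert this using 1
  ext x
  simp [bx, Prod.dist_eq, dist_eq]

noncomputable def nu {X : Type u} [PseudoMetricSpace X] (φ : RR → X) (f g : RR → ℝ) (c : RR) (r : ℝ) : ℝ :=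
  ∫ x in bx f g c r, jac2 (mder φ x)

section
variable {X : Type u} [PseudoMetricSpace X] {φ : RR → X} {f g h : RR → ℝ} {D : ℝ} {K : ℝ≥0}

lemma Sq.lf (s : Sq φ f g D K) : LD f := s.hf.LD s.hφ
lemma Sq.lg (s : Sq φ f g D K) : LD g := s.hg.LD s.hφ

lemma Sq.swap (s : Sq φ f g D K) : Sq φ g f D K :=
  ⟨s.hφ, s.hg, s.hf, s.hD, fun t => by have := s.hb t; tauto⟩

lemma four_pi : 4 / π ≤ 2 := by
  rw [div_le_iff₀ pi_pos]; linarith [Real.pi_gt_three]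

lemma Sq.est (s : Sq φ f g D K) (hh : Fits φ h) {y1 ρ1 y1' ρ1' y2 ρ2 r : ℝ} {c : RR} (h1 : 0 < ρ1) (h1' : 0 < ρ1')
    (h2 : 0 < ρ2) (a1 : c.1 - r ≤ y1 - ρ1) (a2 : y1 + ρ1 ≤ c.1 + r) (a1' : c.1 - r ≤ y1' - ρ1') (a2' : y1' + ρ1' ≤ c.1 + r)
    (b1 : c.2 - r ≤ y2 - ρ2) (b2 : y2 + ρ2 ≤ c.2 + r) (c1 : 0 ≤ c.1 - r) (c2 : c.1 + r ≤ D) (d1 : 0 ≤ c.2 - r)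
    (d2 : c.2 + r ≤ D) :
    |∫ x in D2, h x * ((sa y1 ρ1 (f x) - sa y1' ρ1' (f x)) * sa y2 ρ2 (g x)) * jd f g x| ≤ tB / ρ2 * nu φ f g c r := by
  have lh := hh.LD s.hφ
  set P : ℝ → ℝ := fun t => sE y1 ρ1 t - sE y1' ρ1' t with hPd
  have hP : ∀ t, HasDerivAt P (sa y1 ρ1 t - sa y1' ρ1' t) t := fun t => (sE_deriv _ _ t).sub (sE_deriv _ _ t)
  have lP : LipschitzWith (tB / (2 * ρ1) + tB / (2 * ρ1')).toNNReal P :=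
    lip_of_bd hP fun t => (abs_sub _ _).trans (add_le_add (sa_bd h1 t) (sa_bd h1' t))
  have P0 : ∀ t, t ≤ c.1 - r → P t = 0 := fun t ht => by
    simp only [hPd, sE_zero h1 (ht.trans a1), sE_zero h1' (ht.trans a1'), sub_zero]
  have P1 : ∀ t, c.1 + r ≤ t → P t = 0 := fun t ht => by
    simp only [hPd, sE_one h1 (a2.trans ht), sE_one h1' (a2'.trans ht), sub_self]
  have b0 : ∀ t, t ≤ c.2 - r → sa y2 ρ2 t = 0 := fun t ht => sa_zero h2 (Or.inl (ht.trans b1))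
  have b1' : ∀ t, c.2 + r ≤ t → sa y2 ρ2 t = 0 := fun t ht => sa_zero h2 (Or.inr (b2.trans ht))
  have key := ibp s.lf s.lg lh hP (sa_deriv y2 ρ2) lP (sa_lip h2) (fun t => by
    rcases s.hb t with e | e | e | e <;> rw [e]
    · rw [P0 _ c1, zero_mul]
    · rw [P1 _ c2, zero_mul]
    · rw [b0 _ d1, mul_zero]
    · simp_all)
  have hbn : ∀ x, |P (f x) * sa y2 ρ2 (g x)| ≤ 1 * (tB / (2 * ρ2)) := fun x => bmul (by
      rw [abs_le]; constructor <;> linarith [sE_mem y1 ρ1 (f x), sE_mem y1' ρ1' (f x), (sE_mem y1 ρ1 (f x)).1, (sE_mem y1 ρ1 (f x)).2, (sE_mem y1' ρ1' (f x)).1, (sE_mem y1' ρ1' (f x)).2]) (sa_bd h2 _)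
  have i2 : IntegrableOn (fun x => P (f x) * sa y2 ρ2 (g x) * jd h g x) D2 := by
    refine (lh.jd_int s.lg).bdd_mul (c := 1 * (tB / (2 * ρ2))) ?_ (.of_forall hbn)
    exact ((s.lf.comp lP).mul (s.lg.comp (sa_lip h2))).cont.aestronglyMeasurable D2_closed.measurableSet
  have i1 : IntegrableOn (fun x => h x * ((sa y1 ρ1 (f x) - sa y1' ρ1' (f x)) * sa y2 ρ2 (g x)) * jd f g x) D2 := by
    have hc : ContinuousOn (fun x => h x * ((sa y1 ρ1 (f x) - sa y1' ρ1' (f x)) * sa y2 ρ2 (g x))) D2 :=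
      lh.cont.mul ((((sa_cont _ _).comp_continuousOn s.lf.cont).sub ((sa_cont _ _).comp_continuousOn s.lf.cont)).mul
        ((sa_cont _ _).comp_continuousOn s.lg.cont))
    obtain ⟨B, hB⟩ := D2_cpt.exists_bound_of_continuousOn hc
    refine (s.lf.jd_int s.lg).bdd_mul (c := B) (hc.aestronglyMeasurable D2_closed.measurableSet) ?_
    filter_upwards [ae_restrict_mem D2_closed.measurableSet] with x hx using hB x hx
  rw [integral_add i1 i2] at key
  rw [eq_neg_of_add_eq_zero_left key, abs_neg]
  have e : tB / ρ2 * nu φ f g c r = ∫ x in D2, (bx f g c r).indicator (fun x => tB / ρ2 * jac2 (mder φ x)) x := by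
    rw [setIntegral_indicator (bx_meas s.lf s.lg c r), nu, ← integral_const_mul]
    congr 2
    exact (Set.inter_eq_right.2 (Set.inter_subset_left : bx f g c r ⊆ D2)).symm
  rw [e, ← norm_eq_abs]
  refine norm_integral_le_of_norm_le (((jac_int s.hφ).const_mul _).indicator (bx_meas s.lf s.lg c r)) ?_
  filter_upwards [jd_le_jac s.hφ hh s.hg, ae_restrict_mem D2_closed.measurableSet] with x hx hxD
  by_cases hbx : x ∈ bx f g c r
  · rw [indicator_of_mem hbx, norm_mul]
    have j0 : 0 ≤ jac2 (mder φ x) := jac2_nonneg _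
    calc _ ≤ (1 * (tB / (2 * ρ2))) * (2 * jac2 (mder φ x)) := by
          have := tB_one
          refine mul_le_mul (hbn x) (hx.trans (mul_le_mul_of_nonneg_right four_pi j0)) (norm_nonneg _) PP
      _ = _ := by field_simp
  · rw [indicator_of_notMem hbx]
    have : P (f x) * sa y2 ρ2 (g x) = 0 := by
      by_contra hc
      apply hbx
      refine ⟨hxD, ?_, ?_⟩ <;> rw [abs_le] <;> by_contra h3
      · grind
      · grind
    rw [this, zero_mul, norm_zero]

lemma nu_swap (c : RR) (r : ℝ) : nu φ g f (c.2, c.1) r = nu φ f g c r := by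
  unfold nu
  congr 2
  ext x; simp only [bx, Set.mem_inter_iff, mem_ofPred_eq]; tauto

lemma Sq.tint (s : Sq φ f g D K) (hh : LD h) (y1 ρ1 y2 ρ2 : ℝ) :
    IntegrableOn (fun x => h x * (sa y1 ρ1 (f x) * sa y2 ρ2 (g x)) * jd f g x) D2 := by
  have hc : ContinuousOn (fun x => h x * (sa y1 ρ1 (f x) * sa y2 ρ2 (g x))) D2 :=
    hh.cont.mul (((sa_cont _ _).comp_continuousOn s.lf.cont).mul ((sa_cont _ _).comp_continuousOn s.lg.cont))
  obtain ⟨B, hB⟩ := D2_cpt.exists_bound_of_continuousOn hc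
  refine (s.lf.jd_int s.lg).bdd_mul (c := B) (hc.aestronglyMeasurable D2_closed.measurableSet) ?_
  filter_upwards [ae_restrict_mem D2_closed.measurableSet] with x hx using hB x hx

lemma Sq.W1 (s : Sq φ f g D K) (S : Slice f g) (hh : Fits φ h) {y1 ρ1 y1' ρ1' y2 ρ2 r : ℝ} {c : RR} (h1 : 0 < ρ1) (h1' : 0 < ρ1')
    (h2 : 0 < ρ2) (a1 : c.1 - r ≤ y1 - ρ1) (a2 : y1 + ρ1 ≤ c.1 + r) (a1' : c.1 - r ≤ y1' - ρ1') (a2' : y1' + ρ1' ≤ c.1 + r)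
    (b1 : c.2 - r ≤ y2 - ρ2) (b2 : y2 + ρ2 ≤ c.2 + r) (c1 : 0 ≤ c.1 - r) (c2 : c.1 + r ≤ D) (d1 : 0 ≤ c.2 - r)
    (d2 : c.2 + r ≤ D) :
    |S.W h y1 ρ1 y2 ρ2 - S.W h y1' ρ1' y2 ρ2| ≤ tB / ρ2 * nu φ f g c r := by
  have lh := hh.LD s.hφ
  rw [S.W_eq s.lf s.lg lh h1 h2, S.W_eq s.lf s.lg lh h1' h2, ← integral_sub (s.tint lh _ _ _ _) (s.tint lh _ _ _ _)]
  convert s.est hh h1 h1' h2 a1 a2 a1' a2' b1 b2 c1 c2 d1 d2 using 4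
  ring

lemma Sq.W2 (s : Sq φ f g D K) (S : Slice f g) (hh : Fits φ h) {y1 ρ1 y2' ρ2' y2 ρ2 r : ℝ} {c : RR} (h1 : 0 < ρ1) (h1' : 0 < ρ2')
    (h2 : 0 < ρ2) (a1 : c.1 - r ≤ y1 - ρ1) (a2 : y1 + ρ1 ≤ c.1 + r) (a1' : c.2 - r ≤ y2' - ρ2') (a2' : y2' + ρ2' ≤ c.2 + r)
    (b1 : c.2 - r ≤ y2 - ρ2) (b2 : y2 + ρ2 ≤ c.2 + r) (c1 : 0 ≤ c.1 - r) (c2 : c.1 + r ≤ D) (d1 : 0 ≤ c.2 - r)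
    (d2 : c.2 + r ≤ D) :
    |S.W h y1 ρ1 y2 ρ2 - S.W h y1 ρ1 y2' ρ2'| ≤ tB / ρ1 * nu φ f g c r := by
  have lh := hh.LD s.hφ
  rw [S.W_eq s.lf s.lg lh h1 h2, S.W_eq s.lf s.lg lh h1 h1', ← integral_sub (s.tint lh _ _ _ _) (s.tint lh _ _ _ _),
    ← nu_swap]
  have := s.swap.est hh (c := (c.2, c.1)) h2 h1' h1 b1 b2 a1' a2' a1 a2 d1 d2 c1 c2
  refine le_trans (le_of_eq ?_) this
  rw [← abs_neg, ← integral_neg]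
  congr 2; ext x
  have : jd g f x = - jd f g x := by simp only [jd, wd]; ring
  rw [this]; ring

def GoodNu (φ : RR → X) (f g : RR → ℝ) (l : ℝ) (y : RR) : Prop := ∀ ρ > 0, nu φ f g y ρ ≤ l * ρ ^ 2

lemma Sq.W_scale (s : Sq φ f g D K) (S : Slice f g) (hh : Fits φ h) {l ρ : ℝ} {y : RR} (hy : GoodNu φ f g l y)
    (hρ : 0 < ρ) (c1 : 0 ≤ y.1 - ρ) (c2 : y.1 + ρ ≤ D) (d1 : 0 ≤ y.2 - ρ) (d2 : y.2 + ρ ≤ D) (k : ℕ) :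
    |S.W h y.1 ρ y.2 ρ - S.W h y.1 (ρ / 2 ^ k) y.2 (ρ / 2 ^ k)| ≤ 6 * tB * l * ρ * (1 - 1 / 2 ^ k) := by
  induction k with
  | zero => simp
  | succ k ih =>
    set q := ρ / 2 ^ k with hq
    have q0 : 0 < q := by positivity
    have qρ : q ≤ ρ := div_le_self hρ.le (one_le_pow₀ NN)
    have e : ρ / 2 ^ (k + 1) = q / 2 := by rw [hq, pow_succ]; field_simp
    rw [e]
    have B := tB_one
    have w1 := s.W1 S hh (c := y) (r := q) (y1 := y.1) (y1' := y.1) (y2 := y.2) (ρ2 := q) q0 (half_pos q0) q0 le_rfl le_rfl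
      LL LL le_rfl le_rfl LL LL LL LL
    have w2 := s.W2 S hh (c := y) (r := q) (y1 := y.1) (ρ1 := q / 2) (y2' := y.2) (ρ2' := q / 2) (y2 := y.2) (ρ2 := q) (half_pos q0) (half_pos q0) q0
      LL LL LL LL le_rfl le_rfl LL LL LL LL
    have n := hy q q0
    have n1 : tB / q * nu φ f g y q ≤ tB * l * q := by
      calc _ ≤ tB / q * (l * q ^ 2) := by gcongr
        _ = _ := by field_simp
    have n2 : tB / (q / 2) * nu φ f g y q ≤ 2 * (tB * l * q) := by
      calc _ ≤ tB / (q / 2) * (l * q ^ 2) := by gcongr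
        _ = _ := by field_simp
    have t1 := abs_sub_le (S.W h y.1 ρ y.2 ρ) (S.W h y.1 q y.2 q) (S.W h y.1 (q / 2) y.2 (q / 2))
    have t2 := abs_sub_le (S.W h y.1 q y.2 q) (S.W h y.1 (q / 2) y.2 q) (S.W h y.1 (q / 2) y.2 (q / 2))
    have e2 : 6 * tB * l * ρ * (1 - 1 / 2 ^ (k + 1)) = 6 * tB * l * ρ * (1 - 1 / 2 ^ k) + 3 * (tB * l * q) := by
      grind
    linarith

def GoodW {f g : RR → ℝ} (S : Slice f g) (h : RR → ℝ) (y : RR) : Prop :=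
  Tendsto (fun ρ => S.W h y.1 ρ y.2 ρ) (nhdsWithin 0 (Ioi 0)) (nhds (S.U h y))

lemma Sq.U_scale (s : Sq φ f g D K) (S : Slice f g) (hh : Fits φ h) {l ρ : ℝ} {y : RR} (hy : GoodNu φ f g l y)
    (hW : GoodW S h y) (hl : 0 ≤ l)
    (hρ : 0 < ρ) (c1 : 0 ≤ y.1 - ρ) (c2 : y.1 + ρ ≤ D) (d1 : 0 ≤ y.2 - ρ) (d2 : y.2 + ρ ≤ D) :
    |S.W h y.1 ρ y.2 ρ - S.U h y| ≤ 6 * tB * l * ρ := by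
  have t : Tendsto (fun k : ℕ => ρ / 2 ^ k) atTop (nhdsWithin 0 (Ioi 0)) := by
    refine tendsto_nhdsWithin_iff.2 ⟨?_, .of_forall fun k => by simp only [mem_Ioi]; positivity⟩
    have := (tendsto_pow_atTop_nhds_zero_of_lt_one (r := (1 / 2 : ℝ)) NN NN).const_mul ρ
    simpa [div_eq_mul_inv] using this
  refine le_of_tendsto ((tendsto_const_nhds.sub (hW.comp t)).abs) (.of_forall fun k => ?_)
  refine (s.W_scale S hh hy hρ c1 c2 d1 d2 k).trans ?_
  have := tB_one
  refine mul_le_of_le_one_right PP ?_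
  simp

lemma Sq.U_lip (s : Sq φ f g D K) (S : Slice f g) (hh : Fits φ h) {l : ℝ} {y y' : RR} (hl : 0 ≤ l)
    (hy : GoodNu φ f g l y) (hW : GoodW S h y) (hy' : GoodNu φ f g l y') (hW' : GoodW S h y')
    (m : dist y (D / 2, D / 2) ≤ D / 16) (m' : dist y' (D / 2, D / 2) ≤ D / 16) :
    |S.U h y - S.U h y'| ≤ 20 * tB * l * dist y y' := by
  have B := tB_one
  rcases eq_or_ne y y' with rfl | hne
  · simp
  set ρ := dist y y' with hρd
  have ρ0 : 0 < ρ := dist_pos.2 hne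
  have ρ1 : ρ ≤ D / 8 := by
    have := dist_triangle_right y y' (D / 2, D / 2)
    linarith
  have e1 : |y.1 - y'.1| ≤ ρ := by rw [hρd, Prod.dist_eq, ← dist_eq]; exact le_max_left _ _
  have e2 : |y.2 - y'.2| ≤ ρ := by rw [hρd, Prod.dist_eq, ← dist_eq]; exact le_max_right _ _
  rw [Prod.dist_eq, dist_eq, dist_eq, max_le_iff, abs_le, abs_le] at m m'
  obtain ⟨⟨p1, p2⟩, p3, p4⟩ := m
  obtain ⟨⟨q1, q2⟩, q3, q4⟩ := m'
  simp only at p1 p2 p3 p4 q1 q2 q3 q4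
  rw [abs_le] at e1 e2
  have u := s.U_scale S hh hy hW hl ρ0 LL LL LL LL
  have u' := s.U_scale S hh hy' hW' hl ρ0 LL LL LL LL
  have w1 := s.W1 S hh (c := y) (r := 2 * ρ) (y1 := y.1) (y1' := y'.1) (y2 := y.2) ρ0 ρ0 ρ0 LL LL
      LL LL LL LL LL LL LL LL
  have w2 := s.W2 S hh (c := y) (r := 2 * ρ) (y1 := y'.1) (y2' := y'.2) (y2 := y.2) ρ0 ρ0 ρ0 LL LL
      LL LL LL LL LL LL LL LL
  have n := hy (2 * ρ) PP
  have n1 : tB / ρ * nu φ f g y (2 * ρ) ≤ 4 * (tB * l * ρ) := by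
    calc _ ≤ tB / ρ * (l * (2 * ρ) ^ 2) := by gcongr
      _ = _ := by field_simp; ring
  grind

end

lemma circ_lip : ∃ C, LipschitzWith C circ := by
  refine ⟨_, LipschitzWith.prodMk (lip_of_bd (C := 2 * π) (P' := fun t => - sin (2 * π * t) * (2 * π)) ?_ ?_)
    (lip_of_bd (C := 2 * π) (P' := fun t => cos (2 * π * t) * (2 * π)) ?_ ?_)⟩
  · intro t
    simpa using ((hasDerivAt_id t).const_mul (2 * π)).cos
  · intro t
    rw [abs_mul, abs_neg, abs_of_pos two_pi_pos]
    exact mul_le_of_le_one_left two_pi_pos.le (Real.abs_sin_le_one _)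
  · intro t
    simpa using ((hasDerivAt_id t).const_mul (2 * π)).sin
  · intro t
    rw [abs_mul, abs_of_pos two_pi_pos]
    exact mul_le_of_le_one_left two_pi_pos.le (Real.abs_cos_le_one _)

lemma LD.circ {f : RR → ℝ} (hf : LD f) : ∃ C, LipschitzWith C fun t => f (circ t) := by
  obtain ⟨C, hC⟩ := hf
  obtain ⟨C', hC'⟩ := circ_lip
  exact ⟨C * C', lipschitzOnWith_univ.1 (hC.comp (hC'.lipschitzOnWith (s := Set.univ)) fun t _ => circ_mem t)⟩

lemma circ_fract (t : ℝ) : circ (Int.fract t) = circ t := by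
  have e : 2 * π * Int.fract t = 2 * π * t - (⌊t⌋ : ℤ) * (2 * π) := by
    rw [← Int.self_sub_floor]; ring
  simp only [circ, e, Real.cos_sub_int_mul_two_pi, Real.sin_sub_int_mul_two_pi]

def SqB (f g : RR → ℝ) (D : ℝ) : Prop := ∃ t1 t2 t3 : ℝ, 0 ≤ t1 ∧ t1 ≤ t2 ∧ t2 ≤ t3 ∧ t3 ≤ 1 ∧
  (∀ t ∈ Icc 0 t1, g (circ t) = 0) ∧ (∀ t ∈ Icc t1 t2, f (circ t) = D) ∧
  (∀ t ∈ Icc t2 t3, g (circ t) = D) ∧ (∀ t ∈ Icc t3 1, f (circ t) = 0)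

lemma SqB.hb {f g : RR → ℝ} {D : ℝ} (h : SqB f g D) (t : ℝ) :
    f (circ t) = 0 ∨ f (circ t) = D ∨ g (circ t) = 0 ∨ g (circ t) = D := by
  obtain ⟨t1, t2, t3, h0, h1, h2, h3, a, b, c, d⟩ := h
  rw [← circ_fract]
  have l0 := Int.fract_nonneg t
  have l1 := (Int.fract_lt_one t).le
  grind

section
variable {X : Type u} [PseudoMetricSpace X] {φ : RR → X} {f g h : RR → ℝ} {D : ℝ} {K : ℝ≥0}

lemma Sq.W_one (s : Sq φ f g D K) (S : Slice f g) (hB : SqB f g D) {y1 y2 ρ : ℝ} (hρ : 0 < ρ)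
    (c1 : 0 ≤ y1 - ρ) (c2 : y1 + ρ ≤ D) (d1 : 0 ≤ y2 - ρ) (d2 : y2 + ρ ≤ D) : S.W (fun _ => 1) y1 ρ y2 ρ = 1 := by
  have l1 : LD (fun _ : RR => (1:ℝ)) := LD.of (C := 0) SP
  rw [S.W_eq s.lf s.lg l1 hρ hρ]
  have lE : LipschitzWith (tB / (2 * ρ)).toNNReal (sE y1 ρ) := lip_of_bd (sE_deriv _ _) (sa_bd hρ)
  have lE2 : LipschitzWith (tB / (2 * ρ)).toNNReal (sE y2 ρ) := lip_of_bd (sE_deriv _ _) (sa_bd hρ)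
  have hw : LD (fun x => sE y1 ρ (f x) * sa y2 ρ (g x)) := (s.lf.comp lE).mul (s.lg.comp (sa_lip hρ))
  have key := stokes_on hw s.lg
  have e1 : ∫ x in D2, 1 * (sa y1 ρ (f x) * sa y2 ρ (g x)) * jd f g x =
      ∫ x in D2, jd (fun x => sE y1 ρ (f x) * sa y2 ρ (g x)) g x := by
    apply integral_congr_ae
    filter_upwards [s.lf.ae_diff, s.lg.ae_diff] with x df dg
    have k1 : HasFDerivAt (fun x => sE y1 ρ (f x)) (sa y1 ρ (f x) • fderiv ℝ f x) x :=
      (sE_deriv _ _ _).comp_hasFDerivAt x df.hasFDerivAt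
    have k2 : HasFDerivAt (fun x => sa y2 ρ (g x)) (sa' y2 ρ (g x) • fderiv ℝ g x) x :=
      (sa_deriv _ _ _).comp_hasFDerivAt x dg.hasFDerivAt
    have k3 : fderiv ℝ (fun x => sE y1 ρ (f x) * sa y2 ρ (g x)) x = _ := (k1.mul k2).fderiv
    simp only [jd, wd, grad]
    rw [k3]
    simp
    ring
  rw [e1, key]
  obtain ⟨t1, t2, t3, h0, h1, h2, h3, a, b, c, d⟩ := hB
  obtain ⟨Cg, hCg⟩ := s.lg.circ
  have hG : LipschitzWith _ (fun t => sE y2 ρ (g (circ t))) := lE2.comp hCg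
  have e2 : ∫ t in (0:ℝ)..1, sE y1 ρ (f (circ t)) * sa y2 ρ (g (circ t)) * deriv (fun t => g (circ t)) t =
      ∫ t in Ioc (0:ℝ) 1, (Ioc t1 t2).indicator (deriv (fun t => sE y2 ρ (g (circ t)))) t := by
    rw [intervalIntegral.integral_of_le zero_le_one]
    refine setIntegral_congr_ae measurableSet_Ioc ?_
    filter_upwards [hCg.ae_differentiableAt_real] with t dt ht
    by_cases q : t ∈ Ioc t1 t2
    · rw [indicator_of_mem q, b t ⟨q.1.le, q.2⟩, sE_one hρ c2, one_mul]
      exact ((sE_deriv y2 ρ (g (circ t))).comp t dt.hasDerivAt).deriv.symm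
    · rw [indicator_of_notMem q]
      rcases le_or_gt t t1 with q1 | q1
      · rw [a t ⟨ht.1.le, q1⟩, sa_zero hρ (Or.inl d1)]; ring
      have q2 : t2 < t := by by_contra! hc; exact q ⟨q1, hc⟩
      rcases le_total t t3 with q3 | q3
      · rw [c t ⟨q2.le, q3⟩, sa_zero hρ (Or.inr d2)]; ring
      · rw [d t ⟨q3, ht.2⟩, sE_zero hρ c1]; ring
  rw [e2, setIntegral_indicator measurableSet_Ioc, Set.inter_eq_right.2 (Set.Ioc_subset_Ioc h0 (h2.trans h3)),
    ← intervalIntegral.integral_of_le h1, (hG.lipschitzOnWith.absolutelyContinuousOnInterval).integral_deriv_eq_sub,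
    a t1 ⟨h0, le_rfl⟩, c t2 ⟨le_rfl, h2⟩, sE_zero hρ d1, sE_one hρ d2, sub_zero]

lemma cb_vol (y : RR) {ρ : ℝ} (hρ : 0 ≤ ρ) : volume (closedBall y ρ) = ofReal (4 * ρ ^ 2) := by
  rw [← Prod.eta y, ← closedBall_prod_same, Measure.volume_eq_prod, Measure.prod_prod, Real.volume_closedBall,
    Real.volume_closedBall, ← ofReal_mul PP]
  congr 1; ring

lemma goodW_ae (hf : LD f) (hg : LD g) (hh : LD h) (S : Slice f g) : ∀ᵐ y, GoodW S h y := by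
  have ui := S.U_loc hf hg hh
  filter_upwards [IsUnifLocDoublingMeasure.ae_tendsto_average_norm_sub volume ui.locallyIntegrable 1] with y hy
  have t := hy (fun _ : ℝ => y) (fun ρ => ρ) (tendsto_id (x := nhdsWithin (0:ℝ) (Ioi 0)))
    (by filter_upwards [self_mem_nhdsWithin] with ρ hρ
        simp only [mem_Ioi] at hρ
        simp [hρ.le])
  refine tendsto_iff_norm_sub_tendsto_zero.2 ?_
  refine squeeze_zero' (.of_forall fun _ => norm_nonneg _) ?_ (by simpa using t.const_mul (tB ^ 2))
  filter_upwards [self_mem_nhdsWithin] with ρ hρ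
  simp only [mem_Ioi] at hρ
  have kc : Continuous (fun z : RR => sa y.1 ρ z.1 * sa y.2 ρ z.2) :=
    ((sa_cont _ _).comp continuous_fst).mul ((sa_cont _ _).comp continuous_snd)
  have kb : ∀ z : RR, |sa y.1 ρ z.1 * sa y.2 ρ z.2| ≤ tB / (2 * ρ) * (tB / (2 * ρ)) :=
    fun z => bmul (sa_bd hρ _) (sa_bd hρ _)
  have k1 : ∫ z : RR, sa y.1 ρ z.1 * sa y.2 ρ z.2 = 1 := by
    rw [Measure.volume_eq_prod, integral_prod_mul (sa y.1 ρ) (sa y.2 ρ), sa_integral hρ, sa_integral hρ, one_mul]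
  have ki : Integrable (fun z : RR => sa y.1 ρ z.1 * sa y.2 ρ z.2) := by
    by_contra hc
    rw [integral_undef hc] at k1; norm_num at k1
  have e : S.W h y.1 ρ y.2 ρ - S.U h y = ∫ z, (S.U h z - S.U h y) * (sa y.1 ρ z.1 * sa y.2 ρ z.2) := by
    simp only [sub_mul]
    rw [integral_sub (ui.mul_bdd (c := _) kc.aestronglyMeasurable (.of_forall kb)) (ki.const_mul _),
      integral_const_mul, k1, mul_one, Slice.W]
  rw [e, setAverage_eq, smul_eq_mul, Measure.real, cb_vol y hρ.le, toReal_ofReal PP, ← mul_assoc,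
    ← integral_const_mul, ← integral_indicator measurableSet_closedBall]
  have ic : IntegrableOn (fun _ : RR => S.U h y) (closedBall y ρ) :=
    integrableOn_const (by rw [cb_vol y hρ.le]; exact ofReal_ne_top)
  refine norm_integral_le_of_norm_le ((integrable_indicator_iff measurableSet_closedBall).2
    ((ui.integrableOn.sub ic).norm.const_mul _)) (.of_forall fun z => ?_)
  by_cases hz : z ∈ closedBall y ρ
  · rw [indicator_of_mem hz, norm_mul, mul_comm]
    refine mul_le_mul_of_nonneg_right ((kb z).trans (le_of_eq ?_)) (norm_nonneg _)
    field_simp; ring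
  · rw [indicator_of_notMem hz]
    have : sa y.1 ρ z.1 * sa y.2 ρ z.2 = 0 := by
      rw [mem_closedBall, Prod.dist_eq, dist_eq, dist_eq, max_le_iff, abs_le, abs_le] at hz
      by_contra hc
      apply hz
      constructor
      · by_contra h3
        refine hc ?_
        rw [sa_zero hρ (t := z.1), zero_mul]
        grind
      · by_contra h3
        refine hc ?_
        rw [sa_zero hρ (t := z.2), mul_zero]
        grind
    rw [this, mul_zero, norm_zero]

lemma bx_sub (f g : RR → ℝ) (c : RR) (r : ℝ) : bx f g c r ⊆ D2 := Set.inter_subset_left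

lemma nu_ofReal (hφ : LipschitzOnWith K φ D2) {s : Set RR} (hs : s ⊆ D2) :
    ofReal (∫ x in s, jac2 (mder φ x)) = ∫⁻ x in s, ofReal (jac2 (mder φ x)) :=
  ofReal_integral_eq_lintegral_ofReal ((jac_int hφ).mono_set hs) (.of_forall fun _ => jac2_nonneg _)

lemma Sq.bad_nu (s : Sq φ f g D K) {l : ℝ} (hl : 0 < l) :
    volume {y | ¬ GoodNu φ f g l y} ≤ ofReal (100 / l * ∫ x in D2, jac2 (mder φ x)) := by
  set A := ∫ x in D2, jac2 (mder φ x) with hA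
  have nuA : ∀ c r, nu φ f g c r ≤ A := fun c r =>
    setIntegral_mono_set (jac_int s.hφ) (.of_forall fun _ => jac2_nonneg _)
      (LE.le.eventuallyLE (bx_sub _ _ _ _))
  let t : Set (RR × ℝ) := {p | 0 < p.2 ∧ l * p.2 ^ 2 < nu φ f g p.1 p.2}
  obtain ⟨u, hut, hd, hcov⟩ := Vitali.exists_disjoint_subfamily_covering_enlargement_closedBall t (fun p => p.1) (fun p => p.2)
    (max 1 (A / l)) (fun p hp => by
      rcases le_total p.2 1 with q | q
      · exact q.trans (le_max_left _ _)
      · refine le_trans ?_ (le_max_right _ _)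
        rw [le_div_iff₀ hl]
        have := hp.2.trans_le (nuA _ _)
        nlinarith [mul_nonneg hl.le (mul_nonneg hp.1.le (sub_nonneg.2 q))]) 5 NN
  have uc : u.Countable := hd.countable_of_nonempty_interior fun p hp =>
    ⟨p.1, Metric.ball_subset_interior_closedBall (Metric.mem_ball_self (hut hp).1)⟩
  have sub : {y | ¬ GoodNu φ f g l y} ⊆ ⋃ p ∈ u, closedBall p.1 (5 * p.2) := by
    intro y hy
    simp only [GoodNu, mem_ofPred_eq] at hy
    push Not at hy
    obtain ⟨ρ, h0, h1⟩ := hy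
    obtain ⟨b, hb, hb2⟩ := hcov (y, ρ) ⟨h0, h1⟩
    exact mem_biUnion hb (hb2 (Metric.mem_closedBall_self h0.le))
  calc _ ≤ volume (⋃ p ∈ u, closedBall p.1 (5 * p.2)) := measure_mono sub
    _ ≤ ∑' p : u, volume (closedBall p.1.1 (5 * p.1.2)) := measure_biUnion_le _ uc _
    _ ≤ ∑' p : u, ofReal (100 / l) * ∫⁻ x in bx f g p.1.1 p.1.2, ofReal (jac2 (mder φ x)) := by
        refine ENNReal.tsum_le_tsum fun p => ?_
        have hp := hut p.2
        rw [cb_vol _ (by linarith [hp.1]), ← nu_ofReal s.hφ (bx_sub _ _ _ _), ← ofReal_mul PP]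
        refine ofReal_le_ofReal ?_
        have := hp.2.le
        calc _ = 100 / l * (l * p.1.2 ^ 2) := by field_simp; ring
          _ ≤ _ := by gcongr; exact this
    _ = ofReal (100 / l) * ∫⁻ x in ⋃ p ∈ u, bx f g p.1 p.2, ofReal (jac2 (mder φ x)) := by
        rw [ENNReal.tsum_mul_left, lintegral_biUnion uc (fun p _ => bx_meas s.lf s.lg _ _)]
        intro p hp q hq hpq
        refine Set.disjoint_left.2 fun x h1 h2 => ?_
        have dj : Disjoint (closedBall p.1 p.2) (closedBall q.1 q.2) := hd hp hq hpq
        refine (Set.disjoint_left.1 dj : ∀ ⦃a⦄, _) (a := (f x, g x)) ?_ ?_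
        · simpa [Prod.dist_eq, dist_eq] using h1.2
        · simpa [Prod.dist_eq, dist_eq] using h2.2
    _ ≤ ofReal (100 / l) * ∫⁻ x in D2, ofReal (jac2 (mder φ x)) := by
        gcongr
        exact Set.iUnion₂_subset fun p _ => bx_sub _ _ _ _
    _ = _ := by rw [← nu_ofReal s.hφ le_rfl, ← ofReal_mul PP]

lemma Sq.bad_N (s : Sq φ f g D K) (S : Slice f g) {N : ℕ} (hN : 0 < N) :
    volume {y | ¬ ({n | y ∈ S.J n}.encard ≤ N)} ≤ ofReal (2 / N * ∫ x in D2, jac2 (mder φ x)) := by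
  have e : ∀ y, ∑' n, (S.J n).indicator (fun _ => (1:ℝ≥0∞)) y = ({n | y ∈ S.J n}.encard : ℝ≥0∞) := fun y => by
    rw [← ENNReal.tsum_set_one, tsum_subtype {n | y ∈ S.J n} (fun _ => (1:ℝ≥0∞))]
    rfl
  have m : Measurable fun y => ∑' n, (S.J n).indicator (fun _ => (1:ℝ≥0∞)) y :=
    Measurable.tsum fun n => measurable_const.indicator (S.hJ n)
  have h1 : ∫⁻ y, ∑' n, (S.J n).indicator (fun _ => (1:ℝ≥0∞)) y ≤ ofReal (2 * ∫ x in D2, jac2 (mder φ x)) := by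
    rw [lintegral_tsum fun n => (measurable_const.indicator (S.hJ n)).aemeasurable]
    simp only [lintegral_indicator_const (S.hJ _), one_mul]
    refine S.hN.trans ?_
    rw [ofReal_mul NN, nu_ofReal s.hφ le_rfl, ← lintegral_const_mul' _ _ ofReal_ne_top]
    refine lintegral_mono_ae ?_
    filter_upwards [jd_le_jac s.hφ s.hf s.hg] with x hx
    rw [← ofReal_mul NN]
    exact ofReal_le_ofReal (hx.trans (mul_le_mul_of_nonneg_right four_pi (jac2_nonneg _)))
  have h2 := (mul_meas_ge_le_lintegral (μ := volume) m N).trans h1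
  have n0 : (N : ℝ≥0∞) ≠ 0 := by exact_mod_cast hN.ne'
  have h3 : volume {y | ¬ ({n | y ∈ S.J n}.encard ≤ N)} ≤ volume {y | (N : ℝ≥0∞) ≤ ∑' n, (S.J n).indicator (fun _ => (1:ℝ≥0∞)) y} := by
    refine measure_mono fun y hy => ?_
    simp only [mem_ofPred_eq, e, not_le] at hy ⊢
    exact_mod_cast hy.le
  refine h3.trans ?_
  rw [← ENNReal.mul_le_mul_iff_right n0 (ENNReal.natCast_ne_top N)]
  refine h2.trans (le_of_eq ?_)
  rw [← ENNReal.ofReal_natCast, ← ofReal_mul PP]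
  congr 1
  have : (N : ℝ) ≠ 0 := by positivity
  field_simp

end

lemma propB {X : Type u} [PseudoMetricSpace X] {φ : RR → X} {f g : RR → ℝ} {D C1 : ℝ} {K : ℝ≥0} {N : ℕ}
    (s : Sq φ f g D K) (hB : SqB f g D) (hC : 0 < C1) (hA : ∫ x in D2, jac2 (mder φ x) ≤ C1 * D ^ 2)
    (hN : 512 * C1 ≤ N) :
    ∃ (Q : Set RR) (I : RR → Finset ℕ) (σ : ℕ → RR → ℤ) (ζ : ℕ → RR → X),
      Q ⊆ closedBall (D / 2, D / 2) (D / 16) ∧ ofReal (D ^ 2 / 128) ≤ volume Q ∧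
      (∀ n y, |σ n y| = 1) ∧ (∀ y ∈ Q, (I y).card ≤ N ∧ ∑ n ∈ I y, σ n y = 1) ∧
      (∀ y ∈ Q, ∀ y' ∈ Q, ∀ n ∈ I y, ∀ m ∈ I y', dist y y' ≤ dist (ζ n y) (ζ m y')) ∧
      (∀ y ∈ Q, ∀ y' ∈ Q, ∀ y'' ∈ Q, ∀ m ∈ I y'', ∀ c : ℝ,
        |∑ n ∈ I y, (σ n y : ℝ) * max 0 (c - dist (ζ m y'') (ζ n y)) -
          ∑ n ∈ I y', (σ n y' : ℝ) * max 0 (c - dist (ζ m y'') (ζ n y'))| ≤ 512000 * tB * C1 * dist y y') := by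
  classical
  obtain ⟨S⟩ := slices s.lf s.lg
  have D0 := s.hD
  have ne : Nonempty D2 := ⟨⟨circ 0, circ_mem 0⟩⟩
  let d : ℕ → D2 := TopologicalSpace.denseSeq D2
  let H : X → ℝ → RR → ℝ := fun z c x => max 0 (c - dist z (φ x))
  have hH : ∀ z c, Fits φ (H z c) := fun z c x _ y _ => by
    simp only [H]
    refine (abs_max_sub_max_le_max _ _ _ _).trans ?_
    rw [sub_self, abs_zero]
    refine max_le dist_nonneg ?_
    rw [sub_sub_sub_cancel_left, abs_sub_comm, dist_comm z, dist_comm z]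
    exact abs_dist_sub_le _ _ _
  have h1 : Fits φ (fun _ => (1:ℝ)) := fun x _ y _ => by simp
  have ae1 : ∀ᵐ y, ∀ p : ℕ × ℚ, GoodW S (H (φ (d p.1)) p.2) y :=
    ae_all_iff.2 fun p => goodW_ae s.lf s.lg ((hH _ _).LD s.hφ) S
  have ae2 : ∀ᵐ y, GoodW S (fun _ => 1) y := goodW_ae s.lf s.lg (h1.LD s.hφ) S
  set l := 25600 * C1 with hl
  have l0 : 0 < l := by positivity
  have N0 : (0:ℝ) < N := lt_of_lt_of_le PP hN
  set B : Set RR := closedBall (D / 2, D / 2) (D / 16) with hBd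
  let P : RR → Prop := fun y => (∀ p : ℕ × ℚ, GoodW S (H (φ (d p.1)) p.2) y) ∧ GoodW S (fun _ => 1) y
  let Q : Set RR := {y | y ∈ B ∧ GoodNu φ f g l y ∧ ({n | y ∈ S.J n}.encard ≤ N) ∧ P y}
  have fin : ∀ y ∈ Q, {n | y ∈ S.J n}.Finite := fun y hy => Set.finite_of_encard_le_coe hy.2.2.1
  let I : RR → Finset ℕ := fun y => if h : {n | y ∈ S.J n}.Finite then h.toFinset else ∅
  have Imem : ∀ y ∈ Q, ∀ n, n ∈ I y ↔ y ∈ S.J n := fun y hy n => by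
    simp only [I, fin y hy, dif_pos, Set.Finite.mem_toFinset, mem_ofPred_eq]
  have Ueq : ∀ y ∈ Q, ∀ h, S.U h y = ∑ n ∈ I y, (S.σ n y : ℝ) * h (S.x n y) := fun y hy h => by
    unfold Slice.U
    rw [tsum_eq_sum (s := I y) fun n hn => indicator_of_notMem (fun hc => hn ((Imem y hy n).2 hc)) _]
    refine sum_congr rfl fun n hn => indicator_of_mem ((Imem y hy n).1 hn) _
  have hQ1 : ∀ y ∈ Q, S.U (fun _ => 1) y = 1 := fun y hy => by
    have t := hy.2.2.2.2
    refine tendsto_nhds_unique (t.congr' ?_) tendsto_const_nhds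
    have : Ioo (0:ℝ) (D / 16) ∈ nhdsWithin (0:ℝ) (Ioi 0) := Ioo_mem_nhdsGT PP
    filter_upwards [this] with ρ hρ
    have m : dist y (D / 2, D / 2) ≤ D / 16 := hy.1
    rw [Prod.dist_eq, dist_eq, dist_eq, max_le_iff, abs_le, abs_le] at m
    obtain ⟨⟨p1, p2⟩, p3, p4⟩ := m
    simp only at p1 p2 p3 p4
    obtain ⟨q1, q2⟩ := hρ
    exact s.W_one S hB q1 LL LL LL LL
  refine ⟨Q, I, S.σ, fun n y => φ (S.x n y), fun y hy => hy.1, ?_, S.hσ, ?_, ?_, ?_⟩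
  · have sub : B ⊆ Q ∪ ({y | ¬ GoodNu φ f g l y} ∪ ({y | ¬ ({n | y ∈ S.J n}.encard ≤ N)} ∪ {y | ¬ P y})) := by
      grind
    have z : volume {y | ¬ P y} = 0 := by
      have : ∀ᵐ y, P y := ae1.and ae2
      exact this
    have b1 : volume {y | ¬ GoodNu φ f g l y} ≤ ofReal (D ^ 2 / 256) := by
      refine (s.bad_nu l0).trans (ofReal_le_ofReal ?_)
      calc _ ≤ 100 / l * (C1 * D ^ 2) := by gcongr
        _ = _ := by rw [hl]; field_simp; norm_num
    have b2 : volume {y | ¬ ({n | y ∈ S.J n}.encard ≤ N)} ≤ ofReal (D ^ 2 / 256) := by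
      refine (s.bad_N S (by exact_mod_cast N0)).trans (ofReal_le_ofReal ?_)
      have i0 : 0 ≤ ∫ x in D2, jac2 (mder φ x) := integral_nonneg fun _ => jac2_nonneg _
      calc _ ≤ 2 / (512 * C1) * (C1 * D ^ 2) := by gcongr
        _ = _ := by field_simp; norm_num
    have v := (measure_mono sub).trans ((measure_union_le _ _).trans (add_le_add_right ((measure_union_le _ _).trans
      (add_le_add b1 ((measure_union_le _ _).trans (add_le_add b2 z.le)))) _))
    rw [cb_vol _ PP, add_zero, ← ofReal_add PP PP] at v
    have e : ofReal (4 * (D / 16) ^ 2) = ofReal (D ^ 2 / 128) + ofReal (D ^ 2 / 256 + D ^ 2 / 256) := by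
      rw [← ofReal_add PP PP]; congr 1; ring
    simp_all
  · intro y hy
    constructor
    · have := hy.2.2.1
      simp only [I, fin y hy, dif_pos]
      rw [(fin y hy).encard_eq_coe_toFinset_card] at this
      exact_mod_cast this
    · have := hQ1 y hy
      rw [Ueq y hy] at this
      simp only [mul_one] at this
      exact_mod_cast this
  · intro y hy y' hy' n hn m hm
    obtain ⟨a1, a2, a3⟩ := S.hx n y ((Imem y hy n).1 hn)
    obtain ⟨b1, b2, b3⟩ := S.hx m y' ((Imem y' hy' m).1 hm)
    have := s.hf _ a1 _ b1
    have := s.hg _ a1 _ b1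
    rw [Prod.dist_eq, dist_eq, dist_eq, max_le_iff, ← a2, ← a3, ← b2, ← b3]
    constructor <;> assumption
  · intro y hy y' hy' y'' hy'' m hm c
    obtain ⟨a1, -⟩ := S.hx m y'' ((Imem y'' hy'' m).1 hm)
    have dr : DenseRange (fun p : ℕ × ℚ => (d p.1, (p.2 : ℝ))) :=
      (TopologicalSpace.denseRange_denseSeq D2).prodMap Rat.denseRange_cast
    have cφ : Continuous fun p : D2 × ℝ => φ p.1 :=
      (continuousOn_iff_continuous_domRestrict.1 s.hφ.continuousOn).comp continuous_fst
    refine dr.induction_on (p := fun p : D2 × ℝ => |∑ n ∈ I y, (S.σ n y : ℝ) * max 0 (p.2 - dist (φ p.1) (φ (S.x n y))) -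
          ∑ n ∈ I y', (S.σ n y' : ℝ) * max 0 (p.2 - dist (φ p.1) (φ (S.x n y')))| ≤ 512000 * tB * C1 * dist y y')
      (⟨S.x m y'', a1⟩, c) ?_ ?_
    · exact isClosed_le ((continuous_finsetSum _ fun n _ => continuous_const.mul (continuous_const.max
        (continuous_snd.sub (cφ.dist continuous_const)))).sub (continuous_finsetSum _ fun n _ => continuous_const.mul
        (continuous_const.max (continuous_snd.sub (cφ.dist continuous_const))))).abs continuous_const
    · intro p
      have := s.U_lip S (hH (φ (d p.1)) p.2) l0.le hy.2.1 (hy.2.2.2.1 p) hy'.2.1 (hy'.2.2.2.1 p) hy.1 hy'.1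
      grind

section
variable {X : Type u} [PseudoMetricSpace X]

noncomputable def tS (I : Finset ℕ) (σ : ℕ → ℤ) (ζ : ℕ → X) (z : X) (c : ℝ) : ℝ :=
  ∑ n ∈ I, (σ n : ℝ) * max 0 (c - dist z (ζ n))

open scoped Classical in
noncomputable def cS (I : Finset ℕ) (σ : ℕ → ℤ) (ζ : ℕ → X) (r : ℝ) (z : X) : ℤ :=
  ∑ n ∈ I with dist z (ζ n) ≤ r, σ n

def Gap (I : Finset ℕ) (ζ : ℕ → X) (r1 r0 : ℝ) : Prop := ∀ n ∈ I, ∀ m ∈ I, dist (ζ n) (ζ m) ≤ r1 ∨ r0 < dist (ζ n) (ζ m)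

lemma max_lip (a b : ℝ) : |max 0 a - max 0 b| ≤ |a - b| := by
  grind

lemma clus_near {I : Finset ℕ} {σ : ℕ → ℤ} {ζ : ℕ → X} {r : ℝ} {N : ℕ} (hσ : ∀ n, |σ n| = 1) (hN : I.card ≤ N)
    (hr : 0 ≤ r) (z : X) (m : ℕ) (c : ℝ) (hc : ∀ n ∈ I, dist z (ζ n) < c → dist (ζ m) (ζ n) ≤ r) :
    |tS I σ ζ z c - cS I σ ζ r (ζ m) * max 0 (c - dist z (ζ m))| ≤ N * r := by
  classical
  have e1 : tS I σ ζ z c = ∑ n ∈ I with dist (ζ m) (ζ n) ≤ r, (σ n : ℝ) * max 0 (c - dist z (ζ n)) := by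
    unfold tS
    rw [Finset.sum_filter]
    refine sum_congr rfl fun n hn => ?_
    grind
  have e2 : (cS I σ ζ r (ζ m) : ℝ) = ∑ n ∈ I with dist (ζ m) (ζ n) ≤ r, (σ n : ℝ) := by
    unfold cS; push_cast
    linarith
  rw [e1, e2, sum_mul, ← sum_sub_distrib]
  refine (Finset.abs_sum_le_sum_abs _ _).trans ?_
  calc _ ≤ ∑ n ∈ I with dist (ζ m) (ζ n) ≤ r, r := by
        refine sum_le_sum fun n hn => ?_
        rw [mem_filter] at hn
        rw [← mul_sub, abs_mul, ← Int.cast_abs, hσ, Int.cast_one, one_mul]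
        refine (max_lip _ _).trans ?_
        rw [sub_sub_sub_cancel_left, dist_comm z, dist_comm z]
        exact (abs_dist_sub_le _ _ _).trans hn.2
    _ ≤ _ := by
        rw [sum_const, nsmul_eq_mul]
        gcongr
        grind

lemma selQ {I I' : Finset ℕ} {σ σ' : ℕ → ℤ} {ζ ζ' : ℕ → X} {r1 r0 d : ℝ} {N : ℕ} (hσ : ∀ n, |σ n| = 1)
    (hσ' : ∀ n, |σ' n| = 1) (hN : I.card ≤ N) (hN' : I'.card ≤ N) (hr : 0 ≤ r1) (hr0 : 4 * r1 ≤ r0)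
    (G : Gap I ζ r1 r0) (G' : Gap I' ζ' r1 r0) (hd : d + 2 * N * r1 < r0 / 8)
    {m : ℕ} (hm : m ∈ I) (hs : cS I σ ζ r1 (ζ m) ≠ 0)
    (hT : ∀ c, |tS I σ ζ (ζ m) c - tS I' σ' ζ' (ζ m) c| ≤ d) :
    ∃ m' ∈ I', cS I' σ' ζ' r1 (ζ' m') ≠ 0 ∧ dist (ζ m) (ζ' m') ≤ d + 2 * N * r1 := by
  have d0 : 0 ≤ d := (abs_nonneg _).trans (hT 0)
  have N0 : (0:ℝ) ≤ N * r1 := by positivity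
  have near : ∀ c, 0 ≤ c → c ≤ r0 → |tS I σ ζ (ζ m) c - cS I σ ζ r1 (ζ m) * c| ≤ N * r1 := fun c h0 hc => by
    have := clus_near hσ hN hr (ζ m) m c fun n hn h => by
      rcases G m hm n hn with q | q
      · exact q
      · linarith
    simp_all
  have n1 := near (r0 / 2) LL LL
  have n2 := near (r0 / 4) LL LL
  have t1 := hT (r0 / 2)
  have t2 := hT (r0 / 4)
  set s := cS I σ ζ r1 (ζ m) with hsd
  have s1 : (1:ℝ) ≤ |(s:ℝ)| := by exact_mod_cast Int.one_le_abs hs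
  have c0 : 0 < r0 := by linarith
  have ex : ∃ m' ∈ I', dist (ζ m) (ζ' m') < r0 / 2 := by
    by_contra! hc
    have : tS I' σ' ζ' (ζ m) (r0 / 2) = 0 := sum_eq_zero fun n hn => by
      simp_all
    rw [this, sub_zero] at t1
    have := abs_add_le (s * (r0 / 2) - tS I σ ζ (ζ m) (r0 / 2)) (tS I σ ζ (ζ m) (r0 / 2))
    rw [sub_add_cancel, abs_sub_comm, abs_mul, abs_of_pos (half_pos c0)] at this
    nlinarith
  obtain ⟨m', hm', hdm⟩ := ex
  have near' : ∀ c, c ≤ r0 / 2 → |tS I' σ' ζ' (ζ m) c - cS I' σ' ζ' r1 (ζ' m') * max 0 (c - dist (ζ m) (ζ' m'))| ≤ N * r1 :=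
    fun c hc => clus_near hσ' hN' hr (ζ m) m' c fun n hn h => by
      rcases G' m' hm' n hn with q | q
      · exact q
      · have := dist_triangle_left (ζ' m') (ζ' n) (ζ m)
        linarith
  have p1 := near' (r0 / 2) le_rfl
  have p2 := near' (r0 / 4) LL
  set s' := cS I' σ' ζ' r1 (ζ' m') with hsd'
  set e := dist (ζ m) (ζ' m') with he
  have e0 : 0 ≤ e := dist_nonneg
  rw [max_eq_right LL] at p1
  have k1 : |(s:ℝ) * (r0 / 2) - s' * (r0 / 2 - e)| ≤ d + 2 * N * r1 := by
    rw [abs_le] at *; constructor <;> linarith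
  have k2 : |(s:ℝ) * (r0 / 4) - s' * max 0 (r0 / 4 - e)| ≤ d + 2 * N * r1 := by
    clear k1
    rw [abs_le] at *; constructor <;> linarith
  have e4 : e < r0 / 4 := by
    by_contra! hc
    rw [max_eq_left LL, mul_zero, sub_zero, abs_mul, abs_of_pos (by positivity : 0 < r0 / 4)] at k2
    nlinarith
  rw [max_eq_right LL] at k2
  have ss : s = s' := by
    have : |(s:ℝ) - s'| * (r0 / 4) < 1 * (r0 / 4) := by
      rw [← abs_of_pos (by positivity : 0 < r0 / 4), ← abs_mul, abs_of_pos (by positivity : 0 < r0 / 4), abs_lt]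
      rw [abs_le] at k1 k2
      constructor <;> nlinarith
    have : |(s:ℝ) - s'| < 1 := lt_of_mul_lt_mul_right this PP
    have : |s - s'| < 1 := by exact_mod_cast this
    grind
  refine ⟨m', hm', by rw [← hsd', ← ss]; exact hs, ?_⟩
  rw [← ss] at k1
  have : (s:ℝ) * (r0 / 2) - s * (r0 / 2 - e) = s * e := by ring
  rw [this, abs_mul, abs_of_nonneg e0] at k1
  nlinarith

lemma ex_clus {I : Finset ℕ} {σ : ℕ → ℤ} {ζ : ℕ → X} {r1 r0 : ℝ} (hr : 0 ≤ r1) (h : 4 * r1 ≤ r0) (hp : 0 < r0)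
    (G : Gap I ζ r1 r0) (hs : ∑ n ∈ I, σ n ≠ 0) : ∃ m ∈ I, cS I σ ζ r1 (ζ m) ≠ 0 := by
  classical
  by_contra! hc
  apply hs
  let cl : ℕ → Finset ℕ := fun n => I.filter fun k => dist (ζ n) (ζ k) ≤ r1
  refine Finset.sum_cancels_of_partition_cancels (Setoid.ker cl) fun x hx => ?_
  rw [← hc x hx, cS]
  refine sum_congr ?_ fun _ _ => rfl
  ext k
  simp only [mem_filter, and_congr_right_iff]
  intro hk
  constructor
  · intro hq
    have hq : cl k = cl x := hq
    have : k ∈ cl k := by simp [cl, hk, hr]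
    grind
  · intro hq
    change cl k = cl x
    ext j
    simp only [cl, mem_filter, and_congr_right_iff]
    intro hj
    have t1 := dist_triangle (ζ x) (ζ k) (ζ j)
    have t2 := dist_triangle_left (ζ k) (ζ j) (ζ x)
    constructor
    · intro a
      rcases G x hx j hj with b | b <;> linarith
    · intro a
      rcases G k hk j hj with b | b <;> linarith

lemma ex_gap {I : Finset ℕ} {ζ : ℕ → X} {N : ℕ} (hN : I.card ≤ N) {θ D : ℝ} (h0 : 0 < θ) (h1 : θ < 1) (hD : 0 < D) :
    ∃ j ∈ range (N ^ 2 + 1), Gap I ζ (θ ^ (j + 1) * D) (θ ^ j * D) := by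
  by_contra! hc
  have : ∀ j : ℕ, ∃ p : ℕ × ℕ, j ∈ range (N ^ 2 + 1) → p ∈ I ×ˢ I ∧ θ ^ (j + 1) * D < dist (ζ p.1) (ζ p.2) ∧ dist (ζ p.1) (ζ p.2) ≤ θ ^ j * D := by
    intro j
    by_cases hj : j ∈ range (N ^ 2 + 1)
    · have := hc j hj
      unfold Gap at this
      push Not at this
      obtain ⟨n, hn, m, hm, a, b⟩ := this
      exact ⟨(n, m), fun _ => ⟨Finset.mk_mem_product hn hm, a, b⟩⟩
    · exact ⟨0, fun h => absurd h hj⟩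
  choose p hp using this
  have cd : (I ×ˢ I).card < (range (N ^ 2 + 1)).card := by
    rw [Finset.card_product, card_range]
    nlinarith
  obtain ⟨i, hi, j, hj, hij, he⟩ := Finset.exists_ne_map_eq_of_card_lt_of_maps_to cd fun j hj => (hp j hj).1
  have key : ∀ i j, i < j → p i = p j → i ∈ range (N ^ 2 + 1) → j ∈ range (N ^ 2 + 1) → False := by
    intro i j hij he hi hj
    have a := (hp i hi).2.1
    have b := (hp j hj).2.2
    rw [he] at a
    have : θ ^ j * D ≤ θ ^ (i + 1) * D := by
      gcongr ?_ * D
      exact pow_le_pow_of_le_one h0.le h1.le hij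
    linarith
  grind

end

section
open Pointwise
lemma pig {ι : Type*} {Q : Set RR} {F : Finset ι} {S : ι → Set RR} {c n : ℝ} (hc : 0 < c) (hn : 0 < n)
    (hQ : Q ⊆ ⋃ i ∈ F, S i) (hv : ofReal c ≤ volume Q) (hF : (F.card : ℝ) ≤ n) :
    ∃ i ∈ F, ofReal (c / n) ≤ volume (S i) := by
  by_contra! h
  have a : volume Q ≤ ∑ i ∈ F, volume (S i) := (measure_mono hQ).trans (measure_biUnion_finset_le F S)
  have p : 0 < ofReal c := by simpa
  rcases F.eq_empty_or_nonempty with e | e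
  · grind
  have b := ENNReal.sum_lt_sum_of_nonempty e h
  rw [sum_const, nsmul_eq_mul, ← ENNReal.ofReal_natCast, ← ofReal_mul PP] at b
  have : ofReal (F.card * (c / n)) ≤ ofReal c := ofReal_le_ofReal (by
    rw [mul_div_assoc', div_le_iff₀ hn]
    nlinarith)
  grind

lemma propA {X : Type u} [PseudoMetricSpace X] {φ : RR → X} {f g : RR → ℝ} {D C1 L θ : ℝ} {K : ℝ≥0} {N : ℕ}
    (s : Sq φ f g D K) (hB : SqB f g D) (hC : 0 < C1) (hA : ∫ x in D2, jac2 (mder φ x) ≤ C1 * D ^ 2)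
    (hN : 512 * C1 ≤ N) (hL : 1 ≤ L) (hL' : 512000 * tB * C1 ≤ L) (t0 : 0 < θ) (t1 : θ ≤ 1 / 4) (t2 : 2 * N * θ < 1 / 16) :
    ∃ j ≤ N ^ 2, ∃ (A : Set RR) (ψ : RR → X), A ⊆ closedBall 0 1 ∧
      ofReal (1 / (128 * (N ^ 2 + 1))) ≤ volume A ∧ ∀ y ∈ A, ∀ y' ∈ A,
        dist y y' ≤ dist (ψ y) (ψ y') / (θ ^ j * D / (16 * L)) ∧
        dist (ψ y) (ψ y') / (θ ^ j * D / (16 * L)) ≤ L * dist y y' + (2 * N + 1) * (16 * L) * θ := by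
  obtain ⟨Q, I, σ, ζ, q1, q2, q3, q4, q5, q6⟩ := propB s hB hC hA hN
  have D0 := s.hD
  obtain ⟨j, hj, hv⟩ := pig (S := fun j => {y ∈ Q | Gap (I y) (ζ · y) (θ ^ (j + 1) * D) (θ ^ j * D)})
    (F := range (N ^ 2 + 1)) (n := N ^ 2 + 1) PP PP
    (fun y hy => by
      obtain ⟨j, hj, h⟩ := ex_gap (ζ := (ζ · y)) (q4 y hy).1 t0 LL D0
      exact mem_biUnion hj ⟨hy, h⟩) q2 SP
  refine ⟨j, by rw [mem_range] at hj; omega, ?_⟩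
  set r0 := θ ^ j * D with hr0
  have r00 : 0 < r0 := by positivity
  have r1 : θ ^ (j + 1) * D = θ * r0 := by rw [hr0]; ring
  rw [r1] at hv
  set w := r0 / (16 * L) with hw
  have w0 : 0 < w := by positivity
  have Lw : L * w = r0 / 16 := by rw [hw]; field_simp
  have wD : w ≤ D / 16 := by
    have : r0 ≤ D := by
      have : θ ^ j ≤ 1 := pow_le_one₀ t0.le LL
      rw [hr0]; nlinarith
    nlinarith
  have box : ∀ y ∈ Q, (0 ≤ y.1 / w ∧ y.1 / w ≤ 9 * D / 16 / w) ∧ (0 ≤ y.2 / w ∧ y.2 / w ≤ 9 * D / 16 / w) := fun y hy => by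
    have := q1 hy
    rw [mem_closedBall, Prod.dist_eq, max_le_iff, dist_eq, dist_eq, abs_le, abs_le] at this
    obtain ⟨⟨a, b⟩, c, d⟩ := this
    simp only at a b c d
    refine ⟨⟨div_nonneg LL w0.le, ?_⟩, div_nonneg LL w0.le, ?_⟩ <;> gcongr <;> linarith
  set G := ⌊9 * D / 16 / w⌋₊ + 1 with hG
  have GD : (G : ℝ) ≤ D / w := by
    have := Nat.floor_le (show 0 ≤ 9 * D / 16 / w by positivity)
    have h2 : 9 * D / 16 / w + 1 ≤ D / w := by
      rw [div_add_one w0.ne']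
      gcongr
      linarith
    rw [hG]; push_cast; linarith
  set Kj := {y ∈ Q | Gap (I y) (ζ · y) (θ * r0) r0} with hK
  obtain ⟨p, -, hp⟩ := pig (S := fun p : ℕ × ℕ => {y ∈ Kj | ⌊y.1 / w⌋₊ = p.1 ∧ ⌊y.2 / w⌋₊ = p.2})
    (F := range G ×ˢ range G) (n := (D / w) ^ 2) PP PP
    (fun y hy => by
      obtain ⟨a, b⟩ := box y hy.1
      refine mem_biUnion (x := (⌊y.1 / w⌋₊, ⌊y.2 / w⌋₊)) ?_ ⟨hy, rfl, rfl⟩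
      simp only [Finset.coe_product, Set.mem_prod, SetLike.mem_coe, mem_range, hG, Nat.lt_succ_iff]
      exact ⟨Nat.floor_le_floor a.2, Nat.floor_le_floor b.2⟩) hv (by
        rw [Finset.card_product, card_range]; push_cast; rw [← sq]; gcongr)
  set A := {y ∈ Kj | ⌊y.1 / w⌋₊ = p.1 ∧ ⌊y.2 / w⌋₊ = p.2} with hAd
  have dA : ∀ y ∈ A, ∀ y' ∈ A, dist y y' ≤ w := by
    have key : ∀ a b : ℝ, 0 ≤ a / w → 0 ≤ b / w → ⌊a / w⌋₊ = ⌊b / w⌋₊ → dist a b ≤ w := fun a b ha hb h => by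
      have h1 := Nat.floor_le ha
      have h2 := Nat.floor_le hb
      have h3 := Nat.lt_floor_add_one (a / w)
      have h4 := Nat.lt_floor_add_one (b / w)
      rw [h] at h1 h3
      rw [le_div_iff₀ w0] at h1 h2
      rw [div_lt_iff₀ w0] at h3 h4
      rw [dist_eq, abs_le]; constructor <;> linarith
    intro y hy y' hy'
    rw [Prod.dist_eq]
    obtain ⟨a, b⟩ := box y hy.1.1
    grind
  obtain ⟨y0, h0⟩ : A.Nonempty := nonempty_of_measure_ne_zero (lt_of_lt_of_le (by rw [ofReal_pos]; positivity) hp).ne'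
  have sel : ∀ y ∈ A, ∀ y' ∈ A, ∀ m ∈ I y, cS (I y) (σ · y) (ζ · y) (θ * r0) (ζ m y) ≠ 0 →
      ∃ m' ∈ I y', cS (I y') (σ · y') (ζ · y') (θ * r0) (ζ m' y') ≠ 0 ∧ dist (ζ m y) (ζ m' y') ≤ L * dist y y' + 2 * N * (θ * r0) := by
    intro y hy y' hy' m hm hs
    refine selQ (fun n => q3 n y) (fun n => q3 n y') (q4 y hy.1.1).1 (q4 y' hy'.1.1).1 PP (by nlinarith)
      hy.1.2 hy'.1.2 ?_ hm hs ?_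
    · nlinarith [mul_le_mul_of_nonneg_left (dA y hy y' hy') (by linarith : 0 ≤ L)]
    · exact fun c => (q6 y hy.1.1 y' hy'.1.1 y hy.1.1 m hm c).trans (by gcongr)
  obtain ⟨m0, hm0, hs0⟩ := ex_clus (σ := (σ · y0)) PP (by nlinarith) r00 h0.1.2 (by
    grind)
  choose! M hM1 hM2 hM3 using fun y hy => sel y0 h0 y hy m0 hm0 hs0
  have main : ∀ y ∈ A, ∀ y' ∈ A, dist y y' ≤ dist (ζ (M y) y) (ζ (M y') y') ∧
      dist (ζ (M y) y) (ζ (M y') y') ≤ L * dist y y' + (2 * N + 1) * (θ * r0) := by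
    intro y hy y' hy'
    refine ⟨q5 y hy.1.1 y' hy'.1.1 _ (hM1 y hy) _ (hM1 y' hy'), ?_⟩
    obtain ⟨m', k1, -, k3⟩ := sel y hy y' hy' (M y) (hM1 y hy) (hM2 y hy)
    have a1 := hM3 y hy
    have a2 := hM3 y' hy'
    have b1 := mul_le_mul_of_nonneg_left (dA y0 h0 y hy) (by linarith : 0 ≤ L)
    have b2 := mul_le_mul_of_nonneg_left (dA y0 h0 y' hy') (by linarith : 0 ≤ L)
    have b3 := mul_le_mul_of_nonneg_left (dA y hy y' hy') (by linarith : 0 ≤ L)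
    have c1 := dist_triangle_left (ζ (M y') y') (ζ m' y') (ζ m0 y0)
    have c2 := dist_triangle (ζ m0 y0) (ζ (M y) y) (ζ m' y')
    have c3 := dist_triangle_right (ζ (M y) y) (ζ (M y') y') (ζ m' y')
    rcases hy'.1.2 _ (hM1 y' hy') _ k1 with q | q
    · linarith
    · simp only at q
      nlinarith
  refine ⟨(fun u => w⁻¹ • y0 + u) ⁻¹' (w⁻¹ • A), fun u => ζ (M (w • (w⁻¹ • y0 + u))) (w • (w⁻¹ • y0 + u)), ?_, ?_, ?_⟩
  · intro u hu
    have := dA _ ((mem_inv_smul_set_iff₀ w0.ne' _ _).1 hu) y0 h0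
    rw [smul_add, smul_inv_smul₀ w0.ne', dist_self_add_left, norm_smul, norm_of_nonneg w0.le] at this
    rw [mem_closedBall_zero_iff]
    nlinarith
  · rw [measure_preimage_add, Measure.addHaar_smul]
    refine le_trans ?_ (mul_le_mul_right hp _)
    rw [← ofReal_mul PP]
    refine ofReal_le_ofReal (le_of_eq ?_)
    simp
    field_simp
  · intro y hy y' hy'
    obtain ⟨a, b⟩ := main _ ((mem_inv_smul_set_iff₀ w0.ne' _ _).1 hy) _ ((mem_inv_smul_set_iff₀ w0.ne' _ _).1 hy')
    rw [dist_smul₀, dist_add_left, norm_of_nonneg w0.le] at a b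
    rw [le_div_iff₀ w0, div_le_iff₀ w0]
    refine ⟨by linarith, b.trans (le_of_eq ?_)⟩
    grind

def Iso (X : Type u) [MetricSpace X] (ε s₀ : ℝ) : Prop := ∀ γ : ℝ → X, IsLipLoop γ → s₀ ≤ loopLength γ →
  ∃ φ : RR → X, BoundsLoop φ γ ∧ lipArea φ ≤ (1 - ε) / (4 * π) * (loopLength γ) ^ 2

section
variable {X : Type u} [MetricSpace X]

lemma poly (z : ℕ → X) (g : ℕ → ℝ → X) (hg : ∀ i, IsGeodesicSeg (z i) (z (i + 1)) (g i)) :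
    ∃ Γ : ℝ → X, (∀ (i : ℕ), ∀ s ∈ Icc (i:ℝ) (i + 1), Γ s = g i ((s - i) * dist (z i) (z (i + 1)))) ∧
      ∀ m : ℕ, (∃ C, LipschitzOnWith C Γ (Icc 0 m)) ∧
        eVariationOn Γ (Icc 0 m) = ofReal (∑ i ∈ range m, dist (z i) (z (i + 1))) := by
  let Γ : ℝ → X := fun s => g ⌊s⌋₊ ((s - ⌊s⌋₊) * dist (z ⌊s⌋₊) (z (⌊s⌋₊ + 1)))
  have h1 : ∀ (i : ℕ), ∀ s ∈ Icc (i:ℝ) (i + 1), Γ s = g i ((s - i) * dist (z i) (z (i + 1))) := by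
    intro i s hs
    rcases hs.2.lt_or_eq with h | h
    · have : ⌊s⌋₊ = i := by
        rw [Nat.floor_eq_iff ((Nat.cast_nonneg i).trans hs.1)]
        exact ⟨hs.1, h⟩
      simp only [Γ, this]
    · have : ⌊s⌋₊ = i + 1 := by rw [h]; exact_mod_cast Nat.floor_natCast (i + 1)
      simp only [Γ, this]
      rw [h]
      push_cast
      rw [sub_self, zero_mul, add_sub_cancel_left, one_mul, (hg i).2.1, (hg (i + 1)).1]
  have h2 : ∀ (i : ℕ), ∀ s ∈ Icc (i:ℝ) (i + 1), ∀ t ∈ Icc (i:ℝ) (i + 1),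
      dist (Γ s) (Γ t) = dist (z i) (z (i + 1)) * |s - t| := by
    intro i s hs t ht
    have m : ∀ s ∈ Icc (i:ℝ) (i + 1), (s - i) * dist (z i) (z (i + 1)) ∈ Icc 0 (dist (z i) (z (i + 1))) := fun s hs =>
      ⟨mul_nonneg (by linarith [hs.1]) dist_nonneg, mul_le_of_le_one_left dist_nonneg (by linarith [hs.2])⟩
    rw [h1 i s hs, h1 i t ht, (hg i).2.2 _ (m s hs) _ (m t ht), ← sub_mul, abs_mul, abs_of_nonneg dist_nonneg, sub_sub_sub_cancel_right, mul_comm]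
  refine ⟨Γ, h1, fun m => ?_⟩
  induction m with
  | zero => exact ⟨⟨0, by simp⟩, by simp [eVariationOn.subsingleton]⟩
  | succ m ih =>
    obtain ⟨⟨C, hC⟩, hv⟩ := ih
    push_cast
    have m0 : (0:ℝ) ≤ m := Nat.cast_nonneg m
    constructor
    · have key : ∀ s ∈ Icc (0:ℝ) (m + 1), ∀ t ∈ Icc (0:ℝ) (m + 1), s ≤ t →
          dist (Γ s) (Γ t) ≤ (C + nndist (z m) (z (m + 1)) : ℝ≥0) * dist s t := by
        intro s hs t ht hst
        have d0 : 0 ≤ dist (z m) (z (m + 1)) := dist_nonneg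
        rw [dist_eq, abs_sub_comm, abs_of_nonneg (sub_nonneg.2 hst)]
        push_cast
        have A : ∀ t ∈ Icc (0:ℝ) m, ∀ s ∈ Icc (0:ℝ) t, dist (Γ s) (Γ t) ≤ C * (t - s) := fun t ht s hs => by
          have := hC.dist_le_mul s ⟨hs.1, hs.2.trans ht.2⟩ t ht
          rwa [dist_eq, abs_sub_comm, abs_of_nonneg (sub_nonneg.2 hs.2)] at this
        have B : ∀ s ∈ Icc (m:ℝ) t, dist (Γ s) (Γ t) ≤ dist (z m) (z (m + 1)) * (t - s) := fun s hs => by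
          rw [h2 m s ⟨hs.1, hs.2.trans ht.2⟩ t ⟨hs.1.trans hs.2, ht.2⟩, abs_sub_comm, abs_of_nonneg (sub_nonneg.2 hs.2)]
        rcases le_total t m with h | h
        · have := A t ⟨ht.1, h⟩ s ⟨hs.1, hst⟩
          nlinarith
        rcases le_total (m:ℝ) s with h' | h'
        · have := B s ⟨h', hst⟩
          nlinarith
        · have a1 := A m ⟨m0, le_rfl⟩ s ⟨hs.1, h'⟩
          have a2 := B m ⟨le_rfl, h⟩
          have := dist_triangle (Γ s) (Γ m) (Γ t)
          nlinarith
      refine ⟨C + nndist (z m) (z (m + 1)), LipschitzOnWith.of_dist_le_mul fun s hs t ht => ?_⟩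
      · rcases le_total s t with h | h
        · exact key s hs t ht h
        · rw [dist_comm, dist_comm s]; exact key t ht s hs h
    · have := eVariationOn.Icc_add_Icc Γ (s := Set.univ) m0 (by linarith : (m:ℝ) ≤ m + 1) (Set.mem_univ _)
      simp only [Set.univ_inter] at this
      rw [← this, hv, sum_range_succ, ofReal_add (sum_nonneg fun _ _ => dist_nonneg) dist_nonneg]
      congr 1
      apply le_antisymm
      · have k : LipschitzOnWith (nndist (z m) (z (m + 1))) Γ (Icc m (m + 1)) :=
          LipschitzOnWith.of_dist_le_mul fun s hs t ht => (h2 m s hs t ht).le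
        have := k.comp_eVariationOn_le (f := Γ) (g := id) (s := Icc (m:ℝ) (m + 1)) fun _ h => h
        refine this.trans ?_
        simp
      · have := eVariationOn.edist_le Γ (s := Icc (m:ℝ) (m + 1)) (left_mem_Icc.2 LL) (right_mem_Icc.2 LL)
        rwa [edist_dist, h2 m _ (left_mem_Icc.2 LL) _ (right_mem_Icc.2 LL), sub_add_cancel_left, abs_neg, abs_one, mul_one] at this

lemma fill {ε s₀ : ℝ} (h : Iso X ε s₀) {n : ℕ} (hn : 0 < n) (z : ℕ → X) (g : ℕ → ℝ → X)
    (hg : ∀ i, IsGeodesicSeg (z i) (z (i + 1)) (g i)) (hz : z n = z 0)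
    (hs : s₀ ≤ ∑ i ∈ range n, dist (z i) (z (i + 1))) :
    ∃ (φ : RR → X) (K : ℝ≥0), LipschitzOnWith K φ D2 ∧
      ∫ x in D2, jac2 (mder φ x) ≤ (1 - ε) / (4 * π) * (∑ i ∈ range n, dist (z i) (z (i + 1))) ^ 2 ∧
      ∀ i < n, ∀ t ∈ Icc (i / n : ℝ) ((i + 1) / n), φ (circ t) = g i ((n * t - i) * dist (z i) (z (i + 1))) := by
  obtain ⟨Γ, h1, h2⟩ := poly z g hg
  obtain ⟨⟨C, hC⟩, hv⟩ := h2 n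
  have n0 : (0:ℝ) < n := Nat.cast_pos.2 hn
  have mp : ∀ t ∈ Icc (0:ℝ) 1, (n:ℝ) * t ∈ Icc (0:ℝ) n := fun t ht =>
    ⟨by nlinarith [ht.1], by nlinarith [ht.2]⟩
  have L : loopLength (fun t => Γ (n * t)) = ∑ i ∈ range n, dist (z i) (z (i + 1)) := by
    have e := eVariationOn.comp_eq_of_monotoneOn Γ (t := Icc (0:ℝ) 1) (fun t => (n:ℝ) * t) fun a _ b _ hab => by
      simp only; gcongr
    have im : (fun t => (n:ℝ) * t) '' Icc (0:ℝ) 1 = Icc 0 (n:ℝ) := by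
      rw [Set.image_mul_left_Icc' n0]; simp
    rw [im, hv] at e
    unfold loopLength
    rw [← toReal_ofReal (sum_nonneg fun i (_ : i ∈ range n) => (dist_nonneg : 0 ≤ dist (z i) (z (i + 1)))), ← e]
    rfl
  have v : ∀ i : ℕ, Γ i = z i := fun i => by
    rw [h1 i i ⟨le_rfl, by linarith⟩, sub_self, zero_mul, (hg i).1]
  obtain ⟨φ, ⟨⟨K, hK⟩, b⟩, hA⟩ := h (fun t => Γ (n * t)) ⟨⟨C * n, LipschitzOnWith.of_dist_le_mul fun s hs t ht => by
    refine (hC.dist_le_mul _ (mp s hs) _ (mp t ht)).trans (le_of_eq ?_)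
    rw [dist_eq, dist_eq, ← mul_sub, abs_mul, abs_of_pos n0]
    push_cast; ring⟩, by
      grind⟩ (by rw [L]; exact hs)
  rw [L] at hA
  refine ⟨φ, K, hK, hA, fun i hi t ht => ?_⟩
  have a1 := (div_le_iff₀ n0).1 ht.1
  have a2 := (le_div_iff₀ n0).1 ht.2
  have i1 : (i:ℝ) + 1 ≤ n := by exact_mod_cast hi
  refine (b t ⟨by nlinarith, by nlinarith⟩).trans ?_
  grind
end

section
variable {X : Type u} [MetricSpace X]

lemma subg {p q : X} {γ : ℝ → X} (hg : IsGeodesicSeg p q γ) {s t : ℝ} (hs : s ∈ Icc 0 (dist p q)) (ht : t ∈ Icc 0 (dist p q)) :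
    ∃ γ', IsGeodesicSeg (γ s) (γ t) γ' ∧ ∀ r ∈ Icc 0 (dist (γ s) (γ t)), (∃ r' ∈ uIcc s t, γ' r = γ r') ∧ (s ≤ t → γ' r = γ (s + r)) := by
  have e := hg.2.2 s hs t ht
  rcases le_or_gt s t with h | h
  · rw [abs_sub_comm, abs_of_nonneg (sub_nonneg.2 h)] at e
    refine ⟨fun r => γ (s + r), ⟨by simp, by simp [e], fun r hr r' hr' => ?_⟩, fun r hr => ⟨⟨s + r, ?_, rfl⟩, fun _ => rfl⟩⟩
    · rw [e] at hr hr'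
      rw [hg.2.2 _ ⟨by linarith [hs.1, hr.1], by linarith [ht.2, hr.2]⟩ _ ⟨by linarith [hs.1, hr'.1], by linarith [ht.2, hr'.2]⟩, add_sub_add_left_eq_sub]
    · rw [e] at hr
      rw [uIcc_of_le h]
      grind
  · rw [abs_of_nonneg (sub_nonneg.2 h.le)] at e
    refine ⟨fun r => γ (s - r), ⟨by simp, by simp [e], fun r hr r' hr' => ?_⟩, fun r hr => ⟨⟨s - r, ?_, rfl⟩, fun q => absurd q (not_le.2 h)⟩⟩
    · rw [e] at hr hr'
      rw [hg.2.2 _ ⟨by linarith [ht.1, hr.2], by linarith [hs.2, hr.1]⟩ _ ⟨by linarith [ht.1, hr'.2], by linarith [hs.2, hr'.1]⟩, sub_sub_sub_cancel_left, abs_sub_comm]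
    · rw [e] at hr
      rw [uIcc_of_ge h.le]
      grind

lemma dl {p q : X} {γ : ℝ → X} (hg : IsGeodesicSeg p q γ) {s : ℝ} (hs : s ∈ Icc 0 (dist p q)) : dist p (γ s) = s := by
  rw [← hg.1, hg.2.2 0 (left_mem_Icc.2 dist_nonneg) s hs, zero_sub, abs_neg, abs_of_nonneg hs.1]

lemma gdr {p q : X} {γ : ℝ → X} (hg : IsGeodesicSeg p q γ) {s : ℝ} (hs : s ∈ Icc 0 (dist p q)) : dist (γ s) q = dist p q - s := by
  rw [← hg.2.1, hg.2.2 s hs _ (right_mem_Icc.2 dist_nonneg), hg.2.1, abs_sub_comm, abs_of_nonneg (sub_nonneg.2 hs.2)]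

lemma clamp (D a b : ℝ) : |max 0 (min D a) - max 0 (min D b)| ≤ |a - b| := by
  grind

lemma rect (hX : GeodesicSpace X) {ε s₀ : ℝ} (h : Iso X ε s₀) (h0 : 0 < ε) {a b a' b' c c' : X} {g τ₁ τ₂ τ₃ : ℝ → X}
    (hg : IsGeodesicSeg a b g) {s δ : ℝ} (hδ : 0 < δ) (hs₀ : 2 * s₀ ≤ δ) (h1 : dist a a' + δ ≤ s) (h2 : dist b b' + δ ≤ dist a b - s)
    (t1 : IsGeodesicSeg b' c' τ₁) (t2 : IsGeodesicSeg c' c τ₂) (t3 : IsGeodesicSeg c a' τ₃)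
    (k1 : ∀ r ∈ Icc 0 (dist b' c'), 3 * δ / 4 ≤ dist (τ₁ r) (g s))
    (k2 : ∀ r ∈ Icc 0 (dist c' c), 3 * δ / 4 ≤ dist (τ₂ r) (g s))
    (k3 : ∀ r ∈ Icc 0 (dist c a'), 3 * δ / 4 ≤ dist (τ₃ r) (g s))
    (hl : dist a b + dist a a' + dist b b' + dist b' c' + dist c' c + dist c a' ≤ 288 * δ) :
    ∃ (φ : RR → X) (f g : RR → ℝ) (K : ℝ≥0), Sq φ f g (δ / 2) K ∧ SqB f g (δ / 2) ∧
      ∫ x in D2, jac2 (mder φ x) ≤ 576 ^ 2 * (δ / 2) ^ 2 := by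
  have p1 : 0 ≤ dist a a' := dist_nonneg
  have p2 : 0 ≤ dist b b' := dist_nonneg
  have ms : s ∈ Icc 0 (dist a b) := ⟨by linarith, by linarith⟩
  have mp : s - δ / 4 ∈ Icc 0 (dist a b) := ⟨by linarith, by linarith⟩
  have mq : s + δ / 4 ∈ Icc 0 (dist a b) := ⟨by linarith, by linarith⟩
  have ma := left_mem_Icc.2 (dist_nonneg (x := a) (y := b))
  have mb := right_mem_Icc.2 (dist_nonneg (x := a) (y := b))
  obtain ⟨g0, G0, e0⟩ := subg hg mp mq
  obtain ⟨g1, G1, e1⟩ := subg hg mq mb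
  obtain ⟨g7, G7, e7⟩ := subg hg ma mp
  rw [hg.2.1] at G1 e1
  rw [hg.1] at G7 e7
  obtain ⟨g2, G2⟩ := hX b b'
  obtain ⟨g6, G6⟩ := hX a' a
  set p := g (s - δ / 4) with hp
  set q := g (s + δ / 4) with hq
  let zz : Fin 8 → X := ![p, q, b, b', c', c, a', a]
  let gg : Fin 8 → ℝ → X := ![g0, g1, g2, τ₁, τ₂, τ₃, g6, g7]
  have hG : ∀ i : Fin 8, IsGeodesicSeg (zz i) (zz (i + 1)) (gg i) := by
    intro i; fin_cases i
    exacts [G0, G1, G2, t1, t2, t3, G6, G7]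
  have d0 : dist p q = δ / 2 := by
    rw [hp, hq, hg.2.2 _ mp _ mq, abs_sub_comm, abs_of_nonneg] <;> linarith
  have d1 : dist q b = dist a b - (s + δ / 4) := gdr hg mq
  have d7 : dist a p = s - δ / 4 := dl hg mp
  have sm : ∑ i ∈ range 8, dist (zz (Fin.ofNat 8 i)) (zz (Fin.ofNat 8 (i + 1))) =
      dist a b + dist a a' + dist b b' + dist b' c' + dist c' c + dist c a' := by
    simp only [sum_range_succ, Finset.sum_range_zero, zero_add]
    change dist p q + dist q b + dist b b' + dist b' c' + dist c' c + dist c a' + dist a' a + dist a p = _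
    rw [d0, d1, d7, dist_comm a' a]; ring
  have q1 : 0 ≤ dist b' c' := dist_nonneg
  have q2 : 0 ≤ dist c' c := dist_nonneg
  have q3 : 0 ≤ dist c a' := dist_nonneg
  obtain ⟨φ, K, hK, hA, hφ⟩ := fill h (n := 8) NN (fun i => zz (Fin.ofNat 8 i)) (fun i => gg (Fin.ofNat 8 i)) (fun i => by
    have e : Fin.ofNat 8 (i + 1) = Fin.ofNat 8 i + 1 := by ext; simp [Fin.add_def]
    simp only [e]
    exact hG _) rfl (by rw [sm]; linarith)
  rw [sm] at hA
  have H : ∀ i : Fin 8, ∀ t ∈ Icc ((i:ℕ) / 8 : ℝ) (((i:ℕ) + 1) / 8), ∃ r ∈ Icc 0 (dist (zz i) (zz (i + 1))), φ (circ t) = gg i r := by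
    intro i t ht
    have := hφ i i.2 t ht
    have a1 := (div_le_iff₀ NN).1 ht.1
    have a2 := (le_div_iff₀ NN).1 ht.2
    have e : Fin.ofNat 8 (i + 1) = i + 1 := by ext; simp [Fin.add_def]
    have e' : Fin.ofNat 8 i = i := by ext; simp
    simp only [e, e', Nat.cast_ofNat] at this
    exact ⟨_, ⟨mul_nonneg LL dist_nonneg, mul_le_of_le_one_left dist_nonneg LL⟩, this⟩
  have c0 : ∀ r ∈ Icc 0 (dist p q), dist (g0 r) (g s) ≤ δ / 4 := fun r hr => by
    obtain ⟨r', h, e⟩ := (e0 r hr).1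
    rw [uIcc_of_le LL] at h
    rw [e, hg.2.2 _ ⟨by linarith [h.1, mp.1], by linarith [h.2, mq.2]⟩ _ ms, abs_le]
    grind
  have c1 : ∀ r ∈ Icc 0 (dist q b), s + δ / 4 ≤ dist (g1 r) a := fun r hr => by
    obtain ⟨r', h, e⟩ := (e1 r hr).1
    rw [uIcc_of_le mq.2] at h
    rw [e, dist_comm, dl hg ⟨by linarith [h.1, mq.1], h.2⟩]
    exact h.1
  have c2 : ∀ r ∈ Icc 0 (dist b b'), s + δ / 4 ≤ dist (g2 r) a := fun r hr => by
    have := dl G2 hr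
    have := dist_triangle_right a b (g2 r)
    rw [dist_comm (g2 r)]
    linarith [hr.2]
  have c6 : ∀ r ∈ Icc 0 (dist a' a), dist (g6 r) a ≤ s - δ / 4 := fun r hr => by
    rw [gdr G6 hr, dist_comm a']; linarith [hr.1]
  have c7 : ∀ r ∈ Icc 0 (dist a p), dist (g7 r) a ≤ s - δ / 4 := fun r hr => by
    obtain ⟨r', h, e⟩ := (e7 r hr).1
    rw [uIcc_of_le mp.1] at h
    rw [e, dist_comm, dl hg ⟨h.1, by linarith [h.2, mp.2]⟩]
    exact h.2
  let F : RR → ℝ := fun x => max 0 (min (δ / 2) (dist (φ x) a - (s - δ / 4)))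
  let G : RR → ℝ := fun x => max 0 (min (δ / 2) (dist (φ x) (g s) - δ / 4))
  have F0 : ∀ x, dist (φ x) a ≤ s - δ / 4 → F x = 0 := fun x hx => max_eq_left (min_le_of_right_le LL)
  have FD : ∀ x, s + δ / 4 ≤ dist (φ x) a → F x = δ / 2 := fun x hx => by
    grind
  have G0' : ∀ x, dist (φ x) (g s) ≤ δ / 4 → G x = 0 := fun x hx => max_eq_left (min_le_of_right_le LL)
  have GD : ∀ x, 3 * δ / 4 ≤ dist (φ x) (g s) → G x = δ / 2 := fun x hx => by
    grind
  have J : ∀ (i : Fin 8) (n : ℝ) (g : ℝ → X) (x y : X), ((i:ℕ) : ℝ) = n → gg i = g → zz i = x → zz (i + 1) = y → ∀ C : X → Prop,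
      (∀ r ∈ Icc 0 (dist x y), C (g r)) → ∀ t, n ≤ t * 8 → t * 8 ≤ n + 1 → C (φ (circ t)) := by
    rintro i n g x y rfl rfl rfl rfl C hC t h1 h2
    obtain ⟨r, hr, e⟩ := H i t ⟨(div_le_iff₀ NN).2 h1, (le_div_iff₀ NN).2 h2⟩
    rw [e]; exact hC r hr
  have J0 := J 0 0 g0 p q SP rfl rfl rfl (fun x => dist x (g s) ≤ δ / 4) c0
  have J1 := J 1 1 g1 q b SP rfl rfl rfl (fun x => s + δ / 4 ≤ dist x a) c1
  have J2 := J 2 2 g2 b b' SP rfl rfl rfl (fun x => s + δ / 4 ≤ dist x a) c2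
  have J3 := J 3 3 τ₁ b' c' SP rfl rfl rfl (fun x => 3 * δ / 4 ≤ dist x (g s)) k1
  have J4 := J 4 4 τ₂ c' c SP rfl rfl rfl (fun x => 3 * δ / 4 ≤ dist x (g s)) k2
  have J5 := J 5 5 τ₃ c a' SP rfl rfl rfl (fun x => 3 * δ / 4 ≤ dist x (g s)) k3
  have J6 := J 6 6 g6 a' a SP rfl rfl rfl (fun x => dist x a ≤ s - δ / 4) c6
  have J7 := J 7 7 g7 a p SP rfl rfl rfl (fun x => dist x a ≤ s - δ / 4) c7
  have hB : SqB F G (δ / 2) := by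
    clear_value zz gg
    refine ⟨1 / 8, 3 / 8, 6 / 8, by norm_num, by norm_num, by norm_num, by norm_num, fun t ht => ?_, fun t ht => ?_, fun t ht => ?_, fun t ht => ?_⟩ <;> obtain ⟨u, v⟩ := ht
    · exact G0' _ (J0 t LL LL)
    · apply FD
      rcases le_total t (2 / 8) with l | l
      · exact J1 t LL LL
      · exact J2 t LL LL
    · apply GD
      grind
    · apply F0
      grind
  refine ⟨φ, F, G, K, ⟨hK, fun x _ y _ => (clamp _ _ _).trans ?_, fun x _ y _ => (clamp _ _ _).trans ?_, by linarith, hB.hb⟩, hB, hA.trans ?_⟩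
  · rw [sub_sub_sub_cancel_right]; exact abs_dist_sub_le _ _ _
  · rw [sub_sub_sub_cancel_right]; exact abs_dist_sub_le _ _ _
  · have : (1 - ε) / (4 * π) ≤ 1 := by
      rw [div_le_one PP]; linarith [Real.pi_gt_three]
    refine (mul_le_mul_of_nonneg_right this (sq_nonneg _)).trans ?_
    rw [one_mul, ← mul_pow]
    refine pow_le_pow_left₀ (by linarith [dist_nonneg (x := a) (y := b)]) LL 2
end

section
variable {X : Type u} [MetricSpace X]

def Fat (X : Type u) [MetricSpace X] (P δ : ℝ) : Prop := ∃ (x y z : X) (g₁ g₂ g₃ : ℝ → X), IsGeodesicSeg x y g₁ ∧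
  IsGeodesicSeg y z g₂ ∧ IsGeodesicSeg z x g₃ ∧ dist x y + dist y z + dist z x ≤ P ∧ ∃ s ∈ Icc 0 (dist x y),
    (∀ r ∈ Icc 0 (dist y z), δ < dist (g₁ s) (g₂ r)) ∧ ∀ r ∈ Icc 0 (dist z x), δ < dist (g₁ s) (g₃ r)

lemma exFat (nh : ¬ GromovHyperbolic X) {R : ℝ} (hR : 0 < R) : ∃ P δ, R ≤ δ ∧ Fat X P δ ∧ ¬ Fat X P (2 * δ) := by
  by_contra! hc
  apply nh
  refine ⟨R, hR.le, ?_⟩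
  by_contra! h
  obtain ⟨x, y, z, g₁, g₂, g₃, a1, a2, a3, s, hs, hp⟩ := h
  have f0 : Fat X (dist x y + dist y z + dist z x) R := ⟨x, y, z, g₁, g₂, g₃, a1, a2, a3, le_rfl, s, hs,
    fun r hr => hp _ (Or.inl ⟨r, hr, rfl⟩), fun r hr => hp _ (Or.inr ⟨r, hr, rfl⟩)⟩
  set P := dist x y + dist y z + dist z x
  have all : ∀ k : ℕ, Fat X P (2 ^ k * R) := by
    intro k
    induction k with
    | zero => simpa using f0
    | succ k ih =>
      have := hc P _ (le_mul_of_one_le_left hR.le (one_le_pow₀ (by norm_num : (1:ℝ) ≤ 2))) ih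
      rwa [pow_succ', mul_assoc]
  obtain ⟨k, hk⟩ := pow_unbounded_of_one_lt (P / R) (by norm_num : (1:ℝ) < 2)
  rw [div_lt_iff₀ hR] at hk
  obtain ⟨x, y, z, g₁, g₂, g₃, a1, a2, a3, hP, s, hs, h2, -⟩ := all k
  have := h2 0 (left_mem_Icc.2 dist_nonneg)
  rw [a2.1, gdr a1 hs] at this
  linarith [hs.1, dist_nonneg (x := y) (y := z), dist_nonneg (x := z) (y := x)]

lemma fatq (hX : GeodesicSpace X) {ε s₀ : ℝ} (h : Iso X ε s₀) (h0 : 0 < ε) (nh : ¬ GromovHyperbolic X) (R : ℝ) :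
    ∃ D ≥ R, ∃ (φ : RR → X) (f g : RR → ℝ) (K : ℝ≥0), Sq φ f g D K ∧ SqB f g D ∧
      ∫ x in D2, jac2 (mder φ x) ≤ 576 ^ 2 * D ^ 2 := by
  obtain ⟨P, δ, hδ, ⟨x, y, z, g₁, g₂, g₃, a1, a2, a3, hP, s, hs, k2, k3⟩, nF⟩ := exFat nh (R := max 1 (max (8 * R) (8 * s₀))) PP
  simp only [max_le_iff] at hδ
  have δ0 : 0 < δ := by linarith
  set W : Set X := {p | (∃ r ∈ Icc 0 (dist y z), p = g₂ r) ∨ ∃ r ∈ Icc 0 (dist z x), p = g₃ r} with hW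
  have far : ∀ p ∈ W, δ < dist (g₁ s) p := by
    grind
  have slim : ∀ t ∈ Icc 0 (dist x y), ∃ p ∈ W, dist (g₁ t) p ≤ 2 * δ := fun t ht => by
    by_contra! hc
    exact nF ⟨x, y, z, g₁, g₂, g₃, a1, a2, a3, hP, t, ht, fun r hr => hc _ (Or.inl ⟨r, hr, rfl⟩), fun r hr => hc _ (Or.inr ⟨r, hr, rfl⟩)⟩
  have xW : x ∈ W := Or.inr ⟨_, right_mem_Icc.2 dist_nonneg, a3.2.1.symm⟩
  have yW : y ∈ W := Or.inl ⟨0, left_mem_Icc.2 dist_nonneg, a2.1.symm⟩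
  obtain ⟨ta, hta, ta3, a', haW, ha1, ha2⟩ : ∃ ta ∈ Icc 0 s, s - ta ≤ 3 * δ ∧ ∃ a' ∈ W, dist (g₁ ta) a' ≤ 2 * δ ∧ dist (g₁ ta) a' + δ ≤ s - ta := by
    rcases le_total s (3 * δ) with l | l
    · refine ⟨0, ⟨le_rfl, hs.1⟩, by linarith, x, xW, ?_⟩
      have := far x xW
      rw [dist_comm, dl a1 hs] at this
      rw [a1.1, dist_self]; constructor <;> linarith
    · obtain ⟨p, hp, hd⟩ := slim (s - 3 * δ) ⟨by linarith, by linarith [hs.2]⟩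
      grind
  obtain ⟨tb, htb, tb3, b', hbW, hb1, hb2⟩ : ∃ tb ∈ Icc s (dist x y), tb - s ≤ 3 * δ ∧ ∃ b' ∈ W, dist (g₁ tb) b' ≤ 2 * δ ∧ dist (g₁ tb) b' + δ ≤ tb - s := by
    rcases le_total (dist x y - s) (3 * δ) with l | l
    · refine ⟨dist x y, ⟨hs.2, le_rfl⟩, by linarith, y, yW, ?_⟩
      have := far y yW
      rw [gdr a1 hs] at this
      rw [a1.2.1, dist_self]; constructor <;> linarith
    · obtain ⟨p, hp, hd⟩ := slim (s + 3 * δ) ⟨by linarith [hs.1], by linarith⟩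
      grind
  have mta : ta ∈ Icc 0 (dist x y) := ⟨hta.1, hta.2.trans hs.2⟩
  have mtb : tb ∈ Icc 0 (dist x y) := ⟨hs.1.trans htb.1, htb.2⟩
  set a := g₁ ta with ha
  set b := g₁ tb with hb
  have dab : dist a b = tb - ta := by
    rw [ha, hb, a1.2.2 _ mta _ mtb, abs_sub_comm, abs_of_nonneg]; linarith [hta.2, htb.1]
  have dab' : dist a' b' ≤ 10 * δ := by
    have := dist_triangle4 a' a b b'
    rw [dist_comm a' a] at this
    linarith
  have toz : ∀ p ∈ W, ∃ α, IsGeodesicSeg p z α ∧ (∀ r ∈ Icc 0 (dist p z), α r ∈ W) ∧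
      (dist p x + dist p z = dist z x ∨ dist p y + dist p z = dist y z) := by
    rintro p (⟨r, hr, rfl⟩ | ⟨r, hr, rfl⟩)
    · obtain ⟨α, A1, A2⟩ := subg a2 hr (right_mem_Icc.2 dist_nonneg)
      rw [a2.2.1] at A1 A2
      refine ⟨α, A1, fun t ht => ?_, Or.inr ?_⟩
      · obtain ⟨r', h, e⟩ := (A2 t ht).1
        rw [uIcc_of_le hr.2] at h
        grind
      · rw [dist_comm, dl a2 hr, gdr a2 hr]; ring
    · obtain ⟨α, A1, A2⟩ := subg a3 hr (left_mem_Icc.2 dist_nonneg)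
      rw [a3.1] at A1 A2
      refine ⟨α, A1, fun t ht => ?_, Or.inl ?_⟩
      · obtain ⟨r', h, e⟩ := (A2 t ht).1
        rw [uIcc_of_ge hr.1] at h
        grind
      · rw [dist_comm _ z, dl a3 hr, gdr a3 hr]; ring
  obtain ⟨α, A1, A2, A3⟩ := toz a' haW
  obtain ⟨β, B1, B2, B3⟩ := toz b' hbW
  have per : dist a' z + dist z b' + dist b' a' ≤ P := by
    have e1 := dist_triangle b' x a'
    have e2 := dist_triangle b' y a'
    have e3 := dist_triangle4 b' x y a'
    have e4 := dist_triangle4 b' y x a'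
    have e5 := dist_triangle z y x
    have e6 := dist_triangle y x z
    rw [dist_comm x a'] at e1 e4
    rw [dist_comm y a'] at e2 e3
    rw [dist_comm y x] at e4 e6
    rw [dist_comm z y, dist_comm y x] at e5
    rw [dist_comm x z] at e6
    rw [dist_comm z b']
    grind
  by_cases cA : ∃ r ∈ Icc 0 (dist a' z), r ≤ 24 * δ ∧ ∃ r' ∈ Icc 0 (dist b' z), dist (α r) (β r') ≤ δ / 4
  · obtain ⟨r, hr, hr24, r', hr', hd⟩ := cA
    obtain ⟨G, G1, G2⟩ := subg a1 mta mtb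
    obtain ⟨τ₁, T1, T1'⟩ := subg B1 (left_mem_Icc.2 dist_nonneg) hr'
    obtain ⟨τ₃, T3, T3'⟩ := subg A1 hr (left_mem_Icc.2 dist_nonneg)
    obtain ⟨τ₂, T2⟩ := hX (β r') (α r)
    rw [B1.1] at T1 T1'
    rw [A1.1] at T3 T3'
    have mG : G (s - ta) = g₁ s := by
      grind
    have dc : dist (α r) a' = r := by rw [dist_comm, dl A1 hr]
    refine ⟨δ / 2, by linarith, rect hX h h0 (s := s - ta) G1 δ0 LL LL LL T1 T2 T3 ?_ ?_ ?_ ?_⟩ <;>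
      (try rw [mG])
    · intro t ht
      obtain ⟨r1, q1, e⟩ := (T1' t ht).1
      rw [uIcc_of_le hr'.1] at q1
      rw [e, dist_comm]
      grind
    · intro t ht
      have e1 := gdr T2 ht
      have e2 := far _ (A2 r hr)
      have e3 := dist_triangle_left (g₁ s) (α r) (τ₂ t)
      rw [dist_comm] at hd
      linarith [ht.1]
    · intro t ht
      obtain ⟨r1, q1, e⟩ := (T3' t ht).1
      rw [uIcc_of_ge hr.1] at q1
      rw [e, dist_comm]
      grind
    · have := dist_triangle4 b' a' (α r) (β r')
      rw [dist_comm b' a', dist_comm a' (α r)] at this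
      rw [dist_comm (β r')]
      linarith
  · push Not at cA
    have l24 : 24 * δ ≤ dist a' z := by
      by_contra! hc
      have := cA (dist a' z) (right_mem_Icc.2 dist_nonneg) hc.le (dist b' z) (right_mem_Icc.2 dist_nonneg)
      rw [A1.2.1, B1.2.1, dist_self] at this
      linarith
    have m24 : 24 * δ ∈ Icc 0 (dist a' z) := ⟨by linarith, l24⟩
    have m12 : 12 * δ ∈ Icc 0 (dist a' z) := ⟨by linarith, by linarith⟩
    obtain ⟨ν, N1⟩ := hX b' a'
    obtain ⟨β', B1', B2'⟩ := subg B1 (right_mem_Icc.2 dist_nonneg) (left_mem_Icc.2 dist_nonneg)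
    rw [B1.1, B1.2.1] at B1' B2'
    obtain ⟨r', hr', hd⟩ : ∃ r' ∈ Icc 0 (dist b' z), dist (α (24 * δ)) (β r') ≤ 2 * δ := by
      by_contra! hc
      refine nF ⟨a', z, b', α, β', ν, A1, B1', N1, per, 24 * δ, m24, fun r hr => ?_, fun r hr => ?_⟩
      · obtain ⟨r1, q1, e⟩ := (B2' r hr).1
        rw [uIcc_of_ge dist_nonneg] at q1
        rw [e]; exact hc _ q1
      · have e1 := gdr N1 hr
        have e2 := dl A1 m24
        have e3 := dist_triangle_right a' (α (24 * δ)) (ν r)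
        rw [dist_comm b' a'] at e1
        rw [dist_comm a' (ν r)] at e3
        linarith [hr.1]
    obtain ⟨G, G1, G2⟩ := subg A1 (left_mem_Icc.2 dist_nonneg) m24
    rw [A1.1] at G1 G2
    obtain ⟨τ₁, T1, T1'⟩ := subg B1 hr' (left_mem_Icc.2 dist_nonneg)
    rw [B1.1] at T1 T1'
    have mG : G (12 * δ) = α (12 * δ) := by
      rw [(G2 (12 * δ) ⟨by linarith, by rw [dl A1 m24]; linarith⟩).2 LL, zero_add]
    have T2 : IsGeodesicSeg b' b' (fun _ => b') := ⟨rfl, rfl, fun s hs t ht => by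
      rw [dist_self, Set.Icc_self] at hs ht; rw [hs, ht]; simp⟩
    have e1 := dl A1 m24
    have fr : ∀ r ∈ Icc 0 (dist b' z), 3 * (δ / 4) / 4 ≤ dist (β r) (α (12 * δ)) := fun r hr => by
      rw [dist_comm]; linarith [cA _ m12 LL r hr]
    have fr0 := fr 0 (left_mem_Icc.2 dist_nonneg)
    rw [B1.1] at fr0
    refine ⟨δ / 4 / 2, by linarith, rect hX h h0 (s := 12 * δ) G1 LL LL LL LL T1 T2 T2 ?_ ?_ ?_ ?_⟩ <;>
      (try rw [mG])
    · intro t ht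
      obtain ⟨r1, q1, e⟩ := (T1' t ht).1
      rw [uIcc_of_ge hr'.1] at q1
      grind
    · exact fun _ _ => fr0
    · exact fun _ _ => fr0
    · have := dist_triangle4 (β r') (α (24 * δ)) a' b'
      rw [dist_comm (β r') (α _), dist_comm (α (24 * δ)) a'] at this
      rw [dist_self]
      linarith
end

lemma edge {f g : ℝ → ℝ} {C C' : ℝ≥0} (hf : LipschitzWith C f) (hg : LipschitzWith C' g) {α β c : ℝ} (hab : α ≤ β) (hc : 0 ≤ c)
    (hfc : ∀ s ∈ Icc α β, ∀ t ∈ Icc α β, |f s - f t| ≤ c * |s - t|)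
    (hgc : ∀ s ∈ Icc α β, ∀ t ∈ Icc α β, |g s - g t| ≤ c * |s - t|) :
    |(∫ t in α..β, f t * deriv g t) - (f α + f β) / 2 * (g β - g α)| ≤ (c * (β - α)) ^ 2 / 2 := by
  have hac := (hg.lipschitzOnWith (s := uIcc α β)).absolutelyContinuousOnInterval
  have hi := hac.intervalIntegrable_deriv
  rw [← hac.integral_deriv_eq_sub, ← intervalIntegral.integral_const_mul, ← intervalIntegral.integral_sub
    (hi.continuousOn_mul hf.continuous.continuousOn) (hi.const_mul _)]
  have h1 := intervalIntegral.norm_integral_le_of_norm_le_const_ae (a := α) (b := β)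
    (f := fun t => f t * deriv g t - (f α + f β) / 2 * deriv g t) (C := c * (β - α) / 2 * c) (by
      have h0 : ∀ᵐ t : ℝ, t ≠ β := by simp [ae_iff, measure_singleton]
      filter_upwards [h0] with t ht hm
      rw [Set.uIoc_of_le hab] at hm
      have hm' : t ∈ Icc α β := ⟨hm.1.le, hm.2⟩
      have htb : t < β := lt_of_le_of_ne hm.2 ht
      have e : f t * deriv g t - (f α + f β) / 2 * deriv g t = (f t - (f α + f β) / 2) * deriv g t := by ring
      rw [e, norm_mul]
      have h2 : ‖deriv g t‖ ≤ c := by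
        have : LipschitzOnWith ⟨c, hc⟩ g (Icc α β) := LipschitzOnWith.of_dist_le_mul fun s hs t ht => by
          rw [dist_eq, dist_eq]; exact hgc s hs t ht
        exact norm_deriv_le_of_lipschitzOn (Icc_mem_nhds hm.1 htb) this
      have h3 : ‖f t - (f α + f β) / 2‖ ≤ c * (β - α) / 2 := by
        have a1 := hfc t hm' α ⟨le_rfl, hab⟩
        have a2 := hfc t hm' β ⟨hab, le_rfl⟩
        rw [abs_of_nonneg (by linarith [hm.1] : (0:ℝ) ≤ t - α)] at a1
        rw [abs_of_nonpos (by linarith : t - β ≤ 0)] at a2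
        rw [abs_le] at a1 a2
        rw [norm_eq_abs, abs_le]
        constructor <;> nlinarith
      exact mul_le_mul h3 h2 (norm_nonneg _) (by have := mul_nonneg hc (sub_nonneg.2 hab); linarith))
  rw [norm_eq_abs, abs_of_nonneg (sub_nonneg.2 hab)] at h1
  linarith

noncomputable def pw (n : ℕ) (u v : ℕ → ℝ) : ℝ := 1 / 2 * ∑ i ∈ range n, (u i * v (i + 1) - u (i + 1) * v i)

lemma pw_trap {n : ℕ} {u v : ℕ → ℝ} (hu : u n = u 0) (hv : v n = v 0) :
    ∑ i ∈ range n, (u i + u (i + 1)) / 2 * (v (i + 1) - v i) = pw n u v := by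
  have h := sum_range_sub (fun i => u i * v i) n
  simp only [hu, hv, sub_self] at h
  have : ∑ i ∈ range n, (u i + u (i + 1)) / 2 * (v (i + 1) - v i) =
     ∑ i ∈ range n, (1 / 2 * (u i * v (i + 1) - u (i + 1) * v i) + 1 / 2 * (u (i+1) * v (i+1) - u i * v i)) :=
    sum_congr rfl fun i _ => by ring
  rw [this, sum_add_distrib, ← mul_sum, ← mul_sum, h, pw]; ring

variable {X : Type u} [MetricSpace X]

lemma lemF {ε s₀ : ℝ} (hX : GeodesicSpace X) (h : Iso X ε s₀) {n : ℕ} (hn : 0 < n) (z : ℕ → X) (hz : z n = z 0)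
    (hs : s₀ ≤ ∑ i ∈ range n, dist (z i) (z (i + 1))) (w : ℕ → X) {l : ℕ → ℝ} {N : ℕ} (l0 : ∀ i, 0 ≤ l i)
    (l1 : ∑ i ∈ range N, l i = 1) :
    π / 2 * ∑ a ∈ range N, ∑ b ∈ range N, l a * l b *
      |pw n (fun i => dist (z i) (w a)) (fun i => dist (z i) (w b))| ≤
    (1 - ε) / (4 * π) * (∑ i ∈ range n, dist (z i) (z (i + 1))) ^ 2 +
      π * ∑ i ∈ range n, dist (z i) (z (i + 1)) ^ 2 := by
  choose g hg using fun i => hX (z i) (z (i + 1))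
  obtain ⟨φ, K, hφ, hA, hb⟩ := fill h hn z g hg hz hs
  set f : ℕ → RR → ℝ := fun a x => dist (φ x) (w a) with hf
  have hF : ∀ a, Fits φ (f a) := fun a x _ y _ => abs_dist_sub_le _ _ _
  have hL : ∀ a, LD (f a) := fun a => Fits.LD hφ (hF a)
  have hn' : (0:ℝ) < n := Nat.cast_pos.2 hn
  have main : ∀ a b, |pw n (fun i => dist (z i) (w a)) (fun i => dist (z i) (w b))| ≤
      (∫ x in D2, |jd (f a) (f b) x|) + 1 / 2 * ∑ i ∈ range n, dist (z i) (z (i + 1)) ^ 2 := by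
    intro a b
    obtain ⟨Ca, ha⟩ := (hL a).circ
    obtain ⟨Cb, hb'⟩ := (hL b).circ
    have hst := stokes_on (hL a) (hL b)
    have hi := fun α β => (hb'.lipschitzOnWith (s := uIcc α β)).absolutelyContinuousOnInterval.intervalIntegrable_deriv.continuousOn_mul
      ha.continuous.continuousOn
    have hsum := intervalIntegral.sum_integral_adjacent_intervals (a := fun i : ℕ => (i / n : ℝ)) (n := n)
      (f := fun t => f a (circ t) * deriv (fun t => f b (circ t)) t) (μ := volume) (fun k _ => hi _ _)
    simp only [Nat.cast_zero, zero_div, div_self hn'.ne'] at hsum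
    rw [← hsum] at hst
    have hE : ∀ i ∈ range n, ∀ c, ∀ t ∈ Icc (i / n : ℝ) ((i + 1 : ℕ) / n), ∀ s ∈ Icc (i / n : ℝ) ((i + 1 : ℕ) / n),
        |f c (circ s) - f c (circ t)| ≤ n * dist (z i) (z (i + 1)) * |s - t| := by
      intro i hi c t ht s hs
      refine (abs_dist_sub_le _ _ _).trans ?_
      have hi := mem_range.1 hi
      push_cast at ht hs
      rw [hb i hi t ht, hb i hi s hs]
      have key : ∀ t ∈ Icc (i / n : ℝ) ((i + 1 ) / n), (n * t - i) * dist (z i) (z (i + 1)) ∈ Icc 0 (dist (z i) (z (i + 1))) := by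
        intro t ht
        have h1 := (div_le_iff₀ hn').1 ht.1
        have h2 := (le_div_iff₀ hn').1 ht.2
        have := dist_nonneg (x := z i) (y := z (i + 1))
        constructor <;> nlinarith
      rw [(hg i).2.2 _ (key s hs) _ (key t ht)]
      have : (n * s - i) * dist (z i) (z (i + 1)) - (n * t - i) * dist (z i) (z (i + 1)) = n * dist (z i) (z (i + 1)) * (s - t) := by ring
      grind
    have hv : ∀ i ∈ range n, φ (circ (i / n : ℝ)) = z i ∧ φ (circ ((i + 1 : ℕ) / n : ℝ)) = z (i + 1) := by
      intro i hi
      have hi := mem_range.1 hi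
      have hle : (i / n : ℝ) ≤ (i + 1) / n := by gcongr; linarith
      rw [hb i hi _ ⟨le_rfl, hle⟩, Nat.cast_add, Nat.cast_one, hb i hi _ ⟨hle, le_rfl⟩]
      rw [mul_div_cancel₀ _ hn'.ne', mul_div_cancel₀ _ hn'.ne', sub_self, zero_mul, add_sub_cancel_left, one_mul]
      exact ⟨(hg i).1, (hg i).2.1⟩
    rw [← pw_trap (by simp [hz]) (by simp [hz])]
    have h3 : |(∫ x in D2, jd (f a) (f b) x) - ∑ i ∈ range n, (dist (z i) (w a) + dist (z (i+1)) (w a)) / 2 *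
        (dist (z (i + 1)) (w b) - dist (z i) (w b))| ≤ 1 / 2 * ∑ i ∈ range n, dist (z i) (z (i + 1)) ^ 2 := by
      rw [hst, ← sum_sub_distrib, mul_sum]
      refine (Finset.abs_sum_le_sum_abs _ _).trans (sum_le_sum fun i hi => ?_)
      have := edge ha hb' (α := (i / n : ℝ)) (β := ((i + 1 : ℕ) / n : ℝ)) (c := n * dist (z i) (z (i + 1)))
        (by gcongr; simp) PP (fun s hs t ht => hE i hi a t ht s hs) (fun s hs t ht => hE i hi b t ht s hs)
      simp only [hf, (hv i hi).1, (hv i hi).2] at this ⊢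
      refine this.trans (le_of_eq ?_)
      push_cast; field_simp; ring
    have h4 : |∫ x in D2, jd (f a) (f b) x| ≤ ∫ x in D2, |jd (f a) (f b) x| := abs_integral_le_integral_abs
    have h5 := abs_sub_abs_le_abs_sub (∑ i ∈ range n, (dist (z i) (w a) + dist (z (i+1)) (w a)) / 2 *
        (dist (z (i + 1)) (w b) - dist (z i) (w b))) (∫ x in D2, jd (f a) (f b) x)
    grind
  have h6 : ∫ x in D2, π / 2 * ∑ i ∈ range N, ∑ j ∈ range N, l i * l j * |jd (f i) (f j) x| ≤
      ∫ x in D2, jac2 (mder φ x) := by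
    refine integral_mono_ae ?_ (jac_int hφ) (comass_ae' hφ f hF l0 l1)
    exact (integrable_finsetSum _ fun i _ => integrable_finsetSum _ fun j _ => ((hL i).jd_int (hL j)).abs.const_mul _).const_mul _
  rw [integral_const_mul, integral_finsetSum _ (fun i _ => integrable_finsetSum _ fun j _ => ((hL i).jd_int (hL j)).abs.const_mul _)] at h6
  simp_rw [integral_finsetSum (range N) (fun j _ => ((hL _).jd_int (hL j)).abs.const_mul _), integral_const_mul] at h6
  set S := ∑ i ∈ range n, dist (z i) (z (i + 1)) ^ 2 with hS
  have hS0 : 0 ≤ S := sum_nonneg fun i _ => by positivity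
  have h7 : ∑ a ∈ range N, ∑ b ∈ range N, l a * l b *
      |pw n (fun i => dist (z i) (w a)) (fun i => dist (z i) (w b))| ≤
      (∑ a ∈ range N, ∑ b ∈ range N, l a * l b * ∫ x in D2, |jd (f a) (f b) x|) + 1 / 2 * S := by
    have e : 1 / 2 * S = ∑ a ∈ range N, ∑ b ∈ range N, l a * l b * (1 / 2 * S) := by
      simp_rw [← sum_mul, ← mul_sum, l1, mul_one]
      rw [l1, one_mul]
    rw [e, ← sum_add_distrib]
    refine sum_le_sum fun a _ => ?_
    rw [← sum_add_distrib]
    refine sum_le_sum fun b _ => ?_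
    rw [← mul_add]
    exact mul_le_mul_of_nonneg_left (main a b) (mul_nonneg (l0 a) (l0 b))
  have hp := pi_pos
  nlinarith

section
variable {X : Type u} [MetricSpace X]

lemma seqA (hX : GeodesicSpace X) {ε s₀ : ℝ} (h : Iso X ε s₀) (h0 : 0 < ε) (nh : ¬ GromovHyperbolic X) :
    ∃ κ > 0, ∃ L ≥ 1, ∀ n : ℕ, ∃ r > 0, (n : ℝ) ≤ r ∧ ∃ (A : Set RR) (ψ : RR → X), A ⊆ closedBall 0 1 ∧
      ofReal κ ≤ volume A ∧ ∀ y ∈ A, ∀ y' ∈ A, dist y y' ≤ dist (ψ y) (ψ y') / r ∧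
        dist (ψ y) (ψ y') / r ≤ L * dist y y' + 1 / (n + 1 : ℝ) := by
  obtain ⟨N, hN⟩ := exists_nat_ge (512 * 576 ^ 2 : ℝ)
  have hB := tB_one
  set L : ℝ := 512000 * tB * 576 ^ 2 with hL
  have L1 : 1 ≤ L := by rw [hL]; nlinarith
  refine ⟨1 / (128 * (N ^ 2 + 1)), by positivity, L, L1, fun n => ?_⟩
  set θ : ℝ := min (1 / 4) (min (1 / (64 * (N + 1))) (1 / ((n + 1) * ((2 * N + 1) * (16 * L))))) with hθ
  have t0 : 0 < θ := by simp only [hθ, lt_min_iff]; refine ⟨by norm_num, by positivity, by positivity⟩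
  have t1 : θ ≤ 1 / 4 := min_le_left _ _
  have t2 : θ ≤ 1 / (64 * (N + 1)) := (min_le_right _ _).trans (min_le_left _ _)
  have t3 : θ ≤ 1 / ((n + 1) * ((2 * N + 1) * (16 * L))) := (min_le_right _ _).trans (min_le_right _ _)
  obtain ⟨D, hD, φ, f, g, K, s, sB, hA⟩ := fatq hX h h0 nh ((n + 1) * (16 * L) / θ ^ (N ^ 2))
  obtain ⟨j, hj, A, ψ, a1, a2, a3⟩ := propA s sB NN hA hN L1 le_rfl t0 t1 (by
    rw [le_div_iff₀ PP] at t2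
    nlinarith)
  have hp : θ ^ (N ^ 2) ≤ θ ^ j := pow_le_pow_of_le_one t0.le LL hj
  have hr : (n + 1 : ℝ) ≤ θ ^ j * D / (16 * L) := by
    rw [ge_iff_le, div_le_iff₀ PP] at hD
    rw [le_div_iff₀ PP]
    have := s.hD
    nlinarith
  refine ⟨θ ^ j * D / (16 * L), by linarith [n.cast_nonneg (α := ℝ)], by linarith, A, ψ, a1, a2, fun y hy y' hy' =>
    ⟨(a3 y hy y' hy').1, (a3 y hy y' hy').2.trans ?_⟩⟩
  rw [le_div_iff₀ PP] at t3
  rw [add_le_add_iff_left, le_div_iff₀ PP]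
  linarith

lemma limA (hX : GeodesicSpace X) {ε s₀ : ℝ} (h : Iso X ε s₀) (h0 : 0 < ε) (nh : ¬ GromovHyperbolic X) :
    ∃ (K : Set RR) (ρ : RR → RR → ℝ) (L : ℝ), 0 < L ∧ IsClosed K ∧ 0 < volume K ∧
      (∀ x y, ρ x y = ρ y x) ∧ (∀ x y z, ρ x z ≤ ρ x y + ρ y z) ∧ (∀ x, ρ x x = 0) ∧
      (∀ x ∈ K, ∀ y ∈ K, dist x y ≤ ρ x y ∧ ρ x y ≤ L * dist x y) ∧
      ∀ (n : ℕ) (p q : ℕ → RR) (N : ℕ) (l : ℕ → ℝ), 0 < n → p n = p 0 → (∀ i, 0 ≤ l i) → ∑ i ∈ range N, l i = 1 →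
        0 < ∑ i ∈ range n, ρ (p i) (p (i + 1)) →
        π / 2 * ∑ a ∈ range N, ∑ b ∈ range N, l a * l b *
          |pw n (fun i => ρ (p i) (q a)) (fun i => ρ (p i) (q b))| ≤
        (1 - ε) / (4 * π) * (∑ i ∈ range n, ρ (p i) (p (i + 1))) ^ 2 +
        π * ∑ i ∈ range n, ρ (p i) (p (i + 1)) ^ 2 := by
  obtain ⟨κ, hκ, L, hL, hs⟩ := seqA hX h h0 nh
  choose r r0 rn A ψ A1 Av A2 using hs
  set U : Ultrafilter ℕ := Filter.hyperfilter ℕ with hU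
  have Ule : (U : Filter ℕ) ≤ atTop := Nat.hyperfilter_le_atTop
  have hne : ∀ n, (A n).Nonempty := fun n => by
    refine nonempty_of_measure_ne_zero (μ := volume) (ne_of_gt (lt_of_lt_of_le ?_ (Av n))); simpa
  have hex : ∀ n y, ∃ a ∈ A n, dist y a < infDist y (A n) + 1 / (n + 1 : ℝ) := fun n y =>
    (Metric.infDist_lt_iff (hne n)).1 (by have : (0:ℝ) < 1 / (n + 1) := by positivity
                                          linarith)
  choose a aA ad using hex
  set Dm : ℕ → RR → RR → ℝ := fun n y y' => dist (ψ n (a n y)) (ψ n (a n y')) / r n with hDm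
  have hbd : ∀ n y y', Dm n y y' ∈ Icc 0 (L * 2 + 1) := fun n y y' => by
    refine ⟨div_nonneg dist_nonneg (r0 n).le, ((A2 n _ (aA n y) _ (aA n y')).2).trans ?_⟩
    have h1 := A1 n (aA n y)
    have h2 := A1 n (aA n y')
    rw [mem_closedBall] at h1 h2
    have h3 := dist_triangle_right (a n y) (a n y') 0
    have h4 : (1:ℝ) / (n + 1) ≤ 1 := by rw [div_le_one PP]; linarith [n.cast_nonneg (α := ℝ)]
    nlinarith
  have hlim : ∀ y y', ∃ ρ, Tendsto (fun n => Dm n y y') U (nhds ρ) := fun y y' => by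
    obtain ⟨x, _, hx⟩ := isCompact_Icc.ultrafilter_le_nhds (U.map fun n => Dm n y y') (s := Icc 0 (L * 2 + 1)) (by
      rw [Filter.le_principal_iff]; exact Filter.mem_map.2 (Filter.univ_mem' fun n => hbd n y y'))
    exact ⟨x, hx⟩
  choose ρ hρ using hlim
  set K : Set RR := {y | Tendsto (fun n => infDist y (A n)) U (nhds 0)} with hK
  have hK' : ∀ y, y ∈ K ↔ ∀ δ > 0, ∀ᶠ n in U, infDist y (A n) < δ := fun y => by
    change Tendsto _ _ _ ↔ _
    rw [Metric.tendsto_nhds]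
    simp only [dist_eq, sub_zero, abs_of_nonneg Metric.infDist_nonneg]
  have Kc : IsClosed K := by
    refine isClosed_of_closure_subset fun y hy => (hK' y).2 fun δ hδ => ?_
    obtain ⟨z, hz, hd⟩ := Metric.mem_closure_iff.1 hy (δ / 2) PP
    filter_upwards [(hK' z).1 hz (δ / 2) PP] with n hn
    have := Metric.infDist_le_infDist_add_dist (s := A n) (x := y) (y := z)
    linarith
  have hinv : Tendsto (fun n : ℕ => 1 / (n + 1 : ℝ)) U (nhds 0) := tendsto_one_div_add_atTop_nhds_zero_nat.mono_left Ule
  have ha : ∀ y ∈ K, Tendsto (fun n => a n y) U (nhds y) := fun y hy => by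
    rw [tendsto_iff_dist_tendsto_zero]
    have := (show Tendsto _ _ _ from hy).add hinv
    rw [add_zero] at this
    refine squeeze_zero (fun _ => dist_nonneg) (fun n => ?_) this
    rw [dist_comm]; exact (ad n y).le
  have Kv : 0 < volume K := by
    by_contra hv
    rw [not_lt, nonpos_iff_eq_zero] at hv
    obtain ⟨V, hKV, Vo, hV⟩ := K.exists_isOpen_lt_of_lt (μ := volume) (ofReal κ) (by rw [hv]; simpa)
    have hcp : IsCompact (closedBall (0 : RR) 1 \ V) := (isCompact_closedBall _ _).diff Vo
    have hev : ∀ y ∈ closedBall (0 : RR) 1 \ V, ∃ δ > 0, ∀ᶠ n in U, δ ≤ infDist y (A n) := fun y hy => by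
      have : y ∉ K := fun hk => hy.2 (hKV hk)
      rw [hK'] at this
      push Not at this
      grind
    choose! δ hδ hh using hev
    obtain ⟨t, ht, hcov⟩ := hcp.elim_nhds_subcover (fun y => ball y (δ y)) (fun y hy => Metric.ball_mem_nhds _ (hδ y hy))
    have : ∀ᶠ n in U, ∀ y ∈ t, δ y ≤ infDist y (A n) := (Filter.eventually_all_finset t).2 fun y hy => hh y (ht y hy)
    obtain ⟨n, hn⟩ := this.exists
    have hsub : A n ⊆ V := fun z hz => by
      by_contra hzV
      obtain ⟨y, hy, hzy⟩ := Set.mem_iUnion₂.1 (hcov ⟨A1 n hz, hzV⟩)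
      have := Metric.infDist_le_dist_of_mem (x := y) hz
      rw [Metric.mem_ball, dist_comm] at hzy
      linarith [hn y hy]
    exact absurd ((Av n).trans (measure_mono hsub)) (not_le.2 hV)
  refine ⟨K, ρ, L, by linarith, Kc, Kv, fun x y => ?_, fun x y z => ?_, fun x => ?_, fun x hx y hy => ⟨?_, ?_⟩, ?_⟩
  · refine tendsto_nhds_unique (hρ x y) ?_
    simpa only [hDm, dist_comm] using hρ y x
  · refine le_of_tendsto_of_tendsto' (hρ x z) ((hρ x y).add (hρ y z)) fun n => ?_
    simp only [hDm]
    rw [← add_div]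
    exact div_le_div_of_nonneg_right (dist_triangle _ _ _) (r0 n).le
  · refine tendsto_nhds_unique (hρ x x) ?_
    simp [hDm]
  · exact le_of_tendsto_of_tendsto' ((ha x hx).dist (ha y hy)) (hρ x y) fun n => (A2 n _ (aA n x) _ (aA n y)).1
  · have := (((ha x hx).dist (ha y hy)).const_mul L).add hinv
    rw [add_zero] at this
    exact le_of_tendsto_of_tendsto' (hρ x y) this fun n => (A2 n _ (aA n x) _ (aA n y)).2
  intro n p q N l hn hp l0 l1 hS
  have hsum : Tendsto (fun m => ∑ i ∈ range n, Dm m (p i) (p (i + 1))) U (nhds (∑ i ∈ range n, ρ (p i) (p (i + 1)))) :=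
    tendsto_finsetSum _ fun i _ => hρ _ _
  refine le_of_tendsto_of_tendsto (b := (U : Filter ℕ))
    (f := fun m => π / 2 * ∑ a ∈ range N, ∑ b ∈ range N, l a * l b *
          |pw n (fun i => Dm m (p i) (q a)) (fun i => Dm m (p i) (q b))|)
    (g := fun m => (1 - ε) / (4 * π) * (∑ i ∈ range n, Dm m (p i) (p (i + 1))) ^ 2 +
        π * ∑ i ∈ range n, Dm m (p i) (p (i + 1)) ^ 2) ?_ ?_ ?_
  · refine (tendsto_finsetSum _ fun a _ => tendsto_finsetSum _ fun b _ => (Tendsto.abs ?_).const_mul _).const_mul _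
    exact (tendsto_finsetSum _ fun i _ => ((hρ _ _).mul (hρ _ _)).sub ((hρ _ _).mul (hρ _ _))).const_mul _
  · exact ((hsum.pow 2).const_mul _).add ((tendsto_finsetSum _ fun i _ => (hρ _ _).pow 2).const_mul _)
  · set S := ∑ i ∈ range n, ρ (p i) (p (i + 1)) with hSd
    have e1 : ∀ᶠ m in U, S / 2 < ∑ i ∈ range n, Dm m (p i) (p (i + 1)) := hsum.eventually_const_lt LL
    have e2 : ∀ᶠ m : ℕ in U, 2 * s₀ / S ≤ m := Ule (tendsto_natCast_atTop_atTop.eventually_ge_atTop _)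
    filter_upwards [e1, e2] with m h1 h2
    have rm := r0 m
    have e : ∀ x y, dist (ψ m (a m x)) (ψ m (a m y)) = r m * Dm m x y := fun x y => by simp only [hDm]; field_simp
    have key := lemF hX h hn (fun i => ψ m (a m (p i))) (by simp [hp]) ?_ (fun b => ψ m (a m (q b))) l0 l1
    · simp only [e] at key
      have epw : ∀ a b, |pw n (fun i => r m * Dm m (p i) (q a)) (fun i => r m * Dm m (p i) (q b))| =
          r m ^ 2 * |pw n (fun i => Dm m (p i) (q a)) (fun i => Dm m (p i) (q b))| := fun a b => by
        rw [← abs_of_nonneg (sq_nonneg (r m)), ← abs_mul]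
        congr 1
        simp only [pw, mul_sum]
        exact sum_congr rfl fun i _ => by ring
      have es : ∀ a b, l a * l b * (r m ^ 2 * |pw n (fun i => Dm m (p i) (q a)) (fun i => Dm m (p i) (q b))|) =
        r m ^ 2 * (l a * l b * |pw n (fun i => Dm m (p i) (q a)) (fun i => Dm m (p i) (q b))|) := fun a b => by ring
      simp only [epw, es, mul_pow, ← mul_sum] at key
      have r2 : 0 < r m ^ 2 := by positivity
      nlinarith
    · simp only [e, ← mul_sum]
      have h3 := rn m
      rw [div_le_iff₀ hS] at h2
      nlinarith
end

def LP (f : RR → ℝ) (y : RR) : Prop := ∀ R > 0, ∀ η > 0, ∀ᶠ t in nhdsWithin (0:ℝ) (Ioi 0),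
  ∫⁻ x in closedBall y (R * t), ‖f x - f y‖ₑ ≤ ofReal (η * t ^ 2)

lemma LP_ae {f : RR → ℝ} (hf : Measurable f) {C : ℝ} (hC : ∀ x, |f x| ≤ C) : ∀ᵐ y, LP f y := by
  have hl : LocallyIntegrable f := (locallyIntegrable_const C).mono hf.aestronglyMeasurable (ae_of_all _ fun x => by
    rw [norm_eq_abs, norm_eq_abs]; exact (hC x).trans (le_abs_self _))
  filter_upwards [(IsUnifLocDoublingMeasure.vitaliFamily volume (1:ℝ)).ae_tendsto_lintegral_enorm_sub_div hl] with y hy R hR η hη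
  have ht : Tendsto (fun t : ℝ => R * t) (nhdsWithin 0 (Ioi 0)) (nhdsWithin 0 (Ioi 0)) := by
    refine tendsto_nhdsWithin_iff.2 ⟨?_, ?_⟩
    · have : Tendsto (fun t : ℝ => R * t) (nhds 0) (nhds (R * 0)) := tendsto_id.const_mul R
      rw [mul_zero] at this
      exact this.mono_left nhdsWithin_le_nhds
    · filter_upwards [self_mem_nhdsWithin] with t ht using mul_pos hR ht
  have h1 := hy.comp (IsUnifLocDoublingMeasure.tendsto_closedBall_filterAt (K := 1) volume (x := y) (fun _ => y) (fun t : ℝ => R * t) ht (by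
    filter_upwards [self_mem_nhdsWithin] with t ht'
    have : 0 < R * t := mul_pos hR ht'
    exact Metric.mem_closedBall_self LL))
  rw [ENNReal.tendsto_nhds_zero] at h1
  filter_upwards [h1 (ofReal (η / (4 * R ^ 2))) (by simp; positivity), self_mem_nhdsWithin] with t h2 ht'
  have t0 : 0 < t := ht'
  have p : 0 < R * t := mul_pos hR t0
  simp only [Function.comp] at h2
  rw [cb_vol y p.le, ENNReal.div_le_iff (ofReal_pos.2 PP).ne' ofReal_ne_top, ← ofReal_mul PP] at h2
  convert h2 using 2
  field_simp

lemma line_bd {Ψ : RR → ℝ} {L : ℝ≥0} (hΨ : LipschitzWith L Ψ) (z b : RR) {T : ℝ} (hT : 0 ≤ T) :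
    ofReal |Ψ (z + T • b) - Ψ z| ≤ ∫⁻ τ in Ioc 0 T, ‖lineDeriv ℝ Ψ (z + τ • b) b‖ₑ := by
  have hl : LipschitzWith (L * ‖b‖₊) fun τ : ℝ => Ψ (z + τ • b) := by
    refine hΨ.comp (LipschitzWith.of_dist_le_mul fun s t => ?_)
    rw [dist_add_left, dist_eq_norm, ← sub_smul, norm_smul, dist_eq, mul_comm]; rfl
  have hd : ∀ τ, deriv (fun τ : ℝ => Ψ (z + τ • b)) τ = lineDeriv ℝ Ψ (z + τ • b) b := fun τ => by
    have := deriv_comp_const_add (fun τ : ℝ => Ψ (z + τ • b)) τ 0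
    rw [add_zero] at this
    rw [← this, lineDeriv]
    congr 1; ext s; rw [add_smul, add_assoc]
  have := (hl.lipschitzOnWith (s := uIcc 0 T)).absolutelyContinuousOnInterval.integral_deriv_eq_sub
  rw [zero_smul, add_zero] at this
  rw [← this, intervalIntegral.integral_of_le hT, ← norm_eq_abs, ofReal_norm]
  simp_rw [hd]
  exact enorm_integral_le_lintegral_enorm _

variable {Ψ : ℕ → RR → ℝ} {L : ℝ≥0}

noncomputable def mm (Ψ : ℕ → RR → ℝ) (b x : RR) : ℝ := ⨆ j, |lineDeriv ℝ (Ψ j) x b|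

lemma mm_bdd (hΨ : ∀ j, LipschitzWith L (Ψ j)) (b x : RR) : BddAbove (Set.range fun j => |lineDeriv ℝ (Ψ j) x b|) :=
  ⟨L * ‖b‖, by rintro _ ⟨j, rfl⟩; exact norm_lineDeriv_le_of_lipschitz ℝ (hΨ j)⟩
lemma le_mm (hΨ : ∀ j, LipschitzWith L (Ψ j)) (b x : RR) (j : ℕ) : |lineDeriv ℝ (Ψ j) x b| ≤ mm Ψ b x :=
  le_ciSup (mm_bdd hΨ b x) j
lemma mm_le (hΨ : ∀ j, LipschitzWith L (Ψ j)) (b x : RR) : mm Ψ b x ≤ L * ‖b‖ :=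
  ciSup_le fun j => norm_lineDeriv_le_of_lipschitz ℝ (hΨ j)
lemma mm_nonneg (b x : RR) : 0 ≤ mm Ψ b x := Real.iSup_nonneg fun _ => abs_nonneg _
lemma mm_meas (hΨ : ∀ j, LipschitzWith L (Ψ j)) (b : RR) : Measurable (mm Ψ b) :=
  Measurable.iSup fun j => continuous_abs.measurable.comp (measurable_lineDeriv (hΨ j).continuous)

lemma seg (hΨ : ∀ j, LipschitzWith L (Ψ j)) {b y0 : RR} (h : LP (mm Ψ b) y0) (P : RR) {c η : ℝ} (hc : 0 ≤ c) (hη : 0 < η) :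
    ∀ᶠ t in nhdsWithin (0:ℝ) (Ioi 0), ∀ j p p', dist p (y0 + t • P) ≤ η * t → dist p' (y0 + t • (P + c • b)) ≤ η * t →
      |Ψ j p - Ψ j p'| ≤ t * (c * mm Ψ b y0 + (c + 4 * L) * η) := by
  set R := ‖P‖ + η + c * ‖b‖ with hR
  have R0 : 0 < R := by positivity
  filter_upwards [h R R0 (4 * η ^ 2 * η) PP, self_mem_nhdsWithin] with t h1 ht
  have t0 : 0 < t := ht
  set m := mm Ψ b with hm
  set e : RR → ℝ≥0∞ := fun x => ‖m x - m y0‖ₑ with he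
  have em : Measurable e := ((mm_meas hΨ b).sub_const _).enorm
  set T := c * t with hT
  have T0 : 0 ≤ T := by positivity
  set B := closedBall (y0 + t • P) (η * t) with hB
  have Bv : volume B = ofReal (4 * (η * t) ^ 2) := cb_vol _ PP
  have tr : ∀ τ ∈ Ioc 0 T, ∫⁻ z in B, e (z + τ • b) ≤ ofReal (4 * η ^ 2 * η * t ^ 2) := fun τ hτ => by
    refine le_trans ?_ h1
    rw [← lintegral_indicator isClosed_closedBall.measurableSet, ← lintegral_indicator isClosed_closedBall.measurableSet,
      ← lintegral_add_right_eq_self ((closedBall y0 (R * t)).indicator e) (τ • b)]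
    refine lintegral_mono fun z => ?_
    by_cases hz : z ∈ B
    swap; · rw [indicator_of_notMem hz]; exact zero_le
    rw [indicator_of_mem hz]
    rw [indicator_of_mem]
    rw [mem_closedBall, dist_eq_norm] at hz ⊢
    have e1 : z + τ • b - y0 = (z - (y0 + t • P)) + t • P + τ • b := by abel
    rw [e1]
    refine (norm_add₃_le).trans ?_
    rw [norm_smul, norm_smul, norm_of_nonneg t0.le, norm_of_nonneg hτ.1.le]
    have := mul_le_mul_of_nonneg_right hτ.2 (norm_nonneg b)
    linarith
  have hmeas : Measurable (Function.uncurry fun (z : RR) (τ : ℝ) => e (z + τ • b)) := em.comp FP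
  have hI : ∫⁻ z in B, ∫⁻ τ in Ioc 0 T, e (z + τ • b) ≤ ofReal (T * η) * volume B := by
    rw [lintegral_lintegral_swap hmeas.aemeasurable]
    refine (setLIntegral_mono measurable_const tr).trans ?_
    rw [lintegral_const, Measure.restrict_apply_univ, Real.volume_Ioc, Bv, ← ofReal_mul PP, ← ofReal_mul PP]
    grind
  have Bn : volume B ≠ 0 := by rw [Bv]; exact (ofReal_pos.2 PP).ne'
  have Bt : volume B ≠ ⊤ := by rw [Bv]; exact ofReal_ne_top
  obtain ⟨z, hz, hE⟩ := exists_le_setLAverage Bn Bt (Measurable.lintegral_prod_right (ν := volume.restrict (Ioc 0 T)) hmeas).aemeasurable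
  rw [setLAverage_eq] at hE
  replace hE := hE.trans (ENNReal.div_le_of_le_mul hI)
  intro j p p' hp hp'
  have h2 := line_bd (hΨ j) z b T0
  have h3 : ∫⁻ τ in Ioc 0 T, ‖lineDeriv ℝ (Ψ j) (z + τ • b) b‖ₑ ≤ ofReal (T * m y0 + T * η) := by
    calc _ ≤ ∫⁻ τ in Ioc 0 T, (ofReal (m y0) + e (z + τ • b)) := by
          refine lintegral_mono fun τ => ?_
          rw [← ofReal_norm, he]
          simp only
          rw [← ofReal_norm, ← ofReal_add (mm_nonneg _ _) (norm_nonneg _)]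
          refine ofReal_le_ofReal ((le_mm hΨ b _ j).trans ?_)
          have := le_abs_self (m (z + τ • b) - m y0)
          rw [norm_eq_abs]; linarith
      _ ≤ _ := by
          rw [lintegral_add_left measurable_const, lintegral_const, Measure.restrict_apply_univ, Real.volume_Ioc,
            ← ofReal_mul (mm_nonneg _ _), ofReal_add (mul_nonneg T0 (mm_nonneg _ _)) PP]
          refine add_le_add (le_of_eq (by rw [sub_zero, mul_comm])) hE
  have h4 := (ofReal_le_ofReal_iff (by have := mul_nonneg T0 (mm_nonneg (Ψ := Ψ) b y0); positivity)).1 (h2.trans h3)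
  have h5 := (hΨ j).dist_le_mul p z
  have h6 := (hΨ j).dist_le_mul (z + T • b) p'
  rw [mem_closedBall] at hz
  have h7 : dist p z ≤ 2 * η * t := by linarith [dist_triangle_right p z (y0 + t • P)]
  have h8 : dist (z + T • b) p' ≤ 2 * η * t := by
    have e1 : dist (z + T • b) (y0 + t • (P + c • b)) = dist z (y0 + t • P) := by
      rw [smul_add, smul_smul, ← add_assoc, mul_comm t c, dist_add_right]
    linarith [dist_triangle_right (z + T • b) p' (y0 + t • (P + c • b))]
  rw [dist_eq] at h5 h6
  have h9 : |Ψ j p - Ψ j p'| ≤ |Ψ j p - Ψ j z| + |Ψ j (z + T • b) - Ψ j z| + |Ψ j (z + T • b) - Ψ j p'| := by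
    grind
  nlinarith

lemma dens {K : Set RR} {y0 : RR} (hy : y0 ∈ K) (h : LP (K.indicator 1) y0) (P : RR) {η : ℝ} (hη : 0 < η) :
    ∀ᶠ t in nhdsWithin (0:ℝ) (Ioi 0), ∃ p ∈ K, dist p (y0 + t • P) ≤ η * t := by
  filter_upwards [h (‖P‖ + η) PP (2 * η ^ 2) PP, self_mem_nhdsWithin] with t h1 ht
  have t0 : 0 < t := ht
  by_contra! hn
  have h2 : volume (closedBall (y0 + t • P) (η * t)) ≤ ∫⁻ x in closedBall y0 ((‖P‖ + η) * t), ‖K.indicator 1 x - K.indicator (1 : RR → ℝ) y0‖ₑ := by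
    rw [← setLIntegral_one, ← lintegral_indicator isClosed_closedBall.measurableSet, ← lintegral_indicator isClosed_closedBall.measurableSet]
    refine lintegral_mono fun z => Set.indicator_apply_le fun hz => ?_
    have hzK : z ∉ K := fun hk => by
      have := hn z hk
      rw [mem_closedBall] at hz; linarith
    rw [indicator_of_mem, indicator_of_notMem hzK, indicator_of_mem hy]
    · simp
    rw [mem_closedBall] at hz ⊢
    have := dist_triangle z (y0 + t • P) y0
    rw [dist_self_add_left, norm_smul, norm_of_nonneg t0.le] at this
    linarith
  rw [cb_vol _ PP] at h2
  have := (ofReal_le_ofReal_iff PP).1 (h2.trans h1)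
  have : 0 < η ^ 2 * t ^ 2 := by positivity
  nlinarith

lemma dif {F : RR → ℝ} (hF : LipschitzWith L F) {y0 : RR} (h : DifferentiableAt ℝ F y0) (P : RR) {η : ℝ} (hη : 0 < η) :
    ∀ᶠ t in nhdsWithin (0:ℝ) (Ioi 0), ∀ p, dist p (y0 + t • P) ≤ η * t → |F p - F y0 - t * lineDeriv ℝ F y0 P| ≤ (L + 1) * η * t := by
  have h1 : HasDerivAt (fun t : ℝ => F (y0 + t • P)) (lineDeriv ℝ F y0 P) 0 := h.lineDifferentiableAt.hasLineDerivAt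
  have h2 := (hasDerivAt_iff_isLittleO.1 h1).def hη
  filter_upwards [h2.filter_mono nhdsWithin_le_nhds, self_mem_nhdsWithin] with t h3 ht p hp
  have t0 : 0 < t := ht
  simp only [sub_zero, zero_smul, add_zero, smul_eq_mul, norm_eq_abs, abs_of_pos t0] at h3
  have h4 := hF.dist_le_mul p (y0 + t • P)
  rw [dist_eq] at h4
  have : F p - F y0 - t * lineDeriv ℝ F y0 P = (F p - F (y0 + t • P)) + (F (y0 + t • P) - F y0 - t * lineDeriv ℝ F y0 P) := by ring
  rw [this]
  refine (abs_add_le _ _).trans ?_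
  nlinarith

def ip (a v : RR) : ℝ := a.1 * v.1 + a.2 * v.2

lemma pw_aff {n : ℕ} {x y : ℕ → ℝ} (hx : x n = x 0) (hy : y n = y 0) (α β t : ℝ) :
    pw n (fun i => α + t * x i) (fun i => β + t * y i) = t ^ 2 * pw n x y := by
  have h1 := sum_range_sub x n
  have h2 := sum_range_sub y n
  rw [hx, sub_self] at h1
  rw [hy, sub_self] at h2
  have : ∑ i ∈ range n, ((α + t * x i) * (β + t * y (i + 1)) - (α + t * x (i + 1)) * (β + t * y i)) =
     ∑ i ∈ range n, (t ^ 2 * (x i * y (i + 1) - x (i + 1) * y i) + (α * t * (y (i + 1) - y i) - β * t * (x (i + 1) - x i))) :=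
    sum_congr rfl fun i _ => by ring
  simp only [pw]
  rw [this, sum_add_distrib, sum_sub_distrib, ← mul_sum, ← mul_sum, ← mul_sum, h1, h2]; ring

lemma pw_congr {n : ℕ} {x y x' y' : ℕ → ℝ} (hx : ∀ i ≤ n, x i = x' i) (hy : ∀ i ≤ n, y i = y' i) : pw n x y = pw n x' y' := by
  simp only [pw]
  congr 1
  refine sum_congr rfl fun i hi => ?_
  grind

lemma pw_ip (n : ℕ) (a b : RR) (P : ℕ → RR) : pw n (fun i => ip a (P i)) (fun i => ip b (P i)) =
    wd a b * (1 / 2 * ∑ i ∈ range n, wd (P i) (P (i + 1))) := by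
  simp only [pw, mul_sum]
  refine sum_congr rfl fun i _ => ?_
  simp only [ip, wd]; ring

lemma blow {K : Set RR} {ρ : RR → RR → ℝ} {L ε : ℝ} (L0 : 0 < L) (he : ε ≤ 1) (hK : IsClosed K) (hv : 0 < volume K)
    (rs : ∀ x y, ρ x y = ρ y x) (rt : ∀ x y z, ρ x z ≤ ρ x y + ρ y z)
    (rb : ∀ x ∈ K, ∀ y ∈ K, dist x y ≤ ρ x y ∧ ρ x y ≤ L * dist x y)
    (F : ∀ (n : ℕ) (p q : ℕ → RR) (N : ℕ) (l : ℕ → ℝ), 0 < n → p n = p 0 → (∀ i, 0 ≤ l i) → ∑ i ∈ range N, l i = 1 →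
        0 < ∑ i ∈ range n, ρ (p i) (p (i + 1)) →
        π / 2 * ∑ a ∈ range N, ∑ b ∈ range N, l a * l b *
          |pw n (fun i => ρ (p i) (q a)) (fun i => ρ (p i) (q b))| ≤
        (1 - ε) / (4 * π) * (∑ i ∈ range n, ρ (p i) (p (i + 1))) ^ 2 +
        π * ∑ i ∈ range n, ρ (p i) (p (i + 1)) ^ 2) (b : ℕ → RR) :
    ∃ (a : ℕ → RR) (s : RR → ℝ), (∀ j v, |ip (a j) v| ≤ s v) ∧ (∀ v B, (∀ j, |ip (a j) v| ≤ B) → s v ≤ B) ∧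
      (∀ v, s v ≤ L * ‖v‖) ∧ (∀ k, ‖b k‖ ≤ s (b k)) ∧
      ∀ (n : ℕ) (P : ℕ → RR) (c : ℕ → ℝ) (k : ℕ → ℕ) (N : ℕ) (l : ℕ → ℝ), 0 < n → P n = P 0 →
        (∀ i < n, 0 ≤ c i ∧ P (i + 1) = P i + c i • b (k i)) → (∀ i, 0 ≤ l i) → ∑ i ∈ range N, l i = 1 →
        π / 2 * (qf a l N * |1 / 2 * ∑ i ∈ range n, wd (P i) (P (i + 1))|) ≤
        (1 - ε) / (4 * π) * (∑ i ∈ range n, c i * s (b (k i))) ^ 2 +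
        π * ∑ i ∈ range n, (c i * s (b (k i))) ^ 2 := by
  have Kne : K.Nonempty := nonempty_of_measure_ne_zero hv.ne'
  have : Nonempty K := Kne.to_subtype
  obtain ⟨q, hq⟩ := TopologicalSpace.exists_dense_seq K
  set L' : ℝ≥0 := ⟨L, L0.le⟩ with hL'
  have hLL : (L' : ℝ) = L := rfl
  have hex : ∀ j, ∃ g, LipschitzWith L' g ∧ EqOn (fun x => ρ x (q j)) g K := fun j => by
    refine LipschitzOnWith.extend_real (LipschitzOnWith.of_dist_le_mul fun x hx y hy => ?_)
    rw [dist_eq, hLL]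
    refine le_trans ?_ (rb x hx y hy).2
    rw [abs_le]
    constructor
    · linarith [rt y x (q j), rs x y]
    · linarith [rt x y (q j)]
  choose Ψ hΨ hΨK using hex
  have rho_le : ∀ x ∈ K, ∀ y ∈ K, ∀ B, (∀ j, |Ψ j x - Ψ j y| ≤ B) → ρ x y ≤ B := by
    intro x hx y hy B hB
    refine le_of_forall_pos_le_add fun δ hδ => ?_
    obtain ⟨j, hj⟩ := hq.exists_dist_lt ⟨x, hx⟩ (ε := δ / (2 * L)) PP
    have h1 := (rb x hx (q j) (q j).2).2
    have h2 : L * dist x (q j) ≤ δ / 2 := by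
      have : dist x (q j) < δ / (2 * L) := hj
      rw [lt_div_iff₀ PP] at this; linarith
    have h3 := abs_le.1 (hB j)
    rw [← hΨK j hx, ← hΨK j hy] at h3
    linarith [rt x (q j) y, rs (q j) y, h3.1]
  have hae : ∀ᵐ y : RR, LP (K.indicator 1) y ∧ (∀ k, LP (mm Ψ (b k)) y) ∧ ∀ j, DifferentiableAt ℝ (Ψ j) y := by
    refine (LP_ae (measurable_one.indicator hK.measurableSet) (C := 1) fun x => ?_).and ((ae_all_iff.2 fun k => ?_).and (ae_all_iff.2 fun j => (hΨ j).ae_differentiableAt))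
    · by_cases hx : x ∈ K <;> simp [hx]
    · exact LP_ae (mm_meas hΨ _) (C := L * ‖b k‖) fun x => by rw [abs_of_nonneg (mm_nonneg _ _)]; exact mm_le hΨ _ _
  obtain ⟨y0, yK, lpK, lpb, hd⟩ := ((frequently_ae_mem_iff.2 hv.ne').and_eventually hae).exists
  have hgr : ∀ j v, lineDeriv ℝ (Ψ j) y0 v = ip (grad (Ψ j) y0) v := fun j v => by
    rw [(hd j).lineDeriv_eq_fderiv, fderiv_grad, ip]; ring
  have F' : ∀ (n : ℕ) (p : ℕ → RR) (N : ℕ) (l : ℕ → ℝ), 0 < n → p n = p 0 → (∀ i ≤ n, p i ∈ K) → (∀ i, 0 ≤ l i) → ∑ i ∈ range N, l i = 1 →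
        π / 2 * ∑ a ∈ range N, ∑ b ∈ range N, l a * l b *
          |pw n (fun i => ρ (p i) (q a)) (fun i => ρ (p i) (q b))| ≤
        (1 - ε) / (4 * π) * (∑ i ∈ range n, ρ (p i) (p (i + 1))) ^ 2 +
        π * ∑ i ∈ range n, ρ (p i) (p (i + 1)) ^ 2 := by
    intro n p N l hn hp pK l0 l1
    have r0 : ∀ i ∈ range n, dist (p i) (p (i + 1)) ≤ ρ (p i) (p (i + 1)) := fun i hi => by
      grind
    rcases (sum_nonneg fun i hi => dist_nonneg.trans (r0 i hi)).eq_or_lt with h0 | h0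
    · have h1 := (Finset.sum_eq_zero_iff_of_nonneg fun i hi => dist_nonneg.trans (r0 i hi)).1 h0.symm
      have h2 : ∀ i ∈ range n, p i = p (i + 1) := fun i hi => by
        have := r0 i hi
        rw [h1 i hi] at this
        exact dist_le_zero.1 this
      have h3 : ∀ a b, pw n (fun i => ρ (p i) (q a)) (fun i => ρ (p i) (q b)) = 0 := fun a b => by
        rw [pw, sum_eq_zero, mul_zero]
        grind
      rw [← h0, sum_eq_zero (s := range n) fun i hi => by rw [h1 i hi]; ring]
      simp [h3]
    · simp_all
  refine ⟨fun j => grad (Ψ j) y0, fun v => mm Ψ v y0, fun j v => ?_, fun v B hB => ?_, fun v => mm_le hΨ v y0, fun k => ?_, ?_⟩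
  · rw [← hgr]; exact le_mm hΨ v y0 j
  · exact ciSup_le fun j => by rw [hgr]; exact hB j
  · refine le_of_forall_pos_le_add fun δ hδ => ?_
    set η := δ / (2 + 4 * L) with hη
    have η0 : 0 < η := by positivity
    obtain ⟨t, ⟨p, pK, hp⟩, h2, ht⟩ := ((dens yK lpK (b k) η0).and ((seg hΨ (lpb k) 0 zero_le_one η0).and self_mem_nhdsWithin)).exists
    have t0 : 0 < t := ht
    have h3 := rho_le y0 yK p pK _ fun j => h2 j y0 p (by rw [smul_zero, add_zero, dist_self]; positivity) (by rwa [zero_add, one_smul])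
    have h4 := (rb y0 yK p pK).1
    have h5 := dist_triangle_left y0 (y0 + t • b k) p
    rw [dist_self_add_right, norm_smul, norm_of_nonneg t0.le, dist_comm p y0] at h5
    rw [hLL] at h3
    have h6 : t * ‖b k‖ ≤ t * (mm Ψ (b k) y0 + (2 + 4 * L) * η) := by nlinarith
    have h7 := le_of_mul_le_mul_left h6 t0
    have h8 : (2 + 4 * L) * η = δ := by rw [hη]; field_simp
    linarith
  intro n P c k N l hn hP hc l0 l1
  have step : ∀ η > 0, ∃ x : ℕ → ℕ → ℝ, (∀ a ∈ range N, ∀ i ≤ n, |x a i - ip (grad (Ψ a) y0) (P i)| ≤ (L + 1) * η) ∧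
      π / 2 * ∑ a ∈ range N, ∑ b ∈ range N, l a * l b * |pw n (x a) (x b)| ≤
        (1 - ε) / (4 * π) * (∑ i ∈ range n, (c i * mm Ψ (b (k i)) y0 + (c i + 4 * L) * η)) ^ 2 +
        π * ∑ i ∈ range n, (c i * mm Ψ (b (k i)) y0 + (c i + 4 * L) * η) ^ 2 := by
    intro η η0
    have E1 := (eventually_all_finset (range (n + 1))).2 fun i _ => dens yK lpK (P i) η0
    have E2 := (eventually_all_finset (range n)).2 fun i hi => seg hΨ (lpb (k i)) (P i) (hc i (mem_range.1 hi)).1 η0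
    have E3 := (eventually_all_finset (range N)).2 fun a _ => (eventually_all_finset (range (n + 1))).2 fun i _ => dif (hΨ a) (hd a) (P i) η0
    obtain ⟨t, e1, e2, e3, ht⟩ := (E1.and (E2.and (E3.and self_mem_nhdsWithin))).exists
    have t0 : 0 < t := ht
    choose! p' pK' pd' using e1
    set p : ℕ → RR := fun i => if i = n then p' 0 else p' i with hp
    have hpn : p n = p 0 := by simp [hp]
    have pp : ∀ i ≤ n, p i ∈ K ∧ dist (p i) (y0 + t • P i) ≤ η * t := fun i hi => by
      by_cases h : i = n
      · have : p i = p' 0 := by simp [hp, h]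
        rw [this, h, hP]
        exact ⟨pK' 0 SP, pd' 0 SP⟩
      · have : p i = p' i := by simp [hp, h]
        rw [this]
        exact ⟨pK' i (by simp; omega), pd' i (by simp; omega)⟩
    have key := F' n p N l hn hpn (fun i hi => (pp i hi).1) l0 l1
    refine ⟨fun a i => (Ψ a (p i) - Ψ a y0) / t, fun a ha i hi => ?_, ?_⟩
    · have := e3 a ha i (by simp; omega) (p i) (pp i hi).2
      rw [hgr, hLL] at this
      have e : (Ψ a (p i) - Ψ a y0) / t - ip (grad (Ψ a) y0) (P i) = (Ψ a (p i) - Ψ a y0 - t * ip (grad (Ψ a) y0) (P i)) / t := by field_simp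
      rw [e, abs_div, abs_of_pos t0, div_le_iff₀ t0]
      exact this
    have t2 : 0 < t ^ 2 := by positivity
    have epw : ∀ a b, |pw n (fun i => ρ (p i) (q a)) (fun i => ρ (p i) (q b))| =
        t ^ 2 * |pw n (fun i => (Ψ a (p i) - Ψ a y0) / t) (fun i => (Ψ b (p i) - Ψ b y0) / t)| := fun a b => by
      rw [← abs_of_pos t2, ← abs_mul, ← pw_aff (by simp [hpn]) (by simp [hpn]) (Ψ a y0) (Ψ b y0)]
      congr 1
      refine pw_congr (fun i hi => ?_) fun i hi => ?_
      · refine (hΨK a (pp i hi).1).trans ?_; field_simp; ring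
      · refine (hΨK b (pp i hi).1).trans ?_; field_simp; ring
    have er : ∀ i ∈ range n, ρ (p i) (p (i + 1)) ≤ t * (c i * mm Ψ (b (k i)) y0 + (c i + 4 * L) * η) := fun i hi => by
      have hi' := mem_range.1 hi
      refine rho_le _ (pp i hi'.le).1 _ (pp (i + 1) hi').1 _ fun j => e2 i hi j _ _ (pp i hi'.le).2 ?_
      rw [← (hc i hi').2]
      exact (pp (i + 1) hi').2
    have er0 : ∀ i ∈ range n, 0 ≤ ρ (p i) (p (i + 1)) := fun i hi => by
      have hi' := mem_range.1 hi
      exact dist_nonneg.trans (rb _ (pp i hi'.le).1 _ (pp (i + 1) hi').1).1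
    have es : ∀ a b, l a * l b * (t ^ 2 * |pw n (fun i => (Ψ a (p i) - Ψ a y0) / t) (fun i => (Ψ b (p i) - Ψ b y0) / t)|) =
        t ^ 2 * (l a * l b * |pw n (fun i => (Ψ a (p i) - Ψ a y0) / t) (fun i => (Ψ b (p i) - Ψ b y0) / t)|) := fun a b => by ring
    simp only [epw, es, ← mul_sum] at key
    have k1 : (∑ i ∈ range n, ρ (p i) (p (i + 1))) ^ 2 ≤ (∑ i ∈ range n, t * (c i * mm Ψ (b (k i)) y0 + (c i + 4 * L) * η)) ^ 2 :=
      pow_le_pow_left₀ (sum_nonneg er0) (sum_le_sum er) 2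
    have k2 : ∑ i ∈ range n, ρ (p i) (p (i + 1)) ^ 2 ≤ ∑ i ∈ range n, (t * (c i * mm Ψ (b (k i)) y0 + (c i + 4 * L) * η)) ^ 2 :=
      sum_le_sum fun i hi => pow_le_pow_left₀ (er0 i hi) (er i hi) 2
    simp only [mul_pow, ← mul_sum] at k1 k2
    have hp := pi_pos
    have k3 := mul_le_mul_of_nonneg_left k1 (div_nonneg (by linarith : 0 ≤ 1 - ε) (by positivity : 0 ≤ 4 * π))
    nlinarith
  have hη : Tendsto (fun m : ℕ => 1 / ((m : ℝ) + 1)) atTop (nhds 0) := tendsto_one_div_add_atTop_nhds_zero_nat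
  choose x hx hxx using fun m : ℕ => step (1 / ((m : ℝ) + 1)) PP
  have hxl : ∀ a ∈ range N, ∀ i ≤ n, Tendsto (fun m => x m a i) atTop (nhds (ip (grad (Ψ a) y0) (P i))) := fun a ha i hi => by
    rw [tendsto_iff_dist_tendsto_zero]
    have := hη.const_mul (L + 1)
    rw [mul_zero] at this
    exact squeeze_zero (fun _ => dist_nonneg) (fun m => hx m a ha i hi) this
  have hc' : ∀ i, Tendsto (fun m : ℕ => c i * mm Ψ (b (k i)) y0 + (c i + 4 * L) * (1 / ((m : ℝ) + 1))) atTop (nhds (c i * mm Ψ (b (k i)) y0)) := fun i => by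
    have := (hη.const_mul (c i + 4 * L)).const_add (c i * mm Ψ (b (k i)) y0)
    grind
  have lim1 : Tendsto (fun m => π / 2 * ∑ a ∈ range N, ∑ b ∈ range N, l a * l b * |pw n (x m a) (x m b)|) atTop
      (nhds (π / 2 * ∑ a ∈ range N, ∑ b ∈ range N, l a * l b * |pw n (fun i => ip (grad (Ψ a) y0) (P i)) (fun i => ip (grad (Ψ b) y0) (P i))|)) := by
    refine (tendsto_finsetSum _ fun a ha => tendsto_finsetSum _ fun b hb => (Tendsto.abs ?_).const_mul _).const_mul _
    refine (tendsto_finsetSum _ fun i hi => ?_).const_mul _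
    have hi := mem_range.1 hi
    exact ((hxl a ha i hi.le).mul (hxl b hb (i + 1) hi)).sub ((hxl a ha (i + 1) hi).mul (hxl b hb i hi.le))
  have lim2 := (((tendsto_finsetSum (range n) fun i _ => hc' i).pow 2).const_mul ((1 - ε) / (4 * π))).add
    ((tendsto_finsetSum (range n) fun i _ => (hc' i).pow 2).const_mul π)
  refine le_trans (le_of_eq ?_) (le_of_tendsto_of_tendsto' lim1 lim2 hxx)
  congr 1
  rw [qf, sum_mul]
  refine sum_congr rfl fun a _ => ?_
  rw [sum_mul]
  refine sum_congr rfl fun b _ => ?_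
  rw [pw_ip, abs_mul (wd _ _), mul_assoc]

lemma sum_rm (n H : ℕ) (f : ℕ → ℝ) : ∑ i ∈ range (n * H), f i = ∑ r ∈ range n, ∑ h ∈ range H, f (r * H + h) := by
  induction n with
  | zero => simp
  | succ n ih => rw [Nat.succ_mul, sum_range_add, ih, sum_range_succ]

lemma F2 {a b : ℕ → RR} {s : RR → ℝ} {ε : ℝ} (sn : ∀ v, s (-v) = s v)
    (F : ∀ (n : ℕ) (P : ℕ → RR) (c : ℕ → ℝ) (k : ℕ → ℕ) (N : ℕ) (l : ℕ → ℝ), 0 < n → P n = P 0 →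
        (∀ i < n, 0 ≤ c i ∧ P (i + 1) = P i + c i • (if k i % 2 = 0 then b (k i / 2) else -b (k i / 2))) →
        (∀ i, 0 ≤ l i) → ∑ i ∈ range N, l i = 1 →
        π / 2 * (qf a l N * |1 / 2 * ∑ i ∈ range n, wd (P i) (P (i + 1))|) ≤
        (1 - ε) / (4 * π) * (∑ i ∈ range n, c i * s (if k i % 2 = 0 then b (k i / 2) else -b (k i / 2))) ^ 2 +
        π * ∑ i ∈ range n, (c i * s (if k i % 2 = 0 then b (k i / 2) else -b (k i / 2))) ^ 2)
    {n : ℕ} {P : ℕ → RR} {c : ℕ → ℝ} {k : ℕ → ℕ} {N : ℕ} {l : ℕ → ℝ} (hn : 0 < n) (hP : P n = P 0)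
    (hc : ∀ i < n, P (i + 1) = P i + c i • b (k i)) (l0 : ∀ i, 0 ≤ l i) (l1 : ∑ i ∈ range N, l i = 1) :
    π / 2 * (qf a l N * |1 / 2 * ∑ i ∈ range n, wd (P i) (P (i + 1))|) ≤
        (1 - ε) / (4 * π) * (∑ i ∈ range n, |c i| * s (b (k i))) ^ 2 := by
  have key : ∀ H' : ℕ, π / 2 * (qf a l N * |1 / 2 * ∑ i ∈ range n, wd (P i) (P (i + 1))|) ≤
      (1 - ε) / (4 * π) * (∑ i ∈ range n, |c i| * s (b (k i))) ^ 2 +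
      (π * ∑ i ∈ range n, (|c i| * s (b (k i))) ^ 2) * (1 / ((H' : ℝ) + 1)) := by
    intro H'
    set H := H' + 1 with hH
    have H0 : 0 < H := by omega
    have eH : (H' : ℝ) + 1 = H := by rw [hH]; push_cast; ring
    set P' : ℕ → RR := fun i => P (i / H) + (((i % H : ℕ) : ℝ) / H * c (i / H)) • b (k (i / H)) with hP'
    have d1 : ∀ r h, h < H → (r * H + h) / H = r := fun r h hh => by
      rw [mul_comm, Nat.mul_add_div H0, Nat.div_eq_of_lt hh, add_zero]
    have d2 : ∀ r h, h < H → (r * H + h) % H = h := fun r h hh => by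
      rw [mul_comm, Nat.mul_add_mod, Nat.mod_eq_of_lt hh]
    have st : ∀ r < n, ∀ h < H, P' (r * H + h + 1) = P' (r * H + h) + (c r / H) • b (k r) := by
      intro r hr h hh
      simp only [hP', d1 r h hh, d2 r h hh]
      by_cases h' : h + 1 < H
      · rw [add_assoc, d1 r _ h', d2 r _ h', add_assoc, ← add_smul]
        congr 2; push_cast; field_simp
      · have e : h + 1 = H := by omega
        have e2 : r * H + h + 1 = (r + 1) * H + 0 := by rw [add_assoc, e]; ring
        have e3 : (h : ℝ) = H - 1 := by rw [← e]; push_cast; ring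
        rw [e2, d1 _ 0 H0, d2 _ 0 H0, hc r hr, e3]
        simp only [Nat.cast_zero, zero_div, zero_mul, zero_smul, add_zero]
        rw [add_assoc, ← add_smul]
        congr 2; field_simp; ring
    have ks : ∀ r, (if (2 * k r + if c r < 0 then 1 else 0) % 2 = 0 then b ((2 * k r + if c r < 0 then 1 else 0) / 2)
        else -b ((2 * k r + if c r < 0 then 1 else 0) / 2)) = if c r < 0 then - b (k r) else b (k r) := fun r => by
      by_cases h : c r < 0
      · have : (2 * k r + 1) / 2 = k r := by omega
        simp [h, this, Nat.add_mod]
      · simp [h]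
    have ss : ∀ r, s (if c r < 0 then - b (k r) else b (k r)) = s (b (k r)) := fun r => by
      split_ifs
      · exact sn _
      · rfl
    have := F (n * H) P' (fun i => |c (i / H)| / H) (fun i => 2 * k (i / H) + if c (i / H) < 0 then 1 else 0) N l
      (Nat.mul_pos hn H0) (by
        have h1 := d1 n 0 H0
        have h2 := d2 n 0 H0
        rw [add_zero] at h1 h2
        simp [hP', h1, hP]) (by
        intro i hi
        refine ⟨by positivity, ?_⟩
        have hr : i / H < n := by rw [mul_comm] at hi; exact Nat.div_lt_of_lt_mul hi
        have e : i = i / H * H + i % H := by rw [mul_comm]; exact (Nat.div_add_mod i H).symm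
        have := st (i / H) hr (i % H) (Nat.mod_lt _ H0)
        rw [← e] at this
        simp only [ks]
        rw [this]
        congr 1
        split_ifs with h
        · rw [abs_of_neg h, smul_neg, neg_div, neg_smul, neg_neg]
        · rw [abs_of_nonneg (not_lt.1 h)]) l0 l1
    simp only [ks, ss] at this
    rw [sum_rm, sum_rm, sum_rm] at this
    have s1 : ∑ r ∈ range n, ∑ h ∈ range H, wd (P' (r * H + h)) (P' (r * H + h + 1)) = ∑ r ∈ range n, wd (P r) (P (r + 1)) := by
      refine sum_congr rfl fun r hr => ?_
      have hr := mem_range.1 hr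
      have : ∀ h ∈ range H, wd (P' (r * H + h)) (P' (r * H + h + 1)) = 1 / H * wd (P r) (P (r + 1)) := fun h hh => by
        have hh := mem_range.1 hh
        rw [st r hr h hh, hc r hr]
        simp only [hP', d1 r h hh, d2 r h hh, wd, Prod.fst_add, Prod.snd_add, Prod.smul_fst, Prod.smul_snd, smul_eq_mul]
        field_simp; ring
      rw [sum_congr rfl this, sum_const, card_range, nsmul_eq_mul]
      field_simp
    have s2 : ∑ r ∈ range n, ∑ h ∈ range H, |c ((r * H + h) / H)| / H * s (b (k ((r * H + h) / H))) = ∑ r ∈ range n, |c r| * s (b (k r)) := by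
      refine sum_congr rfl fun r _ => ?_
      rw [sum_congr rfl fun h hh => by rw [d1 r h (mem_range.1 hh)], sum_const, card_range, nsmul_eq_mul]
      field_simp
    have s3 : ∑ r ∈ range n, ∑ h ∈ range H, (|c ((r * H + h) / H)| / H * s (b (k ((r * H + h) / H)))) ^ 2 = (∑ r ∈ range n, (|c r| * s (b (k r))) ^ 2) * (1 / H) := by
      rw [sum_mul]
      refine sum_congr rfl fun r _ => ?_
      rw [sum_congr rfl fun h hh => by rw [d1 r h (mem_range.1 hh)], sum_const, card_range, nsmul_eq_mul]
      field_simp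
    rw [s1, s2, s3] at this
    rw [eH]
    linarith
  have lim := (tendsto_one_div_add_atTop_nhds_zero_nat (𝕜 := ℝ)).const_mul (π * ∑ i ∈ range n, (|c i| * s (b (k i))) ^ 2)
  have lim' := lim.const_add ((1 - ε) / (4 * π) * (∑ i ∈ range n, |c i| * s (b (k i))) ^ 2)
  rw [mul_zero, add_zero] at lim'
  exact ge_of_tendsto' lim' key

lemma wd_sum_right (x : RR) (f : ℕ → RR) (n : ℕ) : wd x (∑ i ∈ range n, f i) = ∑ i ∈ range n, wd x (f i) := by
  simp only [wd, Prod.fst_sum, Prod.snd_sum, mul_sum, sum_sub_distrib]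

lemma tri_sum {e : ℕ → RR} {n : ℕ} (h : ∀ i j, i < j → j < n → 0 ≤ wd (e i) (e j)) :
    ∑ r ∈ range n, wd (∑ i ∈ range r, e i) (e r) =
      1 / 2 * ∑ i ∈ range n, ∑ j ∈ range n, |wd (e i) (e j)| := by
  induction n with
  | zero => simp
  | succ n ih =>
    have ws : ∀ x y : RR, wd x y = - wd y x := fun x y => by simp only [wd]; ring
    have e1 : wd (∑ i ∈ range n, e i) (e n) = ∑ i ∈ range n, |wd (e i) (e n)| := by
      rw [ws, wd_sum_right, ← Finset.sum_neg_distrib]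
      refine sum_congr rfl fun i hi => ?_
      grind
    rw [sum_range_succ, ih fun i j hij hj => h i j hij OM, e1, sum_range_succ (n := n)]
    simp only [sum_range_succ (n := n)]
    have e0 : |wd (e n) (e n)| = 0 := by simp [wd]; ring
    rw [sum_add_distrib, e0]
    grind

lemma polyg {a b : ℕ → RR} {s : RR → ℝ} {ε : ℝ} {N : ℕ} {l : ℕ → ℝ}
    (F : ∀ (n : ℕ) (P : ℕ → RR) (c : ℕ → ℝ) (k : ℕ → ℕ), 0 < n → P n = P 0 →
      (∀ i < n, P (i + 1) = P i + c i • b (k i)) → π / 2 * (qf a l N * |1 / 2 * ∑ i ∈ range n, wd (P i) (P (i + 1))|) ≤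
        (1 - ε) / (4 * π) * (∑ i ∈ range n, |c i| * s (b (k i))) ^ 2)
    (hb : ∀ k, 0 < (b k).1) (sp : ∀ k, 0 < s (b k)) {n : ℕ} (hn : 0 < n) {μ : ℕ → ℝ} (m0 : ∀ i, 0 ≤ μ i) (m1 : ∑ i ∈ range n, μ i = 1) :
    π / 4 * (qf a l N * qf (fun k => (s (b k))⁻¹ • b k) μ n) ≤ (1 - ε) / π := by
  set f : Fin n → ℝ := fun i => (b i).2 / (b i).1 with hf
  set σ : ℕ → ℕ := fun i => if h : i < n then Tuple.sort f ⟨i, h⟩ else i with hσ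
  have σs : ∀ g : ℕ → ℝ, ∑ i ∈ range n, g (σ i) = ∑ i ∈ range n, g i := fun g => by
    rw [← Fin.sum_univ_eq_sum_range (fun i => g (σ i)), ← Fin.sum_univ_eq_sum_range g, ← Equiv.sum_comp (Tuple.sort f) (fun i : Fin n => g i)]
    simp_all
  have σm : ∀ i j, i < j → j < n → (b (σ i)).2 / (b (σ i)).1 ≤ (b (σ j)).2 / (b (σ j)).1 := fun i j hij hj => by
    have := Tuple.monotone_sort f (show (⟨i, hij.trans hj⟩ : Fin n) ≤ ⟨j, hj⟩ from hij.le)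
    grind
  set w : ℕ → ℝ := fun i => μ (σ i) * (s (b (σ i)))⁻¹ with hw
  have w0 : ∀ i, 0 ≤ w i := fun i => mul_nonneg (m0 _) (inv_nonneg.2 (sp _).le)
  set e : ℕ → RR := fun i => w i • b (σ i) with he
  have wds : ∀ (x y : ℝ) (u v : RR), wd (x • u) (y • v) = x * y * wd u v := fun x y u v => by
    simp only [wd, Prod.smul_fst, Prod.smul_snd, smul_eq_mul]; ring
  have epos : ∀ i j, i < j → j < n → 0 ≤ wd (e i) (e j) := fun i j hij hj => by
    have h1 := σm i j hij hj
    rw [div_le_div_iff₀ (hb _) (hb _)] at h1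
    simp only [he, wds]
    refine mul_nonneg (mul_nonneg (w0 _) (w0 _)) ?_
    simp only [wd]; linarith
  set E : ℕ → RR := fun i => if i < n then e i else - e (i - n) with hE
  set P : ℕ → RR := fun i => ∑ j ∈ range i, E j with hP
  have E1 : ∀ i < n, E i = e i := fun i hi => by simp [hE, hi]
  have E2 : ∀ i, E (n + i) = - e i := fun i => by simp [hE]
  have P1 : ∀ i ≤ n, P i = ∑ j ∈ range i, e j := fun i hi =>
    sum_congr rfl fun j hj => E1 j (by have := mem_range.1 hj; omega)
  have P2 : ∀ i, P (n + i) = P n - ∑ j ∈ range i, e j := fun i => by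
    simp only [hP]
    rw [sum_range_add, sum_congr rfl fun j _ => E2 j, Finset.sum_neg_distrib, sub_eq_add_neg]
  have Ps : ∀ i, P (i + 1) = P i + E i := fun i => sum_range_succ _ _
  have wP : ∀ i, wd (P i) (P (i + 1)) = wd (P i) (E i) := fun i => by
    rw [Ps]; simp only [wd, Prod.fst_add, Prod.snd_add]; ring
  have key := F (n + n) P (fun i => if i < n then w i else - w (i - n)) (fun i => if i < n then σ i else σ (i - n)) OM
    (by rw [P2, P1 n le_rfl, sub_self]; simp [hP]) (fun i _ => by
      rw [Ps]
      congr 1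
      simp only [hE]
      split_ifs with h
      · rfl
      · rw [neg_smul])
  have A : ∑ i ∈ range (n + n), wd (P i) (P (i + 1)) = qf (fun k => (s (b k))⁻¹ • b k) μ n := by
    rw [sum_congr rfl fun i _ => wP i, sum_range_add]
    have t1 : ∑ i ∈ range n, wd (P i) (E i) = ∑ r ∈ range n, wd (∑ i ∈ range r, e i) (e r) :=
      sum_congr rfl fun i hi => by rw [E1 i (mem_range.1 hi), P1 i (mem_range.1 hi).le]
    have t2 : ∑ i ∈ range n, wd (P (n + i)) (E (n + i)) = ∑ r ∈ range n, (wd (∑ i ∈ range r, e i) (e r) - wd (P n) (e r)) :=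
      sum_congr rfl fun i hi => by
        rw [E2, P2]; simp only [wd, Prod.fst_sub, Prod.snd_sub, Prod.fst_neg, Prod.snd_neg]; ring
    have t3 : ∑ r ∈ range n, wd (P n) (e r) = 0 := by
      rw [← wd_sum_right, ← P1 n le_rfl]; simp only [wd]; ring
    rw [t1, t2, sum_sub_distrib, t3, tri_sum epos, qf]
    have t4 : ∀ i j, |wd (e i) (e j)| = μ (σ i) * μ (σ j) * |wd ((s (b (σ i)))⁻¹ • b (σ i)) ((s (b (σ j)))⁻¹ • b (σ j))| := fun i j => by
      simp only [he, hw]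
      rw [mul_smul, mul_smul, wds, abs_mul, abs_of_nonneg (mul_nonneg (m0 _) (m0 _))]
    simp only [t4]
    rw [← σs fun i => ∑ j ∈ range n, μ i * μ j * |wd ((s (b i))⁻¹ • b i) ((s (b j))⁻¹ • b j)|]
    rw [sum_congr rfl fun i _ => σs fun j => μ (σ i) * μ j * |wd ((s (b (σ i)))⁻¹ • b (σ i)) ((s (b j))⁻¹ • b j)|]
    ring
  have len : ∑ i ∈ range (n + n), |if i < n then w i else - w (i - n)| * s (b (if i < n then σ i else σ (i - n))) = 2 := by
    have h1 : ∀ i, w i * s (b (σ i)) = μ (σ i) := fun i => by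
      simp only [hw]; rw [mul_assoc, inv_mul_cancel₀ (sp _).ne', mul_one]
    have t1 : ∑ i ∈ range n, |if i < n then w i else - w (i - n)| * s (b (if i < n then σ i else σ (i - n))) = ∑ i ∈ range n, μ (σ i) :=
      sum_congr rfl fun i hi => by simp [mem_range.1 hi, abs_of_nonneg (w0 i), h1]
    have t2 : ∑ i ∈ range n, |if n + i < n then w (n + i) else - w (n + i - n)| * s (b (if n + i < n then σ (n + i) else σ (n + i - n))) = ∑ i ∈ range n, μ (σ i) :=
      sum_congr rfl fun i hi => by simp [abs_of_nonneg (w0 i), h1]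
    rw [sum_range_add, t1, t2, σs μ, m1]; norm_num
  have q0 : 0 ≤ qf (fun k => (s (b k))⁻¹ • b k) μ n := sum_nonneg fun i _ => sum_nonneg fun j _ =>
    mul_nonneg (mul_nonneg (m0 i) (m0 j)) (abs_nonneg _)
  rw [A, len, abs_of_nonneg (mul_nonneg NN q0)] at key
  have e4 : (1 - ε) / (4 * π) * 2 ^ 2 = (1 - ε) / π := by field_simp; ring
  linarith

lemma dbody_lim {v : ℕ → RR} {i j : ℕ} (h : wd (v i) (v j) ≠ 0) :
    IsCompact {x | ∀ i, |wd x (v i)| ≤ 1} ∧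
    Tendsto (fun n => (volume (dbody v n)).toReal) atTop (nhds (volume {x | ∀ i, |wd x (v i)| ≤ 1}).toReal) := by
  have e : {x | ∀ i, |wd x (v i)| ≤ 1} = ⋂ n, dbody v n := by
    ext x
    simp only [dbody, Set.mem_iInter, mem_ofPred_eq]
    exact ⟨fun h n i _ => h i, fun h i => h (i + 1) i OM⟩
  have cl : ∀ n, IsClosed (dbody v n) := fun n => by
    simp only [dbody, ofPred_forall]
    refine isClosed_iInter fun i => isClosed_iInter fun _ => ?_
    exact isClosed_le (by unfold wd; fun_prop) continuous_const
  have cp : IsCompact (dbody v (i + j + 1)) := dbody_cpt OM OM h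
  rw [e]
  refine ⟨cp.of_isClosed_subset (isClosed_iInter cl) (Set.iInter_subset _ _), ?_⟩
  refine (ENNReal.tendsto_toReal ?_).comp (tendsto_measure_iInter_atTop (fun n => (cl n).measurableSet.nullMeasurableSet)
    (fun n m hnm x hx i hi => hx i OM) ⟨_, cp.measure_lt_top.ne⟩)
  exact ((measure_mono (Set.iInter_subset _ _)).trans_lt cp.measure_lt_top).ne

lemma normfin {a b : ℕ → RR} {s : RR → ℝ} {L ε : ℝ} (h0 : 0 < ε) (he : ε ≤ 1)
    (s1 : ∀ j v, |ip (a j) v| ≤ s v) (s2 : ∀ v B, (∀ j, |ip (a j) v| ≤ B) → s v ≤ B) (sL : ∀ v, s v ≤ L * ‖v‖)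
    (hb : ∀ k, 0 < (b k).1) (bd : ∀ v : RR, 0 < v.1 → v ∈ closure (Set.range b)) (sb : ∀ k, ‖b k‖ ≤ s (b k))
    (F : ∀ (n N : ℕ) (l μ : ℕ → ℝ), 0 < n → (∀ i, 0 ≤ l i) → ∑ i ∈ range N, l i = 1 →
      (∀ i, 0 ≤ μ i) → ∑ i ∈ range n, μ i = 1 →
      π / 4 * (qf a l N * qf (fun k => (s (b k))⁻¹ • b k) μ n) ≤ (1 - ε) / π) : False := by
  have ipn : ∀ x v, ip x (-v) = - ip x v := fun x v => by simp [ip]; ring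
  have ipa : ∀ x v w, ip x (v + w) = ip x v + ip x w := fun x v w => by simp [ip]; ring
  have sn' : ∀ v, s (-v) ≤ s v := fun v => s2 _ _ fun j => by rw [ipn, abs_neg]; exact s1 j v
  have sn : ∀ v, s (-v) = s v := fun v => le_antisymm (sn' v) (by simpa using sn' (-v))
  have sa : ∀ v w, s (v + w) ≤ s v + s w := fun v w => s2 _ _ fun j => by
    rw [ipa]; exact (abs_add_le _ _).trans (add_le_add (s1 j v) (s1 j w))
  have s0 : ∀ v, 0 ≤ s v := fun v => (abs_nonneg _).trans (s1 0 v)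
  have L0 : 0 ≤ L := by
    have := (s0 ((1:ℝ), (0:ℝ))).trans (sL _)
    simpa using this
  have sc : Continuous s := by
    refine LipschitzWith.continuous (K := ⟨L, L0⟩) (LipschitzWith.of_dist_le_mul fun v w => ?_)
    rw [dist_eq, dist_eq_norm]
    show _ ≤ L * _
    have t1 := sa (v - w) w
    have t2 := sa (w - v) v
    rw [sub_add_cancel] at t1 t2
    have t3 := sn (v - w)
    rw [neg_sub] at t3
    have t4 := sL (v - w)
    rw [abs_le]; constructor <;> linarith
  have ext : ∀ f : RR → ℝ, Continuous f → (∀ v, f (-v) = f v) → (∀ k, f (b k) ≤ s (b k)) → ∀ v, f v ≤ s v := by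
    intro f fc fn fb
    have hcl : IsClosed {v | f v ≤ s v} := isClosed_le fc sc
    have p1 : ∀ v : RR, 0 < v.1 → f v ≤ s v := fun v hv =>
      closure_minimal (by rintro _ ⟨k, rfl⟩; exact fb k) hcl (bd v hv)
    have p2 : ∀ v : RR, v.1 ≠ 0 → f v ≤ s v := fun v hv => by
      rcases lt_or_gt_of_ne hv with h | h
      · rw [← fn, ← sn]; exact p1 _ (by simpa using h)
      · exact p1 v h
    intro v
    by_cases hv : v.1 = 0
    · have tt : Tendsto (fun m : ℕ => v + ((1 / ((m:ℝ) + 1), (0:ℝ)) : RR)) atTop (nhds v) := by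
        have := (tendsto_one_div_add_atTop_nhds_zero_nat (𝕜 := ℝ)).prodMk_nhds (tendsto_const_nhds (x := (0:ℝ)))
        have := this.const_add v
        rwa [show v + ((0:ℝ), (0:ℝ)) = v from add_zero v] at this
      exact hcl.mem_of_tendsto tt (.of_forall fun m => p2 _ (by
        simp only [Prod.fst_add, hv, zero_add]; positivity))
    · exact p2 v hv
  have snorm := ext (fun v => ‖v‖) continuous_norm (fun v => norm_neg v) sb
  have bn : ∀ k, 0 < s (b k) := fun k => (norm_pos_iff.2 fun h => (hb k).ne' (by rw [h]; rfl)).trans_le (sb k)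
  have wdn : ∀ x v, wd x (-v) = - wd x v := fun x v => by simp [wd]; ring
  have sz : ∀ v, (∀ j, ip (a j) v = 0) → v = 0 := fun v h => by
    have := (snorm v).trans (s2 v 0 fun j => by rw [h j, abs_zero])
    exact norm_le_zero_iff.1 this
  have na : ∃ i j, wd (a i) (a j) ≠ 0 := by
    by_contra hcon
    push Not at hcon
    have ha : ∀ i, a i = 0 := fun i => by
      have := sz (-(a i).2, (a i).1) fun j => by have := hcon i j; simp only [ip, wd] at this ⊢; linarith
      simp only [Prod.mk_eq_zero, neg_eq_zero] at this
      exact Prod.ext this.2 this.1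
    have := sz (1, 0) fun j => by rw [ha]; simp [ip]
    simp at this
  set c : ℕ → RR := fun k => (s (b k))⁻¹ • b k with hc
  have wc : ∀ x k, |wd x (c k)| = (s (b k))⁻¹ * |wd x (b k)| := fun x k => by
    have : wd x (c k) = (s (b k))⁻¹ * wd x (b k) := by simp [hc, wd]; ring
    rw [this, abs_mul, abs_of_pos (inv_pos.2 (bn k))]
  have wcs : ∀ ξ, (∀ k, |wd ξ (c k)| ≤ 1) → ∀ v, |wd ξ v| ≤ s v := fun ξ h =>
    ext (fun v => |wd ξ v|) (by unfold wd; fun_prop) (fun v => by rw [wdn, abs_neg]) fun k => by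
      have := h k
      rw [wc, inv_mul_le_iff₀ (bn k), mul_one] at this
      exact this
  have nc : ∃ i j, wd (c i) (c j) ≠ 0 := by
    by_contra hcon
    push Not at hcon
    have hz : ∀ t : ℝ, ∀ v, |wd (t • c 0) v| ≤ s v := fun t => wcs _ fun k => by
      have : wd (t • c 0) (c k) = t * wd (c 0) (c k) := by simp [wd]; ring
      rw [this, hcon]; simp
    have c0 : 0 < (c 0).1 := by simp only [hc, Prod.smul_fst, smul_eq_mul]; exact mul_pos (inv_pos.2 (bn 0)) (hb 0)
    have := hz ((s (0, 1) + 1) / (c 0).1) (0, 1)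
    simp only [wd, Prod.smul_fst, smul_eq_mul, mul_one, mul_zero, sub_zero, div_mul_cancel₀ _ c0.ne'] at this
    linarith [le_abs_self (s (0, 1) + 1)]
  obtain ⟨i, j, hij⟩ := na
  obtain ⟨i', j', hij'⟩ := nc
  obtain ⟨cS, lS⟩ := dbody_lim hij
  obtain ⟨cT, lT⟩ := dbody_lim hij'
  have sym : ∀ w : ℕ → RR, ∀ x ∈ {x | ∀ i, |wd x (w i)| ≤ 1}, -x ∈ {x | ∀ i, |wd x (w i)| ≤ 1} := fun w x hx i => by
    have e : wd (-x) (w i) = -wd x (w i) := by simp [wd]; ring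
    grind
  have san := santalo cS cT (sym a) (sym c) fun x hx ξ hξ => by
    have h1 := wcs ξ hξ (-x.2, x.1)
    have h2 : s (-x.2, x.1) ≤ 1 := s2 _ _ fun j => by
      have e : ip (a j) (-x.2, x.1) = wd x (a j) := by simp only [ip, wd]; ring
      rw [e]; exact hx j
    have h3 := (le_abs_self _).trans (h1.trans h2)
    simp only [wd] at h3
    linarith
  have san' := toReal_mono ofReal_ne_top san
  rw [toReal_mul, toReal_ofReal PP] at san'
  have hp := pi_pos
  have lim := (lS.mul lT).eventually_lt_const (u := (1 + ε) * π ^ 2) (by nlinarith [pow_pos hp 2])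
  obtain ⟨n, hn, hn'⟩ := (lim.and (eventually_gt_atTop (i + j + i' + j'))).exists
  obtain ⟨l, l0, l1, lq⟩ := maxw (v := a) (n := n) (i0 := i) (j0 := j) OM OM hij
  obtain ⟨μ, m0, m1, mq⟩ := maxw (v := c) (n := n) (i0 := i') (j0 := j') OM OM hij'
  have fin := F n n l μ OM l0 l1 m0 m1
  set A := (volume (dbody a n)).toReal
  set C := (volume (dbody c n)).toReal
  have q0 : ∀ (v : ℕ → RR) (l : ℕ → ℝ), (∀ i, 0 ≤ l i) → 0 ≤ qf v l n := fun v l l0 => sum_nonneg fun i _ => sum_nonneg fun j _ =>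
    mul_nonneg (mul_nonneg (l0 i) (l0 j)) (abs_nonneg _)
  have qq := mul_nonneg (q0 a l l0) (q0 c μ m0)
  have k1 : 4 ≤ (qf a l n * qf c μ n) * (A * C) := by nlinarith
  rw [le_div_iff₀ hp] at fin
  nlinarith

lemma exb : ∃ b : ℕ → RR, (∀ k, 0 < (b k).1) ∧ ∀ v : RR, 0 < v.1 → v ∈ closure (Set.range b) := by
  have : Nonempty {v : RR // 0 < v.1} := ⟨⟨(1, 0), one_pos⟩⟩
  obtain ⟨d, hd⟩ := TopologicalSpace.exists_dense_seq {v : RR // 0 < v.1}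
  refine ⟨fun k => (d k).1, fun k => (d k).2, fun v hv => ?_⟩
  have h := image_closure_subset_closure_image continuous_subtype_val (Set.mem_image_of_mem _ (hd ⟨v, hv⟩))
  rwa [← Set.range_comp] at h
end

end

/-- Theorem 1.1: if there are `ε > 0` and `s₀ > 0` such that every
Lipschitz loop in the geodesic metric space `X` of length at least `s₀` bounds a
singular Lipschitz disc in `X` of area at most `((1-ε)/(4π))·length²`, then `X` is
Gromov hyperbolic. -/
theorem isop_special_case {X : Type u} [MetricSpace X] (hX : GeodesicSpace X)
    (h : ∃ ε > (0:ℝ), ∃ s₀ > (0:ℝ), ∀ γ : ℝ → X, IsLipLoop γ → s₀ ≤ loopLength γ →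
      ∃ φ : ℝ × ℝ → X, BoundsLoop φ γ ∧
        lipArea φ ≤ (1 - ε) / (4 * Real.pi) * (loopLength γ) ^ 2) :
    GromovHyperbolic X := by
  obtain ⟨ε', h0', s₀, -, h'⟩ := h
  have h0 : 0 < min ε' 1 := lt_min h0' one_pos
  have he : min ε' 1 ≤ 1 := min_le_right _ _
  have h : Iso X (min ε' 1) s₀ := fun γ h1 h2 => by
    obtain ⟨φ, h3, h4⟩ := h' γ h1 h2
    refine ⟨φ, h3, h4.trans ?_⟩
    have := min_le_left ε' 1
    have := Real.pi_pos
    gcongr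
  set ε := min ε' 1
  by_contra nh
  obtain ⟨K, ρ, L, L0, hK, hv, rs, rt, -, rb, F⟩ := limA hX h h0 nh
  obtain ⟨b, hb, bd⟩ := exb
  obtain ⟨a, s, s1, s2, sL, sb, F0⟩ := blow L0 he hK hv rs rt rb F (fun j => if j % 2 = 0 then b (j / 2) else - b (j / 2))
  have sn' : ∀ v, s (-v) ≤ s v := fun v => s2 _ _ fun j => by
    rw [show ip (a j) (-v) = - ip (a j) v by simp [ip]; ring, abs_neg]; exact s1 j v
  have sn : ∀ v, s (-v) = s v := fun v => le_antisymm (sn' v) (by simpa using sn' (-v))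
  have sb' : ∀ k, ‖b k‖ ≤ s (b k) := fun k => by simpa using sb (2 * k)
  have sp : ∀ k, 0 < s (b k) := fun k => (norm_pos_iff.2 fun h => (hb k).ne' (by rw [h]; rfl)).trans_le (sb' k)
  exact normfin h0 he s1 s2 sL hb bd sb' fun n N l μ hn l0 l1 m0 m1 =>
    polyg (fun n P c k hn hP hc => F2 sn F0 hn hP hc l0 l1) hb sp hn m0 m1

end SharpIsop
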